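/- arXiv:1308.5560 — 7 statements merged into one kernel-verified Lean document; each statement's English description precedes it below -/
import Mathlib

section
/- Let h ∈ ℝ[x₀,…,xₙ] be homogeneous of degree d ≥ 1 with h(e) ≠ 0 where e = (1,0,…,0), and let R = ℝ[x₁,…,xₙ]. Suppose there exist k ∈ ℕ and homogeneous polynomials v₁,…,v_r ∈ ℝ[x₀,…,xₙ] of degree k such that: (a) (s−t)·Σ_{i=1}^r vᵢ(s)·vᵢ(t) lies in the ideal of R[s,t] generated by h(s) and h(t), where for f ∈ ℝ[x₀,…,xₙ] we write f(s) (resp. f(t)) for the result of substituting s (resp. t) for x₀; and (b) every homogeneous polynomial f ∈ ℝ[x₀,…,xₙ] of degree ≥ k is congruent modulo the ideal (h) to an R-linear combination a₁v₁ + … + a_r v_r with a₁,…,a_r ∈ R. Then there exist N ∈ ℕ and real symmetric N×N matrices A₁,…,Aₙ such that h divides det(x₀·I_N − (x₁A₁ + … + xₙAₙ)) in ℝ[x₀,…,xₙ]. -/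
open MvPolynomial

/-- Substituting the element `s` of `R[s,t] = (ℝ[x₁,…,xₙ])[X₀,X₁]` for `x₀` in a
polynomial `f ∈ ℝ[x₀,…,xₙ]` (the remaining variables `xⱼ₊₁` are sent to `xⱼ ∈ R`). -/
noncomputable def subs {n : ℕ} (s : MvPolynomial (Fin 2) (MvPolynomial (Fin n) ℝ))
    (f : MvPolynomial (Fin (n + 1)) ℝ) : MvPolynomial (Fin 2) (MvPolynomial (Fin n) ℝ) :=
  aeval (Fin.cases s (fun j => C (X j))) f

/-- Two triples `(c, a, b)`, consisting of a letter and two multisets of letters of prescribed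
sizes, with the same total content are connected by exchanging `c` with letters of `a` and of
`b`. -/
lemma eq_of_exchange_invariant {σ Q : Type*} [DecidableEq σ]
    (g : σ → (σ →₀ ℕ) → (σ →₀ ℕ) → Q) (p q : ℕ)
    (hleft : ∀ c c' a a' b, a.degree = p → a'.degree = p → b.degree = q →
      Finsupp.single c 1 + a = Finsupp.single c' 1 + a' → g c a b = g c' a' b)
    (hright : ∀ c c' a b b', a.degree = p → b.degree = q → b'.degree = q →
      Finsupp.single c 1 + b = Finsupp.single c' 1 + b' → g c a b = g c' a b')
    {c c' : σ} {a a' b b' : σ →₀ ℕ} (ha : a.degree = p) (ha' : a'.degree = p)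
    (hb : b.degree = q) (hb' : b'.degree = q)
    (heq : Finsupp.single c 1 + a + b = Finsupp.single c' 1 + a' + b') :
    g c a b = g c' a' b' := by
  induction hN : (a - a').degree using Nat.strong_induction_on generalizing c a b with
  | _ N ih =>
  by_cases hle : a ≤ a'
  · obtain ⟨e, rfl⟩ := exists_add_of_le hle
    have he : e = 0 := by
      rw [← Finsupp.degree_eq_zero_iff]
      simp only [map_add] at ha'
      omega
    subst he
    refine (hright c c' a b b' ha hb hb' ?_).trans (by simp)
    ext z
    have := DFunLike.congr_fun heq z
    simp only [Finsupp.add_apply, add_zero] at this ⊢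
    omega
  · obtain ⟨y, hy⟩ : ∃ y, a' y < a y := by
      by_contra! hcon
      exact hle hcon
    obtain ⟨x, hx⟩ : ∃ x, a x < a' x := by
      by_contra! hcon
      obtain ⟨e, rfl⟩ := exists_add_of_le (show a' ≤ a from hcon)
      have he : e = 0 := by
        rw [← Finsupp.degree_eq_zero_iff]
        simp only [map_add] at ha
        omega
      subst he
      simp at hy
    have hxy : x ≠ y := by
      rintro rfl
      omega
    obtain ⟨b₁, hb₁, hmove⟩ : ∃ b₁ : σ →₀ ℕ, b₁.degree = q ∧
        Finsupp.single c 1 + b = Finsupp.single x 1 + b₁ := by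
      have hpos : Finsupp.single x 1 ≤ Finsupp.single c 1 + b := by
        rw [Finsupp.single_le_iff]
        have := DFunLike.congr_fun heq x
        simp only [Finsupp.add_apply] at this ⊢
        omega
      obtain ⟨b₁, hb₁⟩ := exists_add_of_le hpos
      refine ⟨b₁, ?_, hb₁⟩
      have := congrArg Finsupp.degree hb₁
      simp only [map_add, Finsupp.degree_single] at this
      omega
    obtain ⟨e, rfl⟩ : ∃ e, a = Finsupp.single y 1 + e :=
      exists_add_of_le (Finsupp.single_le_iff.2 (by omega))
    rw [hright c x _ b b₁ ha hb hb₁ hmove]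
    have hd : (Finsupp.single x 1 + e).degree = p := by
      simpa only [map_add, Finsupp.degree_single] using ha
    rw [hleft x y _ (Finsupp.single x 1 + e) b₁ ha hd hb₁ (add_left_comm _ _ _)]
    refine ih _ ?_ hd hb₁ ?_ rfl
    · rw [← hN]
      have hsub : Finsupp.single y 1 + e - a' = Finsupp.single y 1 + (Finsupp.single x 1 + e - a') := by
        ext z
        simp only [Finsupp.add_apply, Finsupp.tsub_apply] at hx hy ⊢
        by_cases hzx : x = z <;> by_cases hzy : y = z <;> subst_vars <;>
          simp_all <;> omega
      rw [hsub, map_add, Finsupp.degree_single]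
      omega
    · rw [← heq]
      ext z
      have := DFunLike.congr_fun hmove z
      simp only [Finsupp.add_apply] at this ⊢
      omega

/-- A linear combination of a family that is constant on fibres vanishes when its coefficients
sum to zero on every fibre. -/
lemma sum_smul_eq_zero_of_fiberwise {ι κ K V : Type*} [DecidableEq κ] [Semiring K]
    [AddCommMonoid V] [Module K V] (s : Finset ι) (π : ι → κ) (c : ι → K) (g : ι → V)
    (hg : ∀ x ∈ s, ∀ y ∈ s, π x = π y → g x = g y)
    (hc : ∀ z, ∑ x ∈ s with π x = z, c x = 0) : ∑ x ∈ s, c x • g x = 0 := by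
  classical
  rw [← Finset.sum_fiberwise_of_maps_to (t := s.image π) (g := π)
    fun x hx => Finset.mem_image_of_mem π hx]
  refine Finset.sum_eq_zero fun z hz => ?_
  obtain ⟨y, hy, rfl⟩ := Finset.mem_image.1 hz
  rw [Finset.sum_congr rfl fun x hx => by
    rw [hg x (Finset.mem_filter.1 hx).1 y hy (Finset.mem_filter.1 hx).2], ← Finset.sum_smul,
    hc, zero_smul]

lemma Polynomial.Monic.coeff_eq_zero_of_dvd_sum {R : Type*} [CommRing R] {H : Polynomial R}
    (hH : H.Monic) (p : ℕ → R)
    (hp : H ∣ ∑ i ∈ Finset.range H.natDegree, Polynomial.C (p i) * Polynomial.X ^ i)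
    {i : ℕ} (hi : i < H.natDegree) : p i = 0 := by
  nontriviality R
  have h0 : ∑ i ∈ Finset.range H.natDegree, Polynomial.C (p i) * Polynomial.X ^ i = 0 := by
    by_contra hne
    refine hH.not_dvd_of_degree_lt hne ?_ hp
    rw [Polynomial.degree_eq_natDegree hH.ne_zero, Polynomial.degree_lt_iff_coeff_zero]
    intro m hm
    simp only [Polynomial.finsetSum_coeff, Polynomial.coeff_C_mul_X_pow]
    refine Finset.sum_eq_zero fun j hj => if_neg ?_
    have := Finset.mem_range.1 hj
    omega
  have := congrArg (fun P => Polynomial.coeff P i) h0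
  simpa [Polynomial.finsetSum_coeff, Polynomial.coeff_C_mul_X_pow, hi] using this

/-- Modulo `H(s)` and `H(t)` the monomials `s ^ i * t ^ j` with `i, j < deg H` are linearly
independent. -/
lemma coeff_eq_zero_of_mem_span_aeval {R : Type*} [CommRing R] {H : Polynomial R}
    (hH : H.Monic) (p : ℕ → ℕ → R)
    (hp : ∑ i ∈ Finset.range H.natDegree, ∑ j ∈ Finset.range H.natDegree,
        (C (p i j) * X 0 ^ i * X 1 ^ j : MvPolynomial (Fin 2) R) ∈
      Ideal.span {Polynomial.aeval (X 0) H, Polynomial.aeval (X 1) H})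
    {i j : ℕ} (hi : i < H.natDegree) (hj : j < H.natDegree) : p i j = 0 := by
  nontriviality R
  let A := AdjoinRoot H
  have hA : Nontrivial A := by
    refine nontrivial_of_ne 1 0 fun h => ?_
    rw [← map_one (AdjoinRoot.mk H), AdjoinRoot.mk_eq_zero] at h
    refine hH.not_dvd_of_degree_lt one_ne_zero ?_ h
    rw [Polynomial.degree_one, ← Polynomial.natDegree_pos_iff_degree_pos]
    omega
  let φ : MvPolynomial (Fin 2) R →ₐ[R] Polynomial A :=
    aeval ![Polynomial.C (AdjoinRoot.root H), Polynomial.X]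
  have hφ0 : φ (X 0) = Polynomial.C (AdjoinRoot.root H) := by simp [φ]
  have hφ1 : φ (X 1) = Polynomial.X := by simp [φ]
  have hφC (r : R) : φ (C r) = Polynomial.C (AdjoinRoot.of H r) := by
    rw [← MvPolynomial.algebraMap_eq, AlgHom.commutes]
    rfl
  have hs : φ (Polynomial.aeval (X 0) H) = 0 := by
    rw [← Polynomial.aeval_algHom_apply, hφ0]
    have : (Polynomial.aeval (Polynomial.C (AdjoinRoot.root H))) H
        = Polynomial.C ((Polynomial.aeval (AdjoinRoot.root H)) H) := by
      rw [← Polynomial.CAlgHom_apply (R := R), Polynomial.aeval_algHom_apply]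
      rfl
    rw [this, AdjoinRoot.aeval_eq, AdjoinRoot.mk_self, Polynomial.C_0]
  have ht : φ (Polynomial.aeval (X 1) H) = H.map (AdjoinRoot.of H) := by
    rw [← Polynomial.aeval_algHom_apply, hφ1, Polynomial.aeval_X_left_eq_map]
    rfl
  have hdvd : H.map (AdjoinRoot.of H) ∣ φ (∑ i ∈ Finset.range H.natDegree,
      ∑ j ∈ Finset.range H.natDegree, C (p i j) * X 0 ^ i * X 1 ^ j) := by
    obtain ⟨a, b, hab⟩ := Ideal.mem_span_pair.1 hp
    rw [← hab, map_add, map_mul, map_mul, hs, ht, mul_zero, zero_add]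
    exact Dvd.intro_left _ rfl
  have hdeg : (H.map (AdjoinRoot.of H)).natDegree = H.natDegree := hH.natDegree_map _
  have hroot : ∑ i ∈ Finset.range H.natDegree,
      AdjoinRoot.of H (p i j) * AdjoinRoot.root H ^ i = 0 := by
    refine (hH.map (AdjoinRoot.of H)).coeff_eq_zero_of_dvd_sum
      (fun j => ∑ i ∈ Finset.range H.natDegree,
        AdjoinRoot.of H (p i j) * AdjoinRoot.root H ^ i) ?_ (hdeg.symm ▸ hj)
    rw [hdeg]
    convert hdvd using 1
    rw [Finset.sum_comm, map_sum]
    refine Finset.sum_congr rfl fun j _ => ?_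
    simp only [map_sum, map_mul, map_pow, hφ0, hφ1, hφC, Finset.sum_mul]
  refine hH.coeff_eq_zero_of_dvd_sum (fun i => p i j) ?_ hi
  rw [← AdjoinRoot.mk_eq_zero]
  simpa using hroot

lemma MvPolynomial.IsHomogeneous.natDegree_finSuccEquiv_le {n d : ℕ} {R : Type*} [CommSemiring R]
    {h : MvPolynomial (Fin (n + 1)) R} (hhom : h.IsHomogeneous d) :
    (finSuccEquiv R n h).natDegree ≤ d := by
  rw [natDegree_finSuccEquiv]
  exact (degreeOf_le_totalDegree _ _).trans hhom.totalDegree_le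

lemma MvPolynomial.IsHomogeneous.coeff_finSuccEquiv_self {n d : ℕ} {R : Type*} [CommSemiring R]
    {h : MvPolynomial (Fin (n + 1)) R} (hhom : h.IsHomogeneous d) :
    (finSuccEquiv R n h).coeff d = C (eval (Fin.cons 1 0 : Fin (n + 1) → R) h) := by
  have hcoeff (i j : ℕ) (hij : i + j = d) :
      eval (0 : Fin n → R) ((finSuccEquiv R n h).coeff i) = if j = 0 then
        coeff 0 ((finSuccEquiv R n h).coeff i) else 0 := by
    rw [← constantCoeff_eq, ← eval_zero]
    split_ifs with hj
    · rfl
    · have := hhom.finSuccEquiv_coeff_isHomogeneous i j hij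
      rw [eval_zero, constantCoeff_eq]
      exact this.coeff_eq_zero (by simpa using Ne.symm hj)
  have h0 := (totalDegree_zero_iff_isHomogeneous _).2
    (hhom.finSuccEquiv_coeff_isHomogeneous d 0 (add_zero d))
  rw [totalDegree_eq_zero_iff_eq_C.1 h0]
  congr 1
  have heval := eval_eq_eval_mv_eval' (0 : Fin n → R) 1 h
  change _ = eval (Fin.cons 1 0 : Fin (n + 1) → R) h
  rw [heval, Polynomial.eval_eq_sum_range' (n := d + 1)
    ((Polynomial.natDegree_map_le).trans_lt (Nat.lt_succ_of_le hhom.natDegree_finSuccEquiv_le)),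
    Finset.sum_range_succ, Finset.sum_eq_zero]
  · simp [constantCoeff_eq]
  · intro i hi
    have := Finset.mem_range.1 hi
    rw [Polynomial.coeff_map, hcoeff i (d - i) (by omega), if_neg (by omega), zero_mul]

/-- The multiple of `h` that is monic in the first variable. -/
lemma exists_monic_finSuccEquiv {n d : ℕ} {h : MvPolynomial (Fin (n + 1)) ℝ}
    (hhom : h.IsHomogeneous d) (hne : eval (Fin.cons 1 0 : Fin (n + 1) → ℝ) h ≠ 0) :
    ∃ c : ℝ, c ≠ 0 ∧ (finSuccEquiv ℝ n (C c * h)).Monic ∧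
      (finSuccEquiv ℝ n (C c * h)).natDegree = d := by
  refine ⟨(eval (Fin.cons 1 0 : Fin (n + 1) → ℝ) h)⁻¹, inv_ne_zero hne, ?_⟩
  set c := (eval (Fin.cons 1 0 : Fin (n + 1) → ℝ) h)⁻¹
  have hhom' : (C c * h).IsHomogeneous d := hhom.C_mul c
  have hc : (finSuccEquiv ℝ n (C c * h)).coeff d = 1 := by
    rw [hhom'.coeff_finSuccEquiv_self]
    simp [c, hne]
  have hdeg := le_antisymm hhom'.natDegree_finSuccEquiv_le
    (Polynomial.le_natDegree_of_ne_zero (hc.symm ▸ one_ne_zero))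
  exact ⟨by rw [Polynomial.Monic, Polynomial.leadingCoeff, hdeg, hc], hdeg⟩

section

attribute [local instance] MvPolynomial.gradedAlgebra

lemma MvPolynomial.homogeneousComponent_mul_of_right {σ R : Type*} [CommSemiring R]
    {p q : MvPolynomial σ R} {k : ℕ} (e : ℕ) (hq : q.IsHomogeneous k) :
    homogeneousComponent (e + k) (p * q) = homogeneousComponent e p * q := by
  have := DirectSum.coe_decompose_mul_add_of_right_mem (homogeneousSubmodule σ R) (i := e) (a := p)
    ((mem_homogeneousSubmodule k q).2 hq)
  rw [← decomposition.decompose'_apply, ← decomposition.decompose'_apply]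
  exact this

lemma MvPolynomial.IsHomogeneous.dvd_homogeneousComponent {σ R : Type*} [CommRing R]
    {h f : MvPolynomial σ R} {d : ℕ} (hh : h.IsHomogeneous d) (hf : h ∣ f) (m : ℕ) :
    h ∣ homogeneousComponent m f := by
  rw [← Ideal.mem_span_singleton] at hf ⊢
  refine homogeneousComponent_mem_of_mem (Ideal.homogeneous_span _ _ ?_) hf m
  rintro x rfl
  exact ⟨d, (mem_homogeneousSubmodule d x).2 hh⟩

end

lemma MvPolynomial.IsHomogeneous.eq_sum_C_mul_X {σ R : Type*} [Fintype σ] [CommSemiring R]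
    {p : MvPolynomial σ R} (hp : p.IsHomogeneous 1) :
    p = ∑ l, C (coeff (Finsupp.single l 1) p) * X l := by
  classical
  ext m
  simp only [coeff_sum, coeff_C_mul, coeff_X, mul_ite, mul_one, mul_zero]
  by_cases hm : m.degree = 1
  · obtain ⟨l, rfl⟩ : ∃ l, m = Finsupp.single l 1 := by
      have hm0 : m ≠ 0 := by
        rintro rfl
        simp at hm
      obtain ⟨l, hl⟩ := Finsupp.support_nonempty_iff.2 hm0
      obtain ⟨e, rfl⟩ := exists_add_of_le
        (Finsupp.single_le_iff.2 (Nat.one_le_iff_ne_zero.2 (Finsupp.mem_support_iff.1 hl)))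
      have he : e = 0 := by
        rw [← Finsupp.degree_eq_zero_iff]
        simp only [map_add, Finsupp.degree_single] at hm
        omega
      exact ⟨l, by rw [he, add_zero]⟩
    simp [Finsupp.single_left_inj]
  · rw [hp.coeff_eq_zero hm, Finset.sum_eq_zero]
    intro l _
    refine if_neg ?_
    rintro rfl
    simp at hm

lemma exists_homogeneous_remainder {n d k : ℕ} {h f : MvPolynomial (Fin (n + 1)) ℝ}
    (hhom : h.IsHomogeneous d) (hne : eval (Fin.cons 1 0 : Fin (n + 1) → ℝ) h ≠ 0) (hd : 1 ≤ d)
    (hf : f.IsHomogeneous k) :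
    ∃ w : MvPolynomial (Fin (n + 1)) ℝ, w.IsHomogeneous k ∧ h ∣ f - w ∧
      ∀ m ∈ w.support, m 0 < d := by
  obtain ⟨c, hc, hmonic, hdeg⟩ := exists_monic_finSuccEquiv hhom hne
  set H := finSuccEquiv ℝ n (C c * h)
  set w := (finSuccEquiv ℝ n).symm (finSuccEquiv ℝ n f %ₘ H) with hw
  refine ⟨homogeneousComponent k w, homogeneousComponent_isHomogeneous k w, ?_, ?_⟩
  · have hdvd : h ∣ f - w := by
      refine (Dvd.intro_left (C c) rfl).trans
        (Dvd.intro ((finSuccEquiv ℝ n).symm (finSuccEquiv ℝ n f /ₘ H)) ?_)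
      apply (finSuccEquiv ℝ n).injective
      rw [map_mul, map_sub, AlgEquiv.apply_symm_apply, hw, AlgEquiv.apply_symm_apply,
        eq_sub_iff_add_eq']
      exact Polynomial.modByMonic_add_div _ H
    have := hhom.dvd_homogeneousComponent hdvd k
    rwa [map_sub, homogeneousComponent_eq_self hf] at this
  · intro m hm
    rw [mem_support_iff, coeff_homogeneousComponent] at hm
    have hm' : m ∈ w.support := mem_support_iff.2 fun h0 => hm (by rw [h0, ite_self])
    rw [← hdeg]
    refine (monomial_le_degreeOf 0 hm').trans_lt ?_
    rw [← natDegree_finSuccEquiv, hw, AlgEquiv.apply_symm_apply]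
    refine Polynomial.natDegree_modByMonic_lt _ hmonic fun h1 => ?_
    rw [h1, Polynomial.natDegree_one] at hdeg
    omega

lemma dvd_sub_sum_homogeneousComponent {n d k r : ℕ} {h : MvPolynomial (Fin (n + 1)) ℝ}
    {v : Fin r → MvPolynomial (Fin (n + 1)) ℝ} (hhom : h.IsHomogeneous d)
    (hv : ∀ i, (v i).IsHomogeneous k) {e : ℕ} {f : MvPolynomial (Fin (n + 1)) ℝ}
    (hf : f.IsHomogeneous (e + k)) {a : Fin r → MvPolynomial (Fin n) ℝ}
    (ha : h ∣ f - ∑ i, rename Fin.succ (a i) * v i) :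
    h ∣ f - ∑ i, rename Fin.succ (homogeneousComponent e (a i)) * v i := by
  have := hhom.dvd_homogeneousComponent ha (e + k)
  rw [map_sub, homogeneousComponent_eq_self hf, map_sum] at this
  simpa only [homogeneousComponent_mul_of_right e (hv _), rename_homogeneousComponent] using this

lemma exists_dvd_sub_sum_C_mul {n d k r : ℕ} {h : MvPolynomial (Fin (n + 1)) ℝ}
    {v : Fin r → MvPolynomial (Fin (n + 1)) ℝ}
    (hhom : h.IsHomogeneous d) (hv : ∀ i, (v i).IsHomogeneous k)
    (hb : ∀ (f : MvPolynomial (Fin (n + 1)) ℝ) (df : ℕ), k ≤ df → f.IsHomogeneous df →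
      ∃ a : Fin r → MvPolynomial (Fin n) ℝ,
        f - ∑ i : Fin r, rename Fin.succ (a i) * v i ∈ Ideal.span {h})
    {f : MvPolynomial (Fin (n + 1)) ℝ} (hf : f.IsHomogeneous k) :
    ∃ p : Fin r → ℝ, h ∣ f - ∑ i, C (p i) * v i := by
  obtain ⟨a, ha⟩ := hb f k le_rfl hf
  refine ⟨fun i => coeff 0 (a i), ?_⟩
  have := dvd_sub_sum_homogeneousComponent (e := 0) hhom hv (by simpa using hf)
    (Ideal.mem_span_singleton.1 ha)
  simpa [homogeneousComponent_zero] using this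

lemma exists_dvd_sub_sum_linear_mul {n d k r : ℕ} {h : MvPolynomial (Fin (n + 1)) ℝ}
    {v : Fin r → MvPolynomial (Fin (n + 1)) ℝ}
    (hhom : h.IsHomogeneous d) (hv : ∀ i, (v i).IsHomogeneous k)
    (hb : ∀ (f : MvPolynomial (Fin (n + 1)) ℝ) (df : ℕ), k ≤ df → f.IsHomogeneous df →
      ∃ a : Fin r → MvPolynomial (Fin n) ℝ,
        f - ∑ i : Fin r, rename Fin.succ (a i) * v i ∈ Ideal.span {h})
    {f : MvPolynomial (Fin (n + 1)) ℝ}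
    (hf : f.IsHomogeneous (1 + k)) :
    ∃ p : Fin n → Fin r → ℝ, h ∣ f - ∑ l, X l.succ * ∑ i, C (p l i) * v i := by
  obtain ⟨a, ha⟩ := hb f (1 + k) (Nat.le_add_left k 1) hf
  refine ⟨fun l i => coeff (Finsupp.single l 1) (homogeneousComponent 1 (a i)), ?_⟩
  have := dvd_sub_sum_homogeneousComponent hhom hv hf (Ideal.mem_span_singleton.1 ha)
  convert this using 2
  simp only [Finset.mul_sum]
  rw [Finset.sum_comm]
  refine Finset.sum_congr rfl fun i _ => ?_
  conv_rhs => rw [(homogeneousComponent_isHomogeneous 1 (a i)).eq_sum_C_mul_X]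
  simp only [map_sum, map_mul, rename_C, rename_X, Finset.sum_mul]
  exact Finset.sum_congr rfl fun l _ => by ring

lemma Finsupp.degree_eq_zero_add_degree_tail {n : ℕ} (m : Fin (n + 1) →₀ ℕ) :
    m.degree = m 0 + m.tail.degree := by
  simp [Finsupp.degree_eq_sum, Fin.sum_univ_succ, Finsupp.tail_apply]

lemma Finsupp.degree_cons {n : ℕ} (i : ℕ) (a : Fin n →₀ ℕ) :
    (Finsupp.cons i a).degree = i + a.degree := by
  rw [Finsupp.degree_eq_zero_add_degree_tail, Finsupp.cons_zero, Finsupp.tail_cons]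

lemma subs_eq_aeval_finSuccEquiv {n : ℕ} (s : MvPolynomial (Fin 2) (MvPolynomial (Fin n) ℝ))
    (f : MvPolynomial (Fin (n + 1)) ℝ) :
    subs s f = Polynomial.aeval s (finSuccEquiv ℝ n f) := by
  have : (aeval (Fin.cases s (fun j => C (X j))) : MvPolynomial (Fin (n + 1)) ℝ →ₐ[ℝ] _) =
      ((Polynomial.aeval s).restrictScalars ℝ).comp (finSuccEquiv ℝ n).toAlgHom := by
    ext i : 1
    refine Fin.cases ?_ (fun j => ?_) i <;>
      simp [finSuccEquiv_X_zero, finSuccEquiv_X_succ, MvPolynomial.algebraMap_eq]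
  exact DFunLike.congr_fun this f

lemma subs_monomial {n : ℕ} (s : MvPolynomial (Fin 2) (MvPolynomial (Fin n) ℝ))
    (m : Fin (n + 1) →₀ ℕ) (c : ℝ) :
    subs s (monomial m c) = C (monomial m.tail c) * s ^ m 0 := by
  rw [subs, aeval_monomial, Finsupp.prod_fintype _ _ (fun _ => pow_zero _), Fin.prod_univ_succ,
    monomial_eq, Finsupp.prod_fintype _ _ (fun _ => pow_zero _)]
  simp only [Fin.cases_zero, Fin.cases_succ, map_mul, map_prod, map_pow, Finsupp.tail_apply]
  rw [IsScalarTower.algebraMap_apply ℝ (MvPolynomial (Fin n) ℝ), MvPolynomial.algebraMap_eq,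
    MvPolynomial.algebraMap_eq]
  ring

/-- A polynomial in `(h(s), h(t))` of degree `< d` both in `s` and in `t` vanishes. -/
lemma sum_filter_eq_zero_of_mem_span {n d : ℕ} {h : MvPolynomial (Fin (n + 1)) ℝ}
    (hhom : h.IsHomogeneous d) (hne : eval (Fin.cons 1 0 : Fin (n + 1) → ℝ) h ≠ 0)
    {ι : Type*} (s : Finset ι) (a b : ι → ℕ) (D : ι → Fin n →₀ ℕ) (c : ι → ℝ)
    (ha : ∀ x ∈ s, a x < d) (hb : ∀ x ∈ s, b x < d)
    (hmem : ∑ x ∈ s, (C (monomial (D x) (c x)) * X 0 ^ a x * X 1 ^ b x :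
        MvPolynomial (Fin 2) (MvPolynomial (Fin n) ℝ)) ∈
      Ideal.span {subs (X 0) h, subs (X 1) h}) (z : (ℕ × ℕ) × (Fin n →₀ ℕ)) :
    ∑ x ∈ s with ((a x, b x), D x) = z, c x = 0 := by
  classical
  obtain ⟨⟨i, j⟩, e⟩ := z
  obtain ⟨u, hu, hmonic, rfl⟩ := exists_monic_finSuccEquiv hhom hne
  set H := finSuccEquiv ℝ n (C u * h) with hH
  let p : ℕ → ℕ → MvPolynomial (Fin n) ℝ :=
    fun i j => ∑ x ∈ s with (a x, b x) = (i, j), monomial (D x) (c x)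
  have hspan (y : MvPolynomial (Fin 2) (MvPolynomial (Fin n) ℝ)) :
      subs y h = C (C u⁻¹) * Polynomial.aeval y H := by
    rw [hH, ← subs_eq_aeval_finSuccEquiv]
    simp only [subs, map_mul, ← MvPolynomial.algebraMap_eq, AlgHom.commutes]
    rw [IsScalarTower.algebraMap_apply ℝ (MvPolynomial (Fin n) ℝ) (MvPolynomial (Fin 2) _),
      ← mul_assoc, ← map_mul, ← map_mul, inv_mul_cancel₀ hu, map_one, map_one, one_mul]
  have hle : Ideal.span {subs (X 0) h, subs (X 1) h} ≤
      Ideal.span {Polynomial.aeval (X 0) H, Polynomial.aeval (X 1) H} := by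
    rw [Ideal.span_le, Set.insert_subset_iff, Set.singleton_subset_iff]
    simp only [hspan]
    exact ⟨Ideal.mul_mem_left _ _ (Ideal.subset_span (by simp)),
      Ideal.mul_mem_left _ _ (Ideal.subset_span (by simp))⟩
  have hsum : ∑ i ∈ Finset.range H.natDegree, ∑ j ∈ Finset.range H.natDegree,
      (C (p i j) * X 0 ^ i * X 1 ^ j : MvPolynomial (Fin 2) (MvPolynomial (Fin n) ℝ)) =
      ∑ x ∈ s, C (monomial (D x) (c x)) * X 0 ^ a x * X 1 ^ b x := by
    rw [← Finset.sum_product', ← Finset.sum_fiberwise_of_maps_to (s := s)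
      (t := Finset.range H.natDegree ×ˢ Finset.range H.natDegree) (g := fun x => (a x, b x))
      fun x hx => by simp [ha x hx, hb x hx]]
    refine Finset.sum_congr rfl fun y _ => ?_
    simp only [p, map_sum, Finset.sum_mul]
    refine Finset.sum_congr rfl fun x hx => ?_
    rw [← (Finset.mem_filter.1 hx).2]
  by_cases hij : i < H.natDegree ∧ j < H.natDegree
  · have h0 := coeff_eq_zero_of_mem_span_aeval hmonic p (hsum ▸ hle hmem) hij.1 hij.2
    have h1 := congrArg (coeff e) h0
    simp only [p, coeff_sum, coeff_monomial, coeff_zero] at h1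
    rw [← Finset.sum_filter, Finset.filter_filter] at h1
    simpa only [Prod.mk.injEq] using h1
  · rw [Finset.filter_eq_empty_iff.2, Finset.sum_empty]
    intro x hx heq
    simp only [Prod.mk.injEq] at heq
    exact hij ⟨heq.1.1 ▸ ha x hx, heq.1.2 ▸ hb x hx⟩

section

variable {n r : ℕ}

/-- Contraction of the row indices of a matrix pencil with the vector `v`: the entry at `j` of
the vector `vᵀ (∑ l, x_l T_l)`. -/
noncomputable def contract (v : Fin r → MvPolynomial (Fin (n + 1)) ℝ) (j : Fin r) :
    (Fin n → Matrix (Fin r) (Fin r) ℝ) →ₗ[ℝ] MvPolynomial (Fin (n + 1)) ℝ where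
  toFun T := ∑ l, X l.succ * ∑ i, T l i j • v i
  map_add' S T := by
    simp only [Pi.add_apply, Matrix.add_apply, add_smul, Finset.sum_add_distrib, mul_add]
  map_smul' c T := by
    simp only [Pi.smul_apply, Matrix.smul_apply, smul_assoc, ← Finset.smul_sum, mul_smul_comm,
      RingHom.id_apply]

/-- The linear matrix pencils `T` with `vᵀ T ≡ 0` modulo `h`. -/
noncomputable def syzygyPencils (h : MvPolynomial (Fin (n + 1)) ℝ)
    (v : Fin r → MvPolynomial (Fin (n + 1)) ℝ) :
    Submodule ℝ (Fin n → Matrix (Fin r) (Fin r) ℝ) :=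
  ⨅ j, ((Ideal.span {h}).restrictScalars ℝ).comap (contract v j)

lemma mem_syzygyPencils {h : MvPolynomial (Fin (n + 1)) ℝ}
    {v : Fin r → MvPolynomial (Fin (n + 1)) ℝ} {T : Fin n → Matrix (Fin r) (Fin r) ℝ} :
    T ∈ syzygyPencils h v ↔ ∀ j, h ∣ contract v j T := by
  simp [syzygyPencils, Submodule.mem_iInf, Ideal.mem_span_singleton]

/-- The span of the pencils `T` with `vᵀ T ≡ 0` and those with `T v ≡ 0` modulo `h`. -/
noncomputable def bisyzygyPencils (h : MvPolynomial (Fin (n + 1)) ℝ)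
    (v : Fin r → MvPolynomial (Fin (n + 1)) ℝ) :
    Submodule ℝ (Fin n → Matrix (Fin r) (Fin r) ℝ) :=
  syzygyPencils h v ⊔ (syzygyPencils h v).comap
    ((Matrix.transposeLinearEquiv (Fin r) (Fin r) ℝ ℝ).toLinearMap.compLeft (Fin n))

/-- The class of the pencil `x_l p qᵀ` modulo `bisyzygyPencils`. -/
noncomputable def pencilClass (h : MvPolynomial (Fin (n + 1)) ℝ)
    (v : Fin r → MvPolynomial (Fin (n + 1)) ℝ) (l : Fin n) :
    (Fin r → ℝ) →ₗ[ℝ] (Fin r → ℝ) →ₗ[ℝ]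
      ((Fin n → Matrix (Fin r) (Fin r) ℝ) ⧸ bisyzygyPencils h v) :=
  (vecMulVecBilin ℝ ℝ).compr₂
    ((bisyzygyPencils h v).mkQ ∘ₗ LinearMap.single ℝ (fun _ => Matrix (Fin r) (Fin r) ℝ) l)

lemma pencilClass_apply (h : MvPolynomial (Fin (n + 1)) ℝ)
    (v : Fin r → MvPolynomial (Fin (n + 1)) ℝ) (l : Fin n) (p q : Fin r → ℝ) :
    pencilClass h v l p q =
      (bisyzygyPencils h v).mkQ (Pi.single l (Matrix.vecMulVec p q)) := rfl

lemma contract_single (v : Fin r → MvPolynomial (Fin (n + 1)) ℝ) (j : Fin r) (l : Fin n)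
    (p q : Fin r → ℝ) : contract v j (Pi.single l (Matrix.vecMulVec p q)) =
      q j • (X l.succ * ∑ i, p i • v i) := by
  change ∑ l', X l'.succ * ∑ i, (Pi.single l (Matrix.vecMulVec p q) :
    Fin n → Matrix (Fin r) (Fin r) ℝ) l' i j • v i = _
  rw [Finset.sum_eq_single l]
  · simp [Matrix.vecMulVec_apply, mul_comm (p _), mul_smul, ← Finset.smul_sum]
  · intro l' _ hl
    simp [Pi.single_eq_of_ne hl]
  · simp

lemma sub_mem_syzygyPencils {h : MvPolynomial (Fin (n + 1)) ℝ}
    {v : Fin r → MvPolynomial (Fin (n + 1)) ℝ} {l l' : Fin n} {p p' : Fin r → ℝ}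
    (q : Fin r → ℝ)
    (hp : h ∣ X l.succ * ∑ i, p i • v i - X l'.succ * ∑ i, p' i • v i) :
    (Pi.single l (Matrix.vecMulVec p q) - Pi.single l' (Matrix.vecMulVec p' q) :
      Fin n → Matrix (Fin r) (Fin r) ℝ) ∈ syzygyPencils h v := by
  refine mem_syzygyPencils.2 fun j => ?_
  rw [map_sub, contract_single, contract_single, ← smul_sub, smul_eq_C_mul]
  exact hp.mul_left _

lemma pencilClass_congr_left {h : MvPolynomial (Fin (n + 1)) ℝ}
    {v : Fin r → MvPolynomial (Fin (n + 1)) ℝ} {l l' : Fin n} {p p' : Fin r → ℝ}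
    (q : Fin r → ℝ)
    (hp : h ∣ X l.succ * ∑ i, p i • v i - X l'.succ * ∑ i, p' i • v i) :
    pencilClass h v l p q = pencilClass h v l' p' q := by
  rw [pencilClass_apply, pencilClass_apply]
  exact (Submodule.Quotient.eq _).2 (Submodule.mem_sup_left (sub_mem_syzygyPencils q hp))

lemma pencilClass_congr_right {h : MvPolynomial (Fin (n + 1)) ℝ}
    {v : Fin r → MvPolynomial (Fin (n + 1)) ℝ} {l l' : Fin n} {p p' : Fin r → ℝ}
    (q : Fin r → ℝ)
    (hp : h ∣ X l.succ * ∑ i, p i • v i - X l'.succ * ∑ i, p' i • v i) :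
    pencilClass h v l q p = pencilClass h v l' q p' := by
  rw [pencilClass_apply, pencilClass_apply]
  refine (Submodule.Quotient.eq _).2 (Submodule.mem_sup_right ?_)
  rw [Submodule.mem_comap]
  convert sub_mem_syzygyPencils q hp using 1
  ext m i j
  by_cases hl : m = l <;> by_cases hl' : m = l' <;> subst_vars <;>
    simp_all [Matrix.vecMulVec_apply, mul_comm]

lemma mkQ_eq_sum_pencilClass (h : MvPolynomial (Fin (n + 1)) ℝ)
    (v : Fin r → MvPolynomial (Fin (n + 1)) ℝ) (T : Fin n → Matrix (Fin r) (Fin r) ℝ) :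
    (bisyzygyPencils h v).mkQ T =
      ∑ l, ∑ i, ∑ j, T l i j • pencilClass h v l (Pi.single i 1) (Pi.single j 1) := by
  simp only [pencilClass_apply, ← map_smul, ← map_sum]
  congr 1
  conv_lhs => rw [← Finset.univ_sum_single T]
  refine Finset.sum_congr rfl fun l _ => ?_
  conv_lhs => rw [Matrix.matrix_eq_sum_single (T l)]
  simp only [← Matrix.single_eq_single_vecMulVec_single]
  simp only [← LinearMap.single_apply ℝ, map_sum, ← map_smul, Matrix.smul_single, smul_eq_mul,
    mul_one]

end

lemma sum_smul_sum_smul_sum_smul {ι μ K V : Type*} [CommSemiring K] [AddCommMonoid V]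
    [Module K V] (s : Finset ι) (t : Finset μ) (c : ι → ι → K) (a : ι → μ → K) (B : μ → μ → V) :
    ∑ i ∈ s, ∑ j ∈ s, c i j • ∑ m ∈ t, a i m • ∑ m' ∈ t, a j m' • B m m' =
      ∑ m ∈ t, ∑ m' ∈ t, (∑ i ∈ s, ∑ j ∈ s, c i j * a i m * a j m') • B m m' := by
  simp only [Finset.smul_sum, Finset.sum_smul, smul_smul, ← mul_assoc]
  refine (Finset.sum_congr rfl fun i _ => Finset.sum_comm.trans
    (Finset.sum_congr rfl fun m _ => Finset.sum_comm)).trans ?_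
  exact Finset.sum_comm.trans (Finset.sum_congr rfl fun m _ => Finset.sum_comm)

/-- `subs` as an algebra homomorphism. -/
noncomputable def subsAlgHom {n : ℕ} (s : MvPolynomial (Fin 2) (MvPolynomial (Fin n) ℝ)) :
    MvPolynomial (Fin (n + 1)) ℝ →ₐ[ℝ] MvPolynomial (Fin 2) (MvPolynomial (Fin n) ℝ) :=
  aeval (Fin.cases s (fun j => C (X j)))

lemma subs_eq_subsAlgHom {n : ℕ} (s : MvPolynomial (Fin 2) (MvPolynomial (Fin n) ℝ))
    (f : MvPolynomial (Fin (n + 1)) ℝ) : subs s f = subsAlgHom s f := rfl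

lemma mkₐ_subs_congr {n : ℕ} {h f g : MvPolynomial (Fin (n + 1)) ℝ} (hfg : h ∣ f - g)
    {I : Ideal (MvPolynomial (Fin 2) (MvPolynomial (Fin n) ℝ))}
    {s : MvPolynomial (Fin 2) (MvPolynomial (Fin n) ℝ)} (hs : subs s h ∈ I) :
    Ideal.Quotient.mkₐ ℝ I (subs s f) = Ideal.Quotient.mkₐ ℝ I (subs s g) := by
  obtain ⟨q, hq⟩ := hfg
  refine Ideal.Quotient.eq.2 ?_
  rw [subs_eq_subsAlgHom, subs_eq_subsAlgHom, ← map_sub, hq, map_mul]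
  exact I.mul_mem_right _ hs

/-- A linear pencil `T` with `v(s)ᵀ T v(t) ≡ 0` modulo `(h(s), h(t))` is a sum of a pencil
annihilating `v` on the left and one annihilating `v` on the right modulo `h`. -/
lemma mem_bisyzygyPencils {n d k r : ℕ} (hd : 1 ≤ d) {h : MvPolynomial (Fin (n + 1)) ℝ}
    {v : Fin r → MvPolynomial (Fin (n + 1)) ℝ}
    (hhom : h.IsHomogeneous d) (hne : eval (Fin.cons 1 0 : Fin (n + 1) → ℝ) h ≠ 0)
    (hv : ∀ i, (v i).IsHomogeneous k)
    (hb : ∀ (f : MvPolynomial (Fin (n + 1)) ℝ) (df : ℕ), k ≤ df → f.IsHomogeneous df →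
      ∃ a : Fin r → MvPolynomial (Fin n) ℝ,
        f - ∑ i : Fin r, rename Fin.succ (a i) * v i ∈ Ideal.span {h})
    (T : Fin n → Matrix (Fin r) (Fin r) ℝ)
    (hT : ∑ l, C (X l) * ∑ i, ∑ j, T l i j • (subs (X 0) (v i) * subs (X 1) (v j)) ∈
      Ideal.span {subs (X 0) h, subs (X 1) h}) :
    T ∈ bisyzygyPencils h v := by
  classical
  have hβ (m : Fin (n + 1) →₀ ℕ) :
      ∃ p : Fin r → ℝ, m.degree = k → h ∣ monomial m 1 - ∑ i, p i • v i := by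
    by_cases hm : m.degree = k
    · obtain ⟨p, hp⟩ := exists_dvd_sub_sum_C_mul hhom hv hb (isHomogeneous_monomial (1 : ℝ) hm)
      exact ⟨p, fun _ => by simpa only [smul_eq_C_mul] using hp⟩
    · exact ⟨0, fun hm' => absurd hm' hm⟩
  choose β hβ using hβ
  choose w hwhom hwdvd hwsupp using fun i => exists_homogeneous_remainder hhom hne hd (hv i)
  let M := Finset.univ.biUnion fun i => (w i).support
  have hMd (m) (hm : m ∈ M) : m 0 < d := by
    obtain ⟨i, _, hi⟩ := Finset.mem_biUnion.1 hm
    exact hwsupp i m hi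
  have hMk (m) (hm : m ∈ M) : m.degree = k := by
    obtain ⟨i, _, hi⟩ := Finset.mem_biUnion.1 hm
    by_contra hcon
    exact mem_support_iff.1 hi ((hwhom i).coeff_eq_zero hcon)
  have hwsum (i) : w i = ∑ m ∈ M, coeff m (w i) • monomial m (1 : ℝ) := by
    conv_lhs => rw [(w i).as_sum]
    simp only [smul_monomial, smul_eq_mul, mul_one]
    refine Finset.sum_subset
      (Finset.subset_biUnion_of_mem (fun i => (w i).support) (Finset.mem_univ i))
      fun m _ hm => ?_
    rw [notMem_support_iff.1 hm, monomial_zero]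
  have hunit (l : Fin n) (i : Fin r) :
      h ∣ X l.succ * ∑ i', (Pi.single i 1 : Fin r → ℝ) i' • v i' -
        X l.succ * ∑ i', (∑ m ∈ M, coeff m (w i) • β m) i' • v i' := by
    rw [← mul_sub]
    refine Dvd.dvd.mul_left ?_ _
    have h1 : h ∣ ∑ m ∈ M, coeff m (w i) • (monomial m 1 - ∑ i', β m i' • v i') := by
      refine Finset.dvd_sum fun m hm => ?_
      rw [smul_eq_C_mul]
      exact (hβ m (hMk m hm)).mul_left _
    simp only [smul_sub, Finset.sum_sub_distrib, ← hwsum] at h1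
    convert dvd_add (hwdvd i) h1 using 1
    rw [sub_add_sub_cancel, Finset.sum_eq_single i (by simp +contextual)
      (by simp), Pi.single_eq_same, one_smul]
    congr 1
    simp only [Finset.sum_apply, Pi.smul_apply, Finset.sum_smul, Finset.smul_sum, smul_assoc]
    exact Finset.sum_comm
  have hclass (l : Fin n) (i j : Fin r) :
      pencilClass h v l (Pi.single i 1) (Pi.single j 1) =
        ∑ m ∈ M, coeff m (w i) • ∑ m' ∈ M, coeff m' (w j) • pencilClass h v l (β m) (β m') := by
    rw [pencilClass_congr_left _ (hunit l i), pencilClass_congr_right _ (hunit l j)]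
    simp only [map_sum, map_smul, LinearMap.sum_apply, LinearMap.smul_apply, Finset.smul_sum]
    rw [Finset.sum_comm]
    exact Finset.sum_congr rfl fun m _ => Finset.sum_congr rfl fun m' _ => smul_comm _ _ _
  let s := (Finset.univ : Finset (Fin n)) ×ˢ M ×ˢ M
  let c : Fin n × (Fin (n + 1) →₀ ℕ) × (Fin (n + 1) →₀ ℕ) → ℝ := fun x =>
    ∑ i, ∑ j, T x.1 i j * coeff x.2.1 (w i) * coeff x.2.2 (w j)
  let D : Fin n × (Fin (n + 1) →₀ ℕ) × (Fin (n + 1) →₀ ℕ) → Fin n →₀ ℕ := fun x =>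
    Finsupp.single x.1 1 + x.2.1.tail + x.2.2.tail
  have hs (x) (hx : x ∈ s) : x.2.1 ∈ M ∧ x.2.2 ∈ M := by
    simpa [s] using hx
  have hzero (z) : ∑ x ∈ s with ((x.2.1 0, x.2.2 0), D x) = z, c x = 0 := by
    refine sum_filter_eq_zero_of_mem_span hhom hne s (fun x => x.2.1 0) (fun x => x.2.2 0) D c
      (fun x hx => hMd _ (hs x hx).1) (fun x hx => hMd _ (hs x hx).2) ?_ z
    set I := Ideal.span {subs (X 0) h, subs (X 1) h}
    have h0 : subs (X 0) h ∈ I := Ideal.subset_span (by simp)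
    have h1 : subs (X 1) h ∈ I := Ideal.subset_span (by simp)
    have hmem : ∑ l, C (X l) * ∑ i, ∑ j, T l i j • (subs (X 0) (w i) * subs (X 1) (w j)) ∈ I := by
      rw [← Ideal.Quotient.eq_zero_iff_mem, ← Ideal.Quotient.mkₐ_eq_mk ℝ] at hT ⊢
      simp only [map_sum, map_mul, map_smul, mkₐ_subs_congr (hwdvd _) h0,
        mkₐ_subs_congr (hwdvd _) h1] at hT ⊢
      exact hT
    convert hmem using 1
    rw [Finset.sum_product]
    refine Finset.sum_congr rfl fun l _ => ?_
    have hsubs (y) (i) : subs y (w i) = ∑ m ∈ M, coeff m (w i) • subs y (monomial m 1) := by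
      conv_lhs => rw [hwsum i]
      simp only [subs_eq_subsAlgHom, map_sum, map_smul]
    have hprod (i j) : subs (X 0) (w i) * subs (X 1) (w j) = ∑ m ∈ M, coeff m (w i) •
        ∑ m' ∈ M, coeff m' (w j) • (subs (X 0) (monomial m 1) * subs (X 1) (monomial m' 1)) := by
      simp only [hsubs, Finset.sum_mul, Finset.mul_sum, smul_mul_assoc, mul_smul_comm,
        Finset.smul_sum]
      rw [Finset.sum_comm]
      exact Finset.sum_congr rfl fun m _ => Finset.sum_congr rfl fun m' _ => smul_comm _ _ _
    have hexp : ∑ i, ∑ j, T l i j • (subs (X 0) (w i) * subs (X 1) (w j)) =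
        ∑ m ∈ M, ∑ m' ∈ M, c (l, m, m') •
          (subs (X 0) (monomial m 1) * subs (X 1) (monomial m' 1)) := by
      simp only [hprod]
      exact sum_smul_sum_smul_sum_smul Finset.univ M (T l) (fun i m => coeff m (w i)) _
    rw [hexp, Finset.sum_product, Finset.mul_sum]
    refine Finset.sum_congr rfl fun m _ => ?_
    rw [Finset.mul_sum]
    refine Finset.sum_congr rfl fun m' _ => ?_
    have hmon : monomial (D (l, m, m')) (c (l, m, m')) =
        c (l, m, m') • (X l * monomial m.tail 1 * monomial m'.tail 1) := by
      rw [X, monomial_mul, monomial_mul, smul_monomial]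
      simp [D]
    rw [hmon, subs_monomial, subs_monomial, mul_smul_comm]
    have hC (a : ℝ) (p : MvPolynomial (Fin n) ℝ) :
        (C (a • p) : MvPolynomial (Fin 2) (MvPolynomial (Fin n) ℝ)) = a • C p :=
      map_smul (IsScalarTower.toAlgHom ℝ (MvPolynomial (Fin n) ℝ) (MvPolynomial (Fin 2) _)) a p
    simp only [hC, map_mul, smul_mul_assoc]
    congr 1
    ring
  have hinv : ∀ x ∈ s, ∀ y ∈ s, ((x.2.1 0, x.2.2 0), D x) = ((y.2.1 0, y.2.2 0), D y) →
      pencilClass h v x.1 (β x.2.1) (β x.2.2) = pencilClass h v y.1 (β y.2.1) (β y.2.2) := by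
    rintro ⟨l, m, m'⟩ hx ⟨l', m₁, m₁'⟩ hy hxy
    simp only [Prod.mk.injEq, D] at hxy
    obtain ⟨⟨h1, h2⟩, h3⟩ := hxy
    have hdvd (i : ℕ) (c c' : Fin n) (a a' : Fin n →₀ ℕ) (hi : i + a.degree = k)
        (hi' : i + a'.degree = k)
        (heq : Finsupp.single c 1 + a = Finsupp.single c' 1 + a') :
        h ∣ X c.succ * ∑ z, β (Finsupp.cons i a) z • v z -
          X c'.succ * ∑ z, β (Finsupp.cons i a') z • v z := by
      have hmon : (X c.succ * monomial (Finsupp.cons i a) 1 : MvPolynomial (Fin (n + 1)) ℝ) =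
          X c'.succ * monomial (Finsupp.cons i a') 1 := by
        rw [X, X, monomial_mul, monomial_mul]
        refine congrArg (fun e => monomial e _) ?_
        ext z
        have := DFunLike.congr_fun heq
        refine Fin.cases ?_ (fun z => ?_) z
        · simp
        · simpa [Finsupp.single_apply] using this z
      have := dvd_sub ((hβ _ ((Finsupp.degree_cons i a').trans hi')).mul_left (X c'.succ))
        ((hβ _ ((Finsupp.degree_cons i a).trans hi)).mul_left (X c.succ))
      rw [mul_sub, mul_sub, hmon] at this
      simpa using this
    have hk := hMk m (hs _ hx).1
    have hk' := hMk m' (hs _ hx).2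
    have hk₁ := hMk m₁ (hs _ hy).1
    have hk₁' := hMk m₁' (hs _ hy).2
    rw [Finsupp.degree_eq_zero_add_degree_tail] at hk hk' hk₁ hk₁'
    have := eq_of_exchange_invariant
      (fun l a b => pencilClass h v l (β (Finsupp.cons (m 0) a)) (β (Finsupp.cons (m' 0) b)))
      m.tail.degree m'.tail.degree
      (fun c c' a a' b ha ha' hb heq =>
        pencilClass_congr_left _ (hdvd _ _ _ _ _ (by omega) (by omega) heq))
      (fun c c' a b b' ha hb hb' heq =>
        pencilClass_congr_right _ (hdvd _ _ _ _ _ (by omega) (by omega) heq))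
      (a := m.tail) (b := m'.tail) (a' := m₁.tail) (b' := m₁'.tail)
      rfl (by omega) rfl (by omega) h3
    have e1 : Finsupp.cons (m 0) m₁.tail = m₁ := by rw [h1, Finsupp.cons_tail]
    have e2 : Finsupp.cons (m' 0) m₁'.tail = m₁' := by rw [h2, Finsupp.cons_tail]
    simpa only [Finsupp.cons_tail, e1, e2] using this
  rw [← Submodule.Quotient.mk_eq_zero, ← Submodule.mkQ_apply, mkQ_eq_sum_pencilClass]
  rw [← sum_smul_eq_zero_of_fiberwise s _ c _ hinv hzero, Finset.sum_product]
  refine Finset.sum_congr rfl fun l _ => ?_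
  simp only [hclass]
  rw [Finset.sum_product]
  exact sum_smul_sum_smul_sum_smul Finset.univ M (T l) (fun i m => coeff m (w i)) _

/-- Multiplication by the first variable is represented, modulo `h` and with respect to the
generators `v`, by a symmetric linear pencil. -/
lemma exists_symm_pencil {n d k r : ℕ} (hd : 1 ≤ d) {h : MvPolynomial (Fin (n + 1)) ℝ}
    {v : Fin r → MvPolynomial (Fin (n + 1)) ℝ}
    (hhom : h.IsHomogeneous d) (hne : eval (Fin.cons 1 0 : Fin (n + 1) → ℝ) h ≠ 0)
    (hv : ∀ i, (v i).IsHomogeneous k)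
    (ha : (X 0 - X 1 : MvPolynomial (Fin 2) (MvPolynomial (Fin n) ℝ)) *
        ∑ i : Fin r, subs (X 0) (v i) * subs (X 1) (v i) ∈
      Ideal.span {subs (X 0) h, subs (X 1) h})
    (hb : ∀ (f : MvPolynomial (Fin (n + 1)) ℝ) (df : ℕ), k ≤ df → f.IsHomogeneous df →
      ∃ a : Fin r → MvPolynomial (Fin n) ℝ,
        f - ∑ i : Fin r, rename Fin.succ (a i) * v i ∈ Ideal.span {h}) :
    ∃ A : Fin n → Matrix (Fin r) (Fin r) ℝ, (∀ l, (A l).IsSymm) ∧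
      ∀ j, h ∣ X 0 * v j - contract v j A := by
  choose q hq using fun j => exists_dvd_sub_sum_linear_mul hhom hv hb
    ((isHomogeneous_X ℝ (0 : Fin (n + 1))).mul (hv j))
  let L : Fin n → Matrix (Fin r) (Fin r) ℝ := fun l => Matrix.of fun i j => q j l i
  have hL (j) : h ∣ X 0 * v j - contract v j L := by
    simpa only [contract, LinearMap.coe_mk, AddHom.coe_mk, L, Matrix.of_apply, smul_eq_C_mul]
      using hq j
  have hmem : (fun l => L l - (L l).transpose) ∈ bisyzygyPencils h v := by
    refine mem_bisyzygyPencils hd hhom hne hv hb _ ?_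
    set I := Ideal.span {subs (X 0) h, subs (X 1) h}
    have h0 : subs (X 0) h ∈ I := Ideal.subset_span (by simp)
    have h1 : subs (X 1) h ∈ I := Ideal.subset_span (by simp)
    have hX (y : MvPolynomial (Fin 2) (MvPolynomial (Fin n) ℝ)) (j) :
        subs y (X 0 * v j) = y * subs y (v j) := by
      simp [subs]
    have hcontract (y : MvPolynomial (Fin 2) (MvPolynomial (Fin n) ℝ)) (j) :
        subs y (contract v j L) = ∑ l, C (X l) * ∑ i, L l i j • subs y (v i) := by
      simp [subs, contract]
    have hsum : ∑ l, C (X l) * ∑ i, ∑ j, (L l - (L l).transpose) i j •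
        (subs (X 0) (v i) * subs (X 1) (v j)) =
        ∑ j, subs (X 0) (contract v j L) * subs (X 1) (v j) -
          ∑ j, subs (X 0) (v j) * subs (X 1) (contract v j L) := by
      simp only [hcontract, Matrix.sub_apply, Matrix.transpose_apply, sub_smul,
        Finset.sum_sub_distrib, mul_sub, Finset.sum_mul, Finset.mul_sum, smul_mul_assoc,
        mul_smul_comm]
      congr 1
      · refine (Finset.sum_congr rfl fun l _ => Finset.sum_comm).trans (Finset.sum_comm.trans ?_)
        simp only [mul_assoc]
      · refine Finset.sum_comm.trans ?_
        simp only [mul_left_comm]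
    rw [← Ideal.Quotient.eq_zero_iff_mem, ← Ideal.Quotient.mkₐ_eq_mk ℝ] at ha ⊢
    rw [hsum, ← ha, sub_mul, Finset.mul_sum, Finset.mul_sum, map_sub, map_sub, map_sum, map_sum,
      map_sum, map_sum]
    congr 1 <;> refine Finset.sum_congr rfl fun j _ => ?_
    · rw [map_mul, ← mkₐ_subs_congr (hL j) h0, hX, ← map_mul, mul_assoc]
    · rw [map_mul, ← mkₐ_subs_congr (hL j) h1, hX, ← map_mul, mul_left_comm]
  obtain ⟨Y, hY, Z, hZ, hYZ⟩ := Submodule.mem_sup.1 hmem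
  rw [Submodule.mem_comap, mem_syzygyPencils] at hZ
  rw [mem_syzygyPencils] at hY
  set Z' := (Matrix.transposeLinearEquiv (Fin r) (Fin r) ℝ ℝ).toLinearMap.compLeft (Fin n) Z
    with hZ'
  refine ⟨L - (1 / 2 : ℝ) • (Y - Z'), fun l => ?_, fun j => ?_⟩
  · ext i j
    have h1 := congrFun (congrFun (congrFun hYZ l) i) j
    have h2 := congrFun (congrFun (congrFun hYZ l) j) i
    simp [hZ'] at h1 h2 ⊢
    linarith
  · rw [map_sub, map_smul, map_sub, smul_eq_C_mul, ← sub_add]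
    exact dvd_add (hL j) ((dvd_sub (hY j) (hZ j)).mul_left _)

lemma Matrix.dvd_det_mul_of_dvd_vecMul {ι R : Type*} [Fintype ι] [DecidableEq ι] [CommRing R]
    {M : Matrix ι ι R} {v : ι → R} {h : R} (hM : ∀ j, h ∣ Matrix.vecMul v M j) (j : ι) :
    h ∣ M.det * v j := by
  have : Matrix.vecMul (Matrix.vecMul v M) M.adjugate j = M.det * v j := by
    rw [Matrix.vecMul_vecMul, Matrix.mul_adjugate, Matrix.vecMul_smul, Matrix.vecMul_one]
    rfl
  rw [← this]
  exact Finset.dvd_sum fun i _ => (hM i).mul_right _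

lemma isRelPrime_X_succ {n : ℕ} {h : MvPolynomial (Fin (n + 1)) ℝ}
    (hne : eval (Fin.cons 1 0 : Fin (n + 1) → ℝ) h ≠ 0) (l : Fin n) (k : ℕ) :
    IsRelPrime h (X l.succ ^ k) := by
  refine IsRelPrime.pow_right ?_
  refine ((X_prime (R := ℝ) (i := l.succ)).irreducible.isRelPrime_iff_not_dvd.2 ?_).symm
  rintro ⟨q, rfl⟩
  simp at hne

/-- **Theorem (nice Bézoutians give determinantal representations).**
Let `h` be homogeneous of degree `d ≥ 1` with `h(1,0,…,0) ≠ 0`. Suppose there are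
homogeneous polynomials `v₁,…,v_r` of degree `k` such that
`(s−t)·Σᵢ vᵢ(s)vᵢ(t) ∈ (h(s), h(t))` and every homogeneous polynomial of degree `≥ k` is,
modulo `(h)`, an `ℝ[x₁,…,xₙ]`-linear combination of `v₁,…,v_r`. Then there are real
symmetric matrices `A₁,…,Aₙ` with `h ∣ det(x₀·I − (x₁A₁ + … + xₙAₙ))`. -/
theorem statement2 {n d : ℕ} (hd : 1 ≤ d) (h : MvPolynomial (Fin (n + 1)) ℝ)
    (hhom : h.IsHomogeneous d)
    (hne : eval (Fin.cons 1 0 : Fin (n + 1) → ℝ) h ≠ 0)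
    (k r : ℕ) (v : Fin r → MvPolynomial (Fin (n + 1)) ℝ)
    (hv : ∀ i, (v i).IsHomogeneous k)
    (ha : (X 0 - X 1 : MvPolynomial (Fin 2) (MvPolynomial (Fin n) ℝ)) *
        ∑ i : Fin r, subs (X 0) (v i) * subs (X 1) (v i) ∈
      Ideal.span {subs (X 0) h, subs (X 1) h})
    (hb : ∀ (f : MvPolynomial (Fin (n + 1)) ℝ) (df : ℕ), k ≤ df → f.IsHomogeneous df →
      ∃ a : Fin r → MvPolynomial (Fin n) ℝ,
        f - ∑ i : Fin r, rename Fin.succ (a i) * v i ∈ Ideal.span {h}) :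
    ∃ (N : ℕ) (A : Fin n → Matrix (Fin N) (Fin N) ℝ),
      (∀ i, (A i).IsSymm) ∧
      h ∣ Matrix.det
        ((X 0 : MvPolynomial (Fin (n + 1)) ℝ) • (1 : Matrix (Fin N) (Fin N) (MvPolynomial (Fin (n + 1)) ℝ)) -
          ∑ i : Fin n, (X i.succ : MvPolynomial (Fin (n + 1)) ℝ) • (A i).map C) := by
  obtain ⟨A, hA, hvA⟩ := exists_symm_pencil hd hhom hne hv ha hb
  set M : Matrix (Fin r) (Fin r) (MvPolynomial (Fin (n + 1)) ℝ) :=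
    (X 0 : MvPolynomial (Fin (n + 1)) ℝ) • 1 -
      ∑ l, (X l.succ : MvPolynomial (Fin (n + 1)) ℝ) • (A l).map C with hM
  have hvM (j) : h ∣ Matrix.vecMul v M j := by
    convert hvA j using 1
    simp only [hM, Matrix.vecMul_sub, Matrix.vecMul_smul, Matrix.vecMul_one, Matrix.vecMul_sum,
      Pi.sub_apply, Pi.smul_apply, Finset.sum_apply, smul_eq_mul]
    congr 1
    simp only [contract, LinearMap.coe_mk, AddHom.coe_mk, Matrix.vecMul, dotProduct,
      Matrix.map_apply, smul_eq_C_mul, mul_comm (v _)]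
  have hdet {f : MvPolynomial (Fin (n + 1)) ℝ} (hf : f.IsHomogeneous k) : h ∣ M.det * f := by
    obtain ⟨p, hp⟩ := exists_dvd_sub_sum_C_mul hhom hv hb hf
    have h1 : h ∣ M.det * ∑ i, C (p i) * v i := by
      rw [Finset.mul_sum]
      refine Finset.dvd_sum fun i _ => ?_
      rw [mul_left_comm]
      exact (Matrix.dvd_det_mul_of_dvd_vecMul hvM i).mul_left _
    simpa only [mul_sub, sub_add_cancel] using dvd_add (hp.mul_left M.det) h1
  cases n with
  | zero =>
    refine ⟨r + k, fun l => l.elim0, fun l => l.elim0, ?_⟩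
    simpa [hM, pow_add, Matrix.det_smul] using hdet (isHomogeneous_X_pow (0 : Fin 1) k)
  | succ n =>
    exact ⟨r, A, hA, (isRelPrime_X_succ hne 0 k).dvd_of_dvd_mul_right
      (hdet (isHomogeneous_X_pow _ k))⟩
end

section
/- Let h ∈ ℝ[x₀,…,xₙ] be homogeneous of degree d ≥ 1 with h(1,0,…,0) ≠ 0, let R = ℝ[x₁,…,xₙ], let I be the ideal of R[s,t] generated by h(s) and h(t), and let δ ∈ R[s,t] be the unique polynomial with (s−t)·δ = h(s) − h(t). Then for every f ∈ R[s,t] the following are equivalent: (i) f(s,t) − f(t,s) ∈ I and (s−t)·f ∈ I; (ii) there exists g ∈ R[s,t] with f − g·δ ∈ I. -/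
open MvPolynomial

lemma dvd_sub_of_forall_X {n : ℕ}
    (φ : MvPolynomial (Fin 2) (MvPolynomial (Fin n) ℝ) →ₐ[MvPolynomial (Fin n) ℝ]
      MvPolynomial (Fin 2) (MvPolynomial (Fin n) ℝ))
    (u : MvPolynomial (Fin 2) (MvPolynomial (Fin n) ℝ))
    (hφ : ∀ i, u ∣ X i - φ (X i)) (a : MvPolynomial (Fin 2) (MvPolynomial (Fin n) ℝ)) :
    u ∣ a - φ a := by
  induction a using MvPolynomial.induction_on with
  | C r =>
    have : φ (C r) = C r := φ.commutes r
    simp [this]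
  | add p q hp hq =>
    rw [map_add, add_sub_add_comm]
    exact dvd_add hp hq
  | mul_X p i hp =>
    obtain ⟨k, hk⟩ := hp
    obtain ⟨l, hl⟩ := hφ i
    rw [map_mul]
    exact ⟨k * X i + φ p * l, by linear_combination X i * hk + φ p * hl⟩

lemma map_subs {n : ℕ}
    (φ : MvPolynomial (Fin 2) (MvPolynomial (Fin n) ℝ) →ₐ[MvPolynomial (Fin n) ℝ]
      MvPolynomial (Fin 2) (MvPolynomial (Fin n) ℝ))
    (s : MvPolynomial (Fin 2) (MvPolynomial (Fin n) ℝ)) (h : MvPolynomial (Fin (n + 1)) ℝ) :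
    φ (subs s h) = subs (φ s) h := by
  have key : (φ.restrictScalars ℝ).comp
      (aeval (Fin.cases s (fun j => C (X j)) : Fin (n + 1) → _)) =
      aeval (Fin.cases (φ s) (fun j => C (X j)) : Fin (n + 1) → _) := by
    ext1 i
    refine Fin.cases ?_ (fun j => ?_) i
    · simp
    · simp
  exact DFunLike.congr_fun key h

lemma subs_X_ne_zero {n : ℕ} (i : Fin 2) (h : MvPolynomial (Fin (n + 1)) ℝ)
    (hne : eval (Fin.cons 1 0 : Fin (n + 1) → ℝ) h ≠ 0) : subs (X i) h ≠ 0 := by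
  intro h0
  let ψ : MvPolynomial (Fin 2) (MvPolynomial (Fin n) ℝ) →+* ℝ :=
    eval₂Hom (eval (0 : Fin n → ℝ)) (fun _ => 1)
  have key : ψ.comp (aeval (Fin.cases (X i) (fun j => C (X j)) : Fin (n + 1) →
      MvPolynomial (Fin 2) (MvPolynomial (Fin n) ℝ)) : _ →ₐ[ℝ] _).toRingHom =
      eval (Fin.cons 1 0 : Fin (n + 1) → ℝ) := by
    apply MvPolynomial.ringHom_ext
    · intro r
      simp [ψ, MvPolynomial.algebraMap_apply]
    · intro k
      refine Fin.cases ?_ (fun j => ?_) k <;> simp [ψ]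
  apply hne
  rw [← key]
  change ψ (subs (X i) h) = 0
  rw [h0, map_zero]

/-- **Theorem (the Bézoutians form the principal ideal generated by `δ_h`).**
Let `h` be homogeneous of degree `d ≥ 1` with `h(1,0,…,0) ≠ 0`, let
`I = (h(s), h(t)) ⊆ R[s,t]` and let `δ` satisfy `(s−t)δ = h(s) − h(t)`. Then `f ∈ R[s,t]`
satisfies `f(s,t) − f(t,s) ∈ I` and `(s−t)f ∈ I` iff `f ≡ gδ mod I` for some `g`. -/
theorem statement3 {n d : ℕ} (hd : 1 ≤ d) (h : MvPolynomial (Fin (n + 1)) ℝ)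
    (hhom : h.IsHomogeneous d)
    (hne : eval (Fin.cons 1 0 : Fin (n + 1) → ℝ) h ≠ 0)
    (δ : MvPolynomial (Fin 2) (MvPolynomial (Fin n) ℝ))
    (hδ : (X 0 - X 1) * δ = subs (X 0) h - subs (X 1) h)
    (f : MvPolynomial (Fin 2) (MvPolynomial (Fin n) ℝ)) :
    (f - rename (Equiv.swap 0 1) f ∈ Ideal.span {subs (X 0) h, subs (X 1) h} ∧
        (X 0 - X 1) * f ∈ Ideal.span {subs (X 0) h, subs (X 1) h}) ↔
      ∃ g : MvPolynomial (Fin 2) (MvPolynomial (Fin n) ℝ),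
        f - g * δ ∈ Ideal.span {subs (X 0) h, subs (X 1) h} := by
  set p := subs (X 0) h with hp
  set q := subs (X 1) h with hq
  have hst : (X 0 - X 1 : MvPolynomial (Fin 2) (MvPolynomial (Fin n) ℝ)) ≠ 0 :=
    sub_ne_zero.mpr fun e => absurd (X_injective e) (by decide)
  constructor
  · rintro ⟨-, hf⟩
    obtain ⟨a, b, hab⟩ := Ideal.mem_span_pair.mp hf
    let φ : MvPolynomial (Fin 2) (MvPolynomial (Fin n) ℝ) →ₐ[MvPolynomial (Fin n) ℝ]
      MvPolynomial (Fin 2) (MvPolynomial (Fin n) ℝ) := aeval fun _ => X 1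
    have hX : ∀ i, φ (X i) = X 1 := fun i => aeval_X _ i
    have hφ := dvd_sub_of_forall_X φ (X 0 - X 1) (by
      intro i
      rw [hX]
      fin_cases i <;> simp)
    have hφp : φ p = q := by rw [hp, map_subs, hX]
    have hφq : φ q = q := by rw [hq, map_subs, hX]
    have h0 : φ a + φ b = 0 := by
      have e := congrArg φ hab
      simp only [map_add, map_mul, map_sub, hφp, hφq, hX, sub_self, zero_mul] at e
      rw [← add_mul] at e
      exact (mul_eq_zero.mp e).resolve_right (subs_X_ne_zero 1 h hne)
    obtain ⟨k, hk⟩ := hφ a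
    obtain ⟨l, hl⟩ := hφ b
    refine ⟨a, Ideal.mem_span_pair.mpr ⟨0, k + l, mul_left_cancel₀ hst ?_⟩⟩
    linear_combination hab - q * (hk + hl) - q * h0 + a * hδ
  · rintro ⟨g, hg⟩
    obtain ⟨a, b, hab⟩ := Ideal.mem_span_pair.mp hg
    let σ : MvPolynomial (Fin 2) (MvPolynomial (Fin n) ℝ) →ₐ[MvPolynomial (Fin n) ℝ]
      MvPolynomial (Fin 2) (MvPolynomial (Fin n) ℝ) := rename (Equiv.swap 0 1)
    have hX0 : σ (X 0) = X 1 := by simp [σ]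
    have hX1 : σ (X 1) = X 0 := by simp [σ]
    have hσp : σ p = q := by rw [hp, map_subs, hX0]
    have hσq : σ q = p := by rw [hq, map_subs, hX1]
    have hσδ : σ δ = δ := by
      have e := congrArg σ hδ
      simp only [map_mul, map_sub, hX0, hX1, hσp, hσq] at e
      exact mul_left_cancel₀ hst (by linear_combination -e - hδ)
    obtain ⟨k, hk⟩ := dvd_sub_of_forall_X σ (X 0 - X 1) (by
      intro i
      fin_cases i
      · simp [hX0]
      · exact ⟨-1, by simp only [Fin.mk_one, hX1]; ring⟩) g
    have e := congrArg σ hab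
    simp only [map_add, map_mul, map_sub, hσp, hσq, hσδ] at e
    constructor
    · change f - σ f ∈ _
      refine Ideal.mem_span_pair.mpr ⟨k + a - σ b, -k + b - σ a, ?_⟩
      linear_combination hab - e - δ * hk - k * hδ
    · refine Ideal.mem_span_pair.mpr ⟨(X 0 - X 1) * a + g, (X 0 - X 1) * b - g, ?_⟩
      linear_combination (X 0 - X 1) * hab - g * hδ
end

section
/- Let f ∈ ℝ[t] be a univariate polynomial of degree d ≥ 1. Then the following are equivalent: (i) every complex root of f is real and simple; (ii) there exists g ∈ ℝ[t] with deg(g) < d such that the Bézout matrix B(f,g) is positive definite; (iii) the Bézout matrix B(f,f′) is positive definite, where f′ is the derivative of f. -/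
open MvPolynomial

/-- `B` is the Bézout matrix of the univariate real polynomials `f` and `g` (with `f` of
degree `d`): it satisfies `f(s)g(t) − f(t)g(s) = (s−t)·Σ_{i,j} B_{ij} sⁱ tʲ` in `ℝ[s,t]`
(indices `0 ≤ i,j ≤ d−1`). -/
def IsBezoutMatrix (d : ℕ) (f g : Polynomial ℝ) (B : Matrix (Fin d) (Fin d) ℝ) : Prop :=
  Polynomial.aeval (X 0 : MvPolynomial (Fin 2) ℝ) f * Polynomial.aeval (X 1) g -
      Polynomial.aeval (X 1) f * Polynomial.aeval (X 0) g =
    (X 0 - X 1) * ∑ i : Fin d, ∑ j : Fin d, C (B i j) * X 0 ^ (i : ℕ) * X 1 ^ (j : ℕ)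

open Polynomial in
/-- Evaluation of the defining identity of the Bézout matrix at a pair of points. -/
theorem IsBezoutMatrix.aeval_sub {d : ℕ} {f g : Polynomial ℝ} {B : Matrix (Fin d) (Fin d) ℝ}
    (h : IsBezoutMatrix d f g B) {A : Type*} [CommRing A] [Algebra ℝ A] (s t : A) :
    aeval s f * aeval t g - aeval t f * aeval s g =
      (s - t) * ∑ i : Fin d, ∑ j : Fin d, algebraMap ℝ A (B i j) * s ^ (i : ℕ) * t ^ (j : ℕ) := by
  have key := congrArg (MvPolynomial.aeval ![s, t]) h
  simpa [← Polynomial.aeval_algHom_apply] using key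

open Polynomial in
theorem IsBezoutMatrix.im_eq_zero {d : ℕ} (hd : 1 ≤ d) {f g : Polynomial ℝ}
    {B : Matrix (Fin d) (Fin d) ℝ} (h : IsBezoutMatrix d f g B) (hB : B.PosDef) {z : ℂ}
    (hz : aeval z f = 0) : z.im = 0 := by
  have hz' : aeval (starRingEnd ℂ z) f = 0 := by
    rw [Polynomial.aeval_conj, hz, map_zero]
  have key := h.aeval_sub (starRingEnd ℂ z) z
  rw [hz, hz', zero_mul, zero_mul, sub_zero, eq_comm, mul_eq_zero] at key
  rcases key with key | key
  · exact Complex.conj_eq_iff_im.mp (sub_eq_zero.mp key)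
  · exfalso
    let x : Fin d → ℝ := fun i => (z ^ (i : ℕ)).re
    let y : Fin d → ℝ := fun i => (z ^ (i : ℕ)).im
    have hx : x ≠ 0 := fun h0 => by simpa [x] using congrFun h0 ⟨0, hd⟩
    have hpx := hB.dotProduct_mulVec_pos hx
    have hpy := hB.posSemidef.dotProduct_mulVec_nonneg y
    have hre := congrArg Complex.re key
    have hsum : star x ⬝ᵥ B.mulVec x + star y ⬝ᵥ B.mulVec y = 0 := by
      rw [← Complex.zero_re, ← hre]
      simp only [dotProduct, Matrix.mulVec, Finset.mul_sum, ← Finset.sum_add_distrib,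
        Complex.re_sum, ← map_pow, star_trivial]
      refine Finset.sum_congr rfl fun i _ => Finset.sum_congr rfl fun j _ => ?_
      simp only [x, y, Complex.coe_algebraMap, mul_assoc, Complex.mul_re, Complex.ofReal_re,
        Complex.ofReal_im, Complex.conj_re, Complex.conj_im]
      ring
    linarith

open Polynomial in
theorem IsBezoutMatrix.eval_derivative_ne_zero {d : ℕ} (hd : 1 ≤ d) {f g : Polynomial ℝ}
    {B : Matrix (Fin d) (Fin d) ℝ} (h : IsBezoutMatrix d f g B) (hB : B.PosDef) {r : ℝ}
    (hr : f.eval r = 0) : (derivative f).eval r ≠ 0 := by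
  intro h'
  have key := congrArg (fun p => (derivative p).eval r)
    (h.aeval_sub (Polynomial.X : Polynomial ℝ) (Polynomial.C r))
  have haev : aeval (Polynomial.C r) f = 0 := by
    have := Polynomial.aeval_algebraMap_apply (Polynomial ℝ) r f
    simpa [hr] using this
  have hag : aeval (Polynomial.C r) g = Polynomial.C (g.eval r) := by
    simpa using Polynomial.aeval_algebraMap_apply (Polynomial ℝ) r g
  simp only [haev, hag, Polynomial.aeval_X_left_apply, zero_mul, sub_zero, derivative_mul,
    derivative_C, mul_zero, add_zero, Polynomial.eval_mul, h', derivative_sub, derivative_X,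
    Polynomial.eval_add, Polynomial.eval_sub, Polynomial.eval_X, Polynomial.eval_C, sub_self,
    one_mul, eval_finsetSum, Polynomial.eval_pow, Polynomial.algebraMap_apply,
    Algebra.algebraMap_self, RingHom.id_apply] at key
  let x : Fin d → ℝ := fun i => r ^ (i : ℕ)
  have hx : x ≠ 0 := fun h0 => by simpa [x] using congrFun h0 ⟨0, hd⟩
  refine (hB.dotProduct_mulVec_pos hx).ne ?_
  rw [key]
  simp only [dotProduct, Matrix.mulVec, Finset.mul_sum, star_trivial]
  refine Finset.sum_congr rfl fun i _ => Finset.sum_congr rfl fun j _ => ?_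
  simp only [x]
  ring

open Polynomial in
theorem IsBezoutMatrix.real_simple_roots {d : ℕ} (hd : 1 ≤ d) {f g : Polynomial ℝ} (hf : f ≠ 0)
    {B : Matrix (Fin d) (Fin d) ℝ} (h : IsBezoutMatrix d f g B) (hB : B.PosDef) (z : ℂ)
    (hz : (f.map (algebraMap ℝ ℂ)).IsRoot z) :
    z.im = 0 ∧ (f.map (algebraMap ℝ ℂ)).rootMultiplicity z = 1 := by
  have hz0 : aeval z f = 0 := by rwa [IsRoot, eval_map_algebraMap] at hz
  have him := h.im_eq_zero hd hB hz0
  refine ⟨him, ?_⟩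
  obtain ⟨r, rfl⟩ : ∃ r : ℝ, (r : ℂ) = z := ⟨z.re, Complex.ext rfl him.symm⟩
  have hr : f.IsRoot r := (isRoot_map_iff (algebraMap ℝ ℂ).injective).mp hz
  have hmap : f.map (algebraMap ℝ ℂ) ≠ 0 :=
    (Polynomial.map_ne_zero_iff (algebraMap ℝ ℂ).injective).mpr hf
  refine le_antisymm ?_ ((rootMultiplicity_pos hmap).mpr hz)
  by_contra hlt
  have h2 := (one_lt_rootMultiplicity_iff_isRoot hmap).mp (not_le.mp hlt)
  refine h.eval_derivative_ne_zero hd hB hr ?_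
  have h3 := h2.2
  rw [derivative_map] at h3
  exact (isRoot_map_iff (algebraMap ℝ ℂ).injective).mp h3

open Polynomial in
theorem exists_injective_eq_prod_of_real_simple_roots {f : Polynomial ℝ} {d : ℕ} (hd : 1 ≤ d)
    (hdeg : f.natDegree = d)
    (h : ∀ z : ℂ, (f.map (algebraMap ℝ ℂ)).IsRoot z →
      z.im = 0 ∧ (f.map (algebraMap ℝ ℂ)).rootMultiplicity z = 1) :
    ∃ r : Fin d → ℝ, Function.Injective r ∧
      f = Polynomial.C f.leadingCoeff * ∏ k, (Polynomial.X - Polynomial.C (r k)) := by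
  have hf : f ≠ 0 := by rintro rfl; simp at hdeg; omega
  have hmap : f.map (algebraMap ℝ ℂ) ≠ 0 :=
    (Polynomial.map_ne_zero_iff (algebraMap ℝ ℂ).injective).mpr hf
  have hnd : (f.map (algebraMap ℝ ℂ)).roots.Nodup := by
    rw [Multiset.nodup_iff_count_le_one]
    intro z
    rw [count_roots]
    by_cases hz : (f.map (algebraMap ℝ ℂ)).IsRoot z
    · exact (h z hz).2.le
    · rw [rootMultiplicity_eq_zero hz]; exact zero_le_one
  have hcard : (f.map (algebraMap ℝ ℂ)).roots.toFinset.card = d := by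
    rw [Multiset.toFinset_card_of_nodup hnd, ← hdeg, ← natDegree_map (algebraMap ℝ ℂ)]
    exact (splits_iff_card_roots.mp (IsAlgClosed.splits _))
  let e := (Finset.equivFinOfCardEq hcard).symm
  have hroot (k : Fin d) : (f.map (algebraMap ℝ ℂ)).IsRoot (e k : ℂ) :=
    isRoot_of_mem_roots (Multiset.mem_toFinset.mp (e k).2)
  have hre (k : Fin d) : (((e k : ℂ).re : ℝ) : ℂ) = (e k : ℂ) :=
    Complex.ext rfl (h _ (hroot k)).1.symm
  let r : Fin d → ℝ := fun k => (e k : ℂ).re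
  have hinj : Function.Injective r := by
    intro a b hab
    apply e.injective
    apply Subtype.ext
    rw [← hre a, ← hre b]
    exact congrArg _ hab
  have hr (k : Fin d) : f.IsRoot (r k) := by
    have h3 := hroot k
    rw [← hre k] at h3
    exact (isRoot_map_iff (algebraMap ℝ ℂ).injective).mp h3
  have hroots : (Finset.univ.image r).val = f.roots := by
    refine Multiset.eq_of_le_of_card_le ?_ ?_
    · refine (Multiset.le_iff_subset (Finset.nodup _)).mpr fun x hx => ?_
      obtain ⟨k, -, rfl⟩ := Finset.mem_image.mp (Finset.mem_val.mp hx)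
      exact (mem_roots hf).mpr (hr k)
    · rw [Finset.card_val, Finset.card_image_of_injective _ hinj, Finset.card_univ,
        Fintype.card_fin, ← hdeg]
      exact card_roots' f
  have hc : f.roots.card = f.natDegree := by
    rw [← hroots, Finset.card_val, Finset.card_image_of_injective _ hinj, Finset.card_univ,
      Fintype.card_fin, hdeg]
  refine ⟨r, hinj, ?_⟩
  conv_lhs => rw [← C_leadingCoeff_mul_prod_multiset_X_sub_C hc, ← hroots]
  congr 1
  exact Finset.prod_image (s := Finset.univ) (f := fun a => Polynomial.X - Polynomial.C a)
    hinj.injOn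

/-- If `f = (X - r k) * q k` for all `k` and `g = ∑ k, q k`, then the Bézout matrix of `f`
and `g` is the Gram matrix of the coefficient vectors of the `q k`. -/
theorem isBezoutMatrix_transpose_mul_self {d : ℕ} {ι : Type*} [Fintype ι] {f : Polynomial ℝ}
    (q : ι → Polynomial ℝ) (r : ι → ℝ) (hq : ∀ k, (q k).natDegree < d)
    (hf : ∀ k, f = (Polynomial.X - Polynomial.C (r k)) * q k) :
    IsBezoutMatrix d f (∑ k, q k)
      ((Matrix.of fun (k : ι) (i : Fin d) => (q k).coeff i).transpose *
        Matrix.of fun (k : ι) (i : Fin d) => (q k).coeff i) := by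
  have hq' (k : ι) (x : MvPolynomial (Fin 2) ℝ) :
      Polynomial.aeval x (q k) = ∑ i : Fin d, C ((q k).coeff i) * x ^ (i : ℕ) := by
    rw [Polynomial.aeval_eq_sum_range' (hq k),
      ← Fin.sum_univ_eq_sum_range (fun i => (q k).coeff i • x ^ i)]
    simp only [smul_eq_C_mul]
  have hf' (k : ι) (x : MvPolynomial (Fin 2) ℝ) :
      Polynomial.aeval x f = (x - C (r k)) * Polynomial.aeval x (q k) := by
    conv_lhs => rw [hf k]
    simp [MvPolynomial.algebraMap_eq]
  have hsum : ∑ i : Fin d, ∑ j : Fin d,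
      C (((Matrix.of fun (k : ι) (i : Fin d) => (q k).coeff i).transpose *
        Matrix.of fun (k : ι) (i : Fin d) => (q k).coeff i) i j) *
          (X 0 : MvPolynomial (Fin 2) ℝ) ^ (i : ℕ) * X 1 ^ (j : ℕ) =
      ∑ k, Polynomial.aeval (X 0) (q k) * Polynomial.aeval (X 1) (q k) := by
    simp only [hq', Matrix.mul_apply, Matrix.transpose_apply, Matrix.of_apply, map_sum, map_mul,
      Finset.sum_mul_sum]
    simp only [Finset.sum_mul]
    rw [Finset.sum_comm (s := (Finset.univ : Finset ι))]
    refine Finset.sum_congr rfl fun i _ => ?_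
    rw [Finset.sum_comm]
    refine Finset.sum_congr rfl fun k _ => Finset.sum_congr rfl fun j _ => ?_
    ring
  rw [IsBezoutMatrix, hsum, map_sum, map_sum, Finset.mul_sum, Finset.mul_sum, Finset.mul_sum,
    ← Finset.sum_sub_distrib]
  refine Finset.sum_congr rfl fun k _ => ?_
  rw [hf' k, hf' k]
  ring

open Polynomial in
/-- The matrix of coefficients of polynomials `q k` which are nonzero at `r k` and vanish at
all other `r l` acts injectively. -/
theorem mulVec_injective_of_eval_eq_zero {d : ℕ} {q : Fin d → Polynomial ℝ} {r : Fin d → ℝ}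
    (hq : ∀ k, (q k).natDegree < d) (h0 : ∀ k l, k ≠ l → (q k).eval (r l) = 0)
    (h1 : ∀ k, (q k).eval (r k) ≠ 0) :
    Function.Injective (Matrix.of fun (k : Fin d) (i : Fin d) => (q k).coeff i).mulVec := by
  rw [Matrix.mulVec_injective_iff_isUnit]
  have hAV : (Matrix.of fun (k : Fin d) (i : Fin d) => (q k).coeff i) *
      (Matrix.vandermonde r).transpose = Matrix.diagonal fun k => (q k).eval (r k) := by
    ext k l
    simp only [Matrix.mul_apply, Matrix.of_apply, Matrix.transpose_apply,
      Matrix.vandermonde_apply]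
    rw [Fin.sum_univ_eq_sum_range (fun i => (q k).coeff i * r l ^ i),
      ← eval_eq_sum_range' (hq k)]
    by_cases hkl : k = l
    · subst hkl; simp
    · rw [h0 k l hkl, Matrix.diagonal_apply_ne _ hkl]
  rw [Matrix.isUnit_iff_isUnit_det, isUnit_iff_ne_zero]
  refine left_ne_zero_of_mul (b := (Matrix.vandermonde r).transpose.det) ?_
  rw [← Matrix.det_mul, hAV, Matrix.det_diagonal]
  exact Finset.prod_ne_zero_iff.mpr fun k _ => h1 k

open Polynomial in
theorem exists_posDef_isBezoutMatrix_derivative {d : ℕ} {f : Polynomial ℝ} (hdeg : f.natDegree = d)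
    {c : ℝ} (hc : c ≠ 0) {r : Fin d → ℝ} (hr : Function.Injective r)
    (hf : f = Polynomial.C c * ∏ k, (Polynomial.X - Polynomial.C (r k))) :
    ∃ B : Matrix (Fin d) (Fin d) ℝ, IsBezoutMatrix d f (derivative f) B ∧ B.PosDef := by
  let q : Fin d → Polynomial ℝ := fun k =>
    Polynomial.C c * ∏ j ∈ Finset.univ.erase k, (Polynomial.X - Polynomial.C (r j))
  have hfq (k : Fin d) : f = (Polynomial.X - Polynomial.C (r k)) * q k := by
    rw [hf, ← Finset.mul_prod_erase Finset.univ _ (Finset.mem_univ k)]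
    ring
  have hq (k : Fin d) : (q k).natDegree < d := by
    have hq0 : q k ≠ 0 :=
      mul_ne_zero (C_ne_zero.mpr hc) (Finset.prod_ne_zero_iff.mpr fun j _ => X_sub_C_ne_zero _)
    have := hdeg
    rw [hfq k, natDegree_mul (X_sub_C_ne_zero _) hq0, natDegree_X_sub_C] at this
    omega
  have hder : derivative f = ∑ k, q k := by
    rw [hf, derivative_C_mul, derivative_prod_finset, Finset.mul_sum]
    simp [q]
  refine ⟨_, hder ▸ isBezoutMatrix_transpose_mul_self q r hq hfq, ?_⟩
  rw [← Matrix.conjTranspose_eq_transpose_of_trivial]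
  refine Matrix.PosDef.conjTranspose_mul_self _
    (mulVec_injective_of_eval_eq_zero (r := r) hq (fun k l hkl => ?_) fun k => ?_)
  · simp only [q, Polynomial.eval_mul, Polynomial.eval_prod]
    rw [Finset.prod_eq_zero (Finset.mem_erase.mpr ⟨hkl.symm, Finset.mem_univ l⟩) (by simp),
      mul_zero]
  · simp only [q, Polynomial.eval_mul, Polynomial.eval_prod, Polynomial.eval_C,
      Polynomial.eval_sub, Polynomial.eval_X]
    refine mul_ne_zero hc (Finset.prod_ne_zero_iff.mpr fun j hj => sub_ne_zero.mpr fun h => ?_)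
    exact (Finset.mem_erase.mp hj).1 (hr h.symm)

/-- **Theorem (classical property of the Bézout matrix).** For a univariate real
polynomial `f` of degree `d ≥ 1`, the following are equivalent: (i) every complex root of
`f` is real and simple; (ii) there is a `g` with `deg g < d` whose Bézout matrix `B(f,g)`
is positive definite; (iii) the Bézout matrix `B(f,f′)` is positive definite. -/
theorem statement5 (d : ℕ) (hd : 1 ≤ d) (f : Polynomial ℝ) (hdeg : f.natDegree = d) :
    ((∀ z : ℂ, (f.map (algebraMap ℝ ℂ)).IsRoot z →
        z.im = 0 ∧ (f.map (algebraMap ℝ ℂ)).rootMultiplicity z = 1) ↔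
      ∃ (g : Polynomial ℝ) (B : Matrix (Fin d) (Fin d) ℝ),
        g.degree < d ∧ IsBezoutMatrix d f g B ∧ B.PosDef) ∧
    ((∀ z : ℂ, (f.map (algebraMap ℝ ℂ)).IsRoot z →
        z.im = 0 ∧ (f.map (algebraMap ℝ ℂ)).rootMultiplicity z = 1) ↔
      ∃ B : Matrix (Fin d) (Fin d) ℝ,
        IsBezoutMatrix d f (Polynomial.derivative f) B ∧ B.PosDef) := by
  have hf : f ≠ 0 := by
    rintro rfl
    rw [Polynomial.natDegree_zero] at hdeg
    omega
  have key : (∀ z : ℂ, (f.map (algebraMap ℝ ℂ)).IsRoot z →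
      z.im = 0 ∧ (f.map (algebraMap ℝ ℂ)).rootMultiplicity z = 1) →
      ∃ B : Matrix (Fin d) (Fin d) ℝ,
        IsBezoutMatrix d f (Polynomial.derivative f) B ∧ B.PosDef := fun h => by
    obtain ⟨r, hr, hprod⟩ := exists_injective_eq_prod_of_real_simple_roots hd hdeg h
    exact exists_posDef_isBezoutMatrix_derivative hdeg
      (Polynomial.leadingCoeff_ne_zero.mpr hf) hr hprod
  refine ⟨⟨fun h => ?_, fun ⟨g, B, _, hB, hpos⟩ => hB.real_simple_roots hd hf hpos⟩,
    key, fun ⟨B, hB, hpos⟩ => hB.real_simple_roots hd hf hpos⟩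
  obtain ⟨B, hB, hpos⟩ := key h
  refine ⟨Polynomial.derivative f, B, ?_, hB, hpos⟩
  rw [← hdeg, ← Polynomial.degree_eq_natDegree hf]
  exact Polynomial.degree_derivative_lt hf
end

section
/- Let R = ℝ[x₁,…,xₙ], let m ≥ 1, let α₁,…,α_m be natural numbers, and let Λ be a symmetric m×m matrix with entries in R whose (i,j) entry is homogeneous of degree αᵢ + αⱼ, such that the real symmetric matrix Λ(p), obtained by evaluating all entries at p, is positive definite for every 0 ≠ p ∈ ℝⁿ. Then there exists a homogeneous polynomial q ∈ R which is a sum of squares in R and satisfies q(p) > 0 for every 0 ≠ p ∈ ℝⁿ, and a matrix B with entries in R, such that q·Λ = B·Bᵀ. -/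
open MvPolynomial

/-- `q` is a sum of squares of polynomials. -/
def IsSOS {n : ℕ} (q : MvPolynomial (Fin n) ℝ) : Prop :=
  ∃ (s : ℕ) (g : Fin s → MvPolynomial (Fin n) ℝ), q = ∑ i, (g i) ^ 2

open MvPolynomial Matrix

section Gram

variable {ι κ S : Type*} [CommRing S]

/-- A square matrix is a Gram matrix (a sum of squares) if it has the form `B * Bᵀ`. -/
def IsGram (A : Matrix ι ι S) : Prop :=
  ∃ (s : ℕ) (B : Matrix ι (Fin s) S), A = B * Bᵀ

theorem isGram_mul_transpose [Fintype κ] (B : Matrix ι κ S) : IsGram (B * Bᵀ) := by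
  refine ⟨Fintype.card κ, B.submatrix id (Fintype.equivFin κ).symm, ?_⟩
  rw [transpose_submatrix, submatrix_mul_equiv, submatrix_id_id]

theorem isGram_zero : IsGram (0 : Matrix ι ι S) := ⟨0, 0, by simp⟩

theorem IsGram.add {A A' : Matrix ι ι S} (h : IsGram A) (h' : IsGram A') : IsGram (A + A') := by
  obtain ⟨s, B, rfl⟩ := h
  obtain ⟨s', B', rfl⟩ := h'
  rw [← fromCols_mul_fromRows, ← transpose_fromCols]
  exact isGram_mul_transpose _

theorem isGram_sum {τ : Type*} (t : Finset τ) (A : τ → Matrix ι ι S) (h : ∀ i ∈ t, IsGram (A i)) :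
    IsGram (∑ i ∈ t, A i) :=
  Finset.sum_induction A IsGram (fun _ _ => IsGram.add) isGram_zero h

theorem IsGram.conj [Fintype ι] {A : Matrix ι ι S} (h : IsGram A) (P : Matrix κ ι S) :
    IsGram (P * A * Pᵀ) := by
  obtain ⟨s, B, rfl⟩ := h
  exact ⟨s, P * B, by simp only [transpose_mul, Matrix.mul_assoc]⟩

theorem IsGram.sq_smul {A : Matrix ι ι S} (h : IsGram A) (a : S) : IsGram (a ^ 2 • A) := by
  obtain ⟨s, B, rfl⟩ := h
  exact ⟨s, a • B, by rw [transpose_smul, Matrix.smul_mul, Matrix.mul_smul, smul_smul, sq]⟩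

theorem Matrix.PosSemidef.isGram_map [Finite ι] [Algebra ℝ S] {A : Matrix ι ι ℝ}
    (h : A.PosSemidef) : IsGram (A.map (algebraMap ℝ S)) := by
  obtain ⟨m, v, rfl⟩ := posSemidef_iff_eq_sum_vecMulVec.mp h
  refine ⟨m, Matrix.of fun i k => algebraMap ℝ S (v k i), ?_⟩
  ext i j
  simp [Matrix.mul_apply, Matrix.sum_apply, vecMulVec_apply]

end Gram

section Words

variable {K S : Type*} [Fintype K]

open scoped Pointwise in
theorem MvPolynomial.IsHomogeneous.exists_eq_sum_words {d : ℕ} {P : MvPolynomial K ℝ}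
    (hP : P.IsHomogeneous d) :
    ∃ c : (Fin d → K) → ℝ, P = ∑ u, c u • ∏ j, X (u j) := by
  have hmem : P ∈ homogeneousSubmodule K ℝ d := hP
  rw [← MvPolynomial.homogeneousSubmodule_one_pow,
    MvPolynomial.homogeneousSubmodule_one_eq_span_X, Submodule.span_pow] at hmem
  have hsub : (Set.range (X : K → MvPolynomial K ℝ)) ^ d ⊆
      Set.range fun u : Fin d → K => ∏ j, (X (u j) : MvPolynomial K ℝ) := by
    intro x hx
    obtain ⟨f, rfl⟩ := Set.mem_pow.mp hx
    choose u hu using fun i => (f i).2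
    exact ⟨u, by simp [List.prod_ofFn, hu]⟩
  obtain ⟨c, hc⟩ := (Submodule.mem_span_range_iff_exists_fun ℝ).mp
    (Submodule.span_mono hsub hmem)
  exact ⟨c, hc.symm⟩

/-- Summing over all words of length `N` a function of the letters at `d` prescribed positions. -/
theorem sum_words_comp_embedding [CommRing S] {d M N : ℕ} (hN : d + M = N)
    (σ : Fin d ↪ Fin N) (y : K → S) (g : (Fin d → K) → S) :
    ∑ w : Fin N → K, (∏ i, y (w i)) * g (w ∘ σ) =
      (∑ k, y k) ^ M * ∑ u : Fin d → K, (∏ j, y (u j)) * g u := by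
  classical
  have hcard : Fintype.card ((Set.range σ)ᶜ : Set (Fin N)) = M := by
    rw [Fintype.card_compl_set, Set.card_range_of_injective σ.injective]
    simp; omega
  let e : Fin d ⊕ Fin M ≃ Fin N :=
    (Equiv.sumCongr (Equiv.ofInjective σ σ.injective) (Fintype.equivFinOfCardEq hcard).symm).trans
      (Equiv.Set.sumCompl _)
  have he : ∀ j, e (Sum.inl j) = σ j := fun j => by simp [e]
  let E : (Fin N → K) ≃ (Fin d → K) × (Fin M → K) :=
    (e.symm.arrowCongr (Equiv.refl K)).trans (Equiv.sumArrowEquivProdArrow _ _ _)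
  have hE : ∀ w : Fin N → K, (∏ i, y (w i)) * g (w ∘ σ) =
      (∏ j, y ((E w).1 j)) * (∏ l, y ((E w).2 l)) * g (E w).1 := by
    intro w
    have h1 : (E w).1 = w ∘ σ := by
      funext j; simp [E, Equiv.sumArrowEquivProdArrow, he]
    have h2 : ∏ i, y (w i) = (∏ j, y ((E w).1 j)) * ∏ l, y ((E w).2 l) := by
      rw [← e.prod_comp, Fintype.prod_sum_type]
      simp [E, Equiv.sumArrowEquivProdArrow]
    rw [h2, h1]
  rw [Fintype.sum_congr _ _ hE,
    E.sum_comp (fun p => (∏ j, y (p.1 j)) * (∏ l, y (p.2 l)) * g p.1),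
    Fintype.sum_prod_type, Finset.sum_pow', Fintype.piFinset_univ, Finset.mul_sum]
  refine Finset.sum_congr rfl fun u _ => ?_
  rw [Finset.sum_mul]
  exact Finset.sum_congr rfl fun _ _ => by ring

/-- Averaging over all choices of `d` positions in a word evaluates a form at the letter
frequencies of the word. -/
theorem sum_comp_eq_sum_frequencies [DecidableEq K] {d N : ℕ} (w : Fin N → K)
    (g : (Fin d → K) → ℝ) :
    ∑ σ : Fin d → Fin N, g (w ∘ σ) =
      ∑ u : Fin d → K, (∏ j, ∑ i : Fin N, if w i = u j then (1 : ℝ) else 0) * g u := by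
  simp_rw [Fintype.prod_sum, Finset.sum_mul]
  rw [Finset.sum_comm]
  refine Finset.sum_congr rfl fun σ _ => ?_
  have h : ∀ u : Fin d → K, (∏ j, if w (σ j) = u j then (1 : ℝ) else 0) =
      if w ∘ σ = u then 1 else 0 := by
    intro u
    rw [Finset.prod_ite_zero]
    simp [funext_iff]
  simp [h]

theorem sum_embedding_comp_nonneg {d N : ℕ} (hN : 0 < N) {ε b : ℝ}
    (hNb : ((N : ℝ) ^ d - N.descFactorial d) * b ≤ N ^ d * ε)
    (g : (Fin d → K) → ℝ) (hb : ∀ u, g u ≤ b)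
    (hg : ∀ y ∈ stdSimplex ℝ K, ε ≤ ∑ u : Fin d → K, (∏ j, y (u j)) * g u) (w : Fin N → K) :
    0 ≤ ∑ σ : Fin d ↪ Fin N, g (w ∘ σ) := by
  classical
  have hN' : (0 : ℝ) < N := by exact_mod_cast hN
  let y : K → ℝ := fun k => (∑ i : Fin N, if w i = k then (1 : ℝ) else 0) / N
  have hy : y ∈ stdSimplex ℝ K := by
    refine ⟨fun k => by positivity, ?_⟩
    simp only [y]
    rw [← Finset.sum_div, Finset.sum_comm]
    simp [hN'.ne']
  have hall : N ^ d * ε ≤ ∑ σ : Fin d → Fin N, g (w ∘ σ) := by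
    rw [sum_comp_eq_sum_frequencies]
    calc N ^ d * ε ≤ N ^ d * ∑ u : Fin d → K, (∏ j, y (u j)) * g u := by
          gcongr; exact hg y hy
      _ = _ := by
          simp only [y, Finset.prod_div_distrib, Finset.prod_const, Finset.card_univ,
            Fintype.card_fin, Finset.mul_sum]
          refine Finset.sum_congr rfl fun u _ => ?_
          field_simp
  have hinj : ∑ σ : Fin d ↪ Fin N, (b - g (w ∘ σ)) ≤ ∑ σ : Fin d → Fin N, (b - g (w ∘ σ)) := by
    refine (Finset.sum_map Finset.univ ⟨_, DFunLike.coe_injective⟩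
      (fun σ : Fin d → Fin N => b - g (w ∘ σ))).symm.trans_le ?_
    exact Finset.sum_le_univ_sum_of_nonneg fun σ => sub_nonneg.mpr (hb _)
  simp only [Finset.sum_sub_distrib, Finset.sum_const, Finset.card_univ, nsmul_eq_mul,
    Fintype.card_embedding_eq, Fintype.card_fun, Fintype.card_fin, Nat.cast_pow] at hinj
  linarith

theorem exists_pow_sub_descFactorial_le (d : ℕ) {ε : ℝ} (hε : 0 < ε) (b : ℝ) :
    ∃ M : ℕ, 0 < d + M ∧
      (((d + M : ℕ) : ℝ) ^ d - (d + M).descFactorial d) * b ≤ ((d + M : ℕ) : ℝ) ^ d * ε := by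
  have hlim : Filter.Tendsto (fun M : ℕ => (1 - ((M : ℝ) / (M + d)) ^ d) * |b|) Filter.atTop
      (nhds ((1 - 1 ^ d) * |b|)) :=
    (((tendsto_natCast_div_add_atTop (d : ℝ)).pow d).const_sub 1).mul_const _
  rw [one_pow, sub_self, zero_mul] at hlim
  obtain ⟨M, hM, hM0⟩ := ((hlim.eventually_le_const hε).and (Filter.eventually_gt_atTop 0)).exists
  refine ⟨M, by omega, ?_⟩
  have hpos : (0 : ℝ) < M + d := by positivity
  have hdesc : (M : ℝ) ^ d ≤ (d + M).descFactorial d := by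
    refine le_trans ?_ (Nat.cast_le.mpr (Nat.pow_sub_le_descFactorial (d + M) d))
    rw [Nat.cast_pow]
    gcongr
    omega
  have hle : ((d + M).descFactorial d : ℝ) ≤ ((d + M : ℕ) : ℝ) ^ d := by
    exact_mod_cast Nat.descFactorial_le_pow _ _
  calc (((d + M : ℕ) : ℝ) ^ d - (d + M).descFactorial d) * b
      ≤ (((d + M : ℕ) : ℝ) ^ d - (d + M).descFactorial d) * |b| :=
        mul_le_mul_of_nonneg_left (le_abs_self b) (sub_nonneg.mpr hle)
    _ ≤ (((d + M : ℕ) : ℝ) ^ d - (M : ℝ) ^ d) * |b| := by gcongr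
    _ = ((d + M : ℕ) : ℝ) ^ d * ((1 - ((M : ℝ) / (M + d)) ^ d) * |b|) := by
        push_cast
        rw [div_pow, add_comm (d : ℝ)]
        field_simp
    _ ≤ _ := by gcongr

end Words

section Polya

variable {ι K S : Type*} [Fintype ι] [Fintype K]

theorem IsCompact.exists_pos_le_of_pos {X : Type*} [TopologicalSpace X] {Z : Set X}
    (hZ : IsCompact Z) {f : X → ℝ} (hf : ContinuousOn f Z) (hpos : ∀ x ∈ Z, 0 < f x) :
    ∃ ε > 0, ∀ x ∈ Z, ε ≤ f x := by
  rcases Z.eq_empty_or_nonempty with rfl | hne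
  · exact ⟨1, one_pos, by simp⟩
  · obtain ⟨x, hx, hmin⟩ := hZ.exists_isMinOn hne hf
    exact ⟨f x, hpos x hx, fun y hy => hmin hy⟩

theorem IsCompact.exists_add_mul_pos {X : Type*} [TopologicalSpace X] {Z : Set X}
    (hZ : IsCompact Z) {f g : X → ℝ} (hf : Continuous f) (hg : Continuous g)
    (hg0 : ∀ x ∈ Z, 0 ≤ g x) (hfg : ∀ x ∈ Z, g x = 0 → 0 < f x) :
    ∃ c : ℝ, ∀ x ∈ Z, 0 < f x + c * g x := by
  have hZ' : IsCompact (Z ∩ {x | f x ≤ 0}) := hZ.inter_right (isClosed_le hf continuous_const)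
  obtain ⟨δ, hδ, hδg⟩ := hZ'.exists_pos_le_of_pos hg.continuousOn fun x hx =>
    (hg0 x hx.1).lt_of_ne fun h => (hfg x hx.1 h.symm).not_ge hx.2
  obtain ⟨b, hb⟩ := hZ.exists_bound_of_continuousOn hf.continuousOn
  refine ⟨(|b| + 1) / δ, fun x hx => ?_⟩
  by_cases h : f x ≤ 0
  · have h1 : |b| + 1 ≤ (|b| + 1) / δ * g x := by
      rw [div_mul_eq_mul_div, le_div_iff₀ hδ]
      gcongr
      exact hδg x ⟨hx, h⟩
    have h2 := neg_le_of_abs_le (hb x hx)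
    have h3 := le_abs_self b
    linarith
  · have := hg0 x hx
    push Not at h
    positivity

theorem Matrix.smul_dotProduct_mulVec_smul (A : Matrix ι ι ℝ) (t : ℝ) (v : ι → ℝ) :
    (t • v) ⬝ᵥ A *ᵥ (t • v) = t ^ 2 * (v ⬝ᵥ A *ᵥ v) := by
  rw [mulVec_smul, smul_dotProduct, dotProduct_smul, smul_eq_mul, smul_eq_mul]
  ring

theorem exists_smul_mem_sphere {v : ι → ℝ} (hv : v ≠ 0) :
    ∃ t > (0 : ℝ), ∃ u ∈ Metric.sphere (0 : ι → ℝ) 1, v = t • u :=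
  ⟨‖v‖, norm_pos_iff.mpr hv, ‖v‖⁻¹ • v, by simp [norm_smul, hv], by simp [smul_smul, hv]⟩

theorem Matrix.dotProduct_mulVec_le_sum_abs (A : Matrix ι ι ℝ) {v : ι → ℝ}
    (hv : v ∈ Metric.sphere (0 : ι → ℝ) 1) : v ⬝ᵥ A *ᵥ v ≤ ∑ i, ∑ j, |A i j| := by
  have h1 : ∀ i, |v i| ≤ 1 := fun i => by
    simpa [mem_sphere_zero_iff_norm.mp hv] using norm_le_pi_norm v i
  simp only [dotProduct, mulVec, Finset.mul_sum]
  refine Finset.sum_le_sum fun i _ => Finset.sum_le_sum fun j _ => (le_abs_self _).trans ?_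
  rw [abs_mul, abs_mul]
  have hj : |A i j| * |v j| ≤ |A i j| := mul_le_of_le_one_right (abs_nonneg _) (h1 j)
  exact (mul_le_of_le_one_left (by positivity) (h1 i)).trans hj

/-- Pólya's theorem for matrices of forms, with squares substituted for the variables. -/
theorem exists_isGram_sum_sq_pow_smul [CommRing S] [Algebra ℝ S] {d : ℕ}
    (F : Matrix ι ι (MvPolynomial K ℝ)) (hF : ∀ i j, (F i j).IsHomogeneous d)
    (hpos : ∀ y ∈ stdSimplex ℝ K, ∀ v : ι → ℝ, v ≠ 0 → 0 < v ⬝ᵥ F.map (eval y) *ᵥ v)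
    (z : K → S) :
    ∃ M : ℕ, IsGram ((∑ k, z k ^ 2) ^ M • (F + Fᵀ).map (aeval fun k => z k ^ 2)) := by
  classical
  choose c hc using fun i j => (hF i j).exists_eq_sum_words
  let A : (Fin d → K) → Matrix ι ι ℝ := fun u => Matrix.of fun i j => c i j u
  have hFA : ∀ y : K → ℝ, F.map (eval y) = ∑ u, (∏ j, y (u j)) • A u := by
    intro y
    ext i j
    simp [hc, A, Matrix.sum_apply, smul_eval, mul_comm, map_prod]
  have hquad : ∀ (y : K → ℝ) (v : ι → ℝ),
      v ⬝ᵥ F.map (eval y) *ᵥ v = ∑ u, (∏ j, y (u j)) * (v ⬝ᵥ A u *ᵥ v) := by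
    intro y v
    rw [hFA, Matrix.sum_mulVec, dotProduct_sum]
    simp [Matrix.smul_mulVec]
  obtain ⟨ε, hε, hεle⟩ := ((isCompact_stdSimplex ℝ K).prod
    (isCompact_sphere (0 : ι → ℝ) 1)).exists_pos_le_of_pos
    (f := fun p : (K → ℝ) × (ι → ℝ) => ∑ u, (∏ j, p.1 (u j)) * (p.2 ⬝ᵥ A u *ᵥ p.2))
    (by simp only [dotProduct, mulVec]; fun_prop)
    (fun p hp => by
      rw [← hquad]
      exact hpos _ hp.1 _ fun h0 => by simpa [h0] using hp.2)
  let b : ℝ := ∑ u, ∑ i, ∑ j, |A u i j|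
  have hb : ∀ v ∈ Metric.sphere (0 : ι → ℝ) 1, ∀ u, v ⬝ᵥ A u *ᵥ v ≤ b := fun v hv u =>
    ((A u).dotProduct_mulVec_le_sum_abs hv).trans
      (Finset.single_le_sum (f := fun u => ∑ i, ∑ j, |A u i j|)
        (fun _ _ => by positivity) (Finset.mem_univ u))
  obtain ⟨M, hN, hNb⟩ := exists_pow_sub_descFactorial_le d hε b
  let P : (Fin (d + M) → K) → Matrix ι ι ℝ := fun w =>
    ∑ σ : Fin d ↪ Fin (d + M), (A (w ∘ σ) + (A (w ∘ σ))ᵀ)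
  have hP : ∀ w, (P w).PosSemidef := by
    intro w
    refine .of_dotProduct_mulVec_nonneg ?_ fun v => ?_
    · ext i j
      simp [P, Matrix.sum_apply, add_comm]
    · rw [star_trivial]
      rcases eq_or_ne v 0 with rfl | hv
      · simp
      obtain ⟨t, -, x, hx, rfl⟩ := exists_smul_mem_sphere hv
      rw [smul_dotProduct_mulVec_smul]
      have h := sum_embedding_comp_nonneg hN hNb (fun u => x ⬝ᵥ A u *ᵥ x) (hb x hx)
        (fun y hy => hεle (y, x) ⟨hy, hx⟩) w
      have hPx : x ⬝ᵥ P w *ᵥ x = 2 * ∑ σ : Fin d ↪ Fin (d + M), x ⬝ᵥ A (w ∘ σ) *ᵥ x := by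
        simp only [P, Matrix.sum_mulVec, dotProduct_sum, Matrix.add_mulVec, dotProduct_add,
          Finset.mul_sum, two_mul]
        refine Finset.sum_congr rfl fun σ _ => ?_
        rw [mulVec_transpose, dotProduct_comm x (x ᵥ* _), dotProduct_mulVec x]
      rw [hPx]
      exact mul_nonneg (sq_nonneg t) (mul_nonneg zero_le_two h)
  let D : ℝ := (d + M).descFactorial d
  have hD : 0 < D := Nat.cast_pos.mpr (Nat.descFactorial_pos.mpr (Nat.le_add_right d M))
  have hgram : IsGram (∑ w : Fin (d + M) → K,
      (∏ i, z (w i)) ^ 2 • (P w).map (algebraMap ℝ S)) :=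
    isGram_sum _ _ fun w _ => (hP w).isGram_map.sq_smul _
  have hsum : ∑ w : Fin (d + M) → K, (∏ i, z (w i)) ^ 2 • (P w).map (algebraMap ℝ S) =
      algebraMap ℝ S D • ((∑ k, z k ^ 2) ^ M • (F + Fᵀ).map (aeval fun k => z k ^ 2)) := by
    ext i j
    have hentry := fun σ : Fin d ↪ Fin (d + M) => sum_words_comp_embedding rfl σ
      (fun k => z k ^ 2) fun u => algebraMap ℝ S (A u i j + A u j i)
    have haeval : (F i j + F j i).aeval (fun k => z k ^ 2) =
        ∑ u : Fin d → K, (∏ l, z (u l) ^ 2) * algebraMap ℝ S (A u i j + A u j i) := by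
      rw [hc i j, hc j i, ← Finset.sum_add_distrib, map_sum]
      refine Finset.sum_congr rfl fun u _ => ?_
      simp [A, Algebra.smul_def, map_prod]
      ring
    simp only [Matrix.sum_apply, Matrix.smul_apply, Matrix.map_apply, P, Matrix.add_apply,
      Matrix.transpose_apply, smul_eq_mul, map_sum, Finset.mul_sum]
    rw [Finset.sum_comm]
    simp only [← Finset.prod_pow]
    rw [Finset.sum_congr rfl fun σ _ => hentry σ, haeval]
    simp [D, Fintype.card_embedding_eq]
  rw [hsum] at hgram
  refine ⟨M, ?_⟩
  have := hgram.sq_smul (algebraMap ℝ S √D⁻¹)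
  rwa [smul_smul, ← map_pow, ← map_mul, Real.sq_sqrt (by positivity), inv_mul_cancel₀ hD.ne',
    map_one, one_smul] at this

end Polya

section Lift

variable {n : ℕ}

/-- The linear forms `xᵢ + xⱼ` and `xᵢ - xⱼ`. -/
noncomputable def pairForm : Fin n × Fin n × Bool → MvPolynomial (Fin n) ℝ
  | (i, j, true) => X i + X j
  | (i, j, false) => X i - X j

theorem pairForm_isHomogeneous (k : Fin n × Fin n × Bool) : (pairForm k).IsHomogeneous 1 := by
  rcases k with ⟨i, j, _ | _⟩
  · exact (isHomogeneous_X ℝ i).sub (isHomogeneous_X ℝ j)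
  · exact (isHomogeneous_X ℝ i).add (isHomogeneous_X ℝ j)

theorem MvPolynomial.IsHomogeneous.exists_aeval_pairForm_sq {a : ℕ}
    {P : MvPolynomial (Fin n) ℝ} (hP : P.IsHomogeneous (2 * a)) :
    ∃ G : MvPolynomial (Fin n × Fin n × Bool) ℝ,
      G.IsHomogeneous a ∧ MvPolynomial.aeval (fun k => pairForm k ^ 2) G = P := by
  let φ : MvPolynomial (Fin n × Fin n × Bool) ℝ →ₐ[ℝ] MvPolynomial (Fin n) ℝ :=
    MvPolynomial.aeval fun k => pairForm k ^ 2
  have hmul : homogeneousSubmodule (Fin n) ℝ 1 ^ 2 ≤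
      (homogeneousSubmodule (Fin n × Fin n × Bool) ℝ 1).map φ.toLinearMap := by
    rw [homogeneousSubmodule_one_eq_span_X (σ := Fin n), sq, Submodule.span_mul_span,
      Submodule.span_le]
    rintro _ ⟨_, ⟨i, rfl⟩, _, ⟨j, rfl⟩, rfl⟩
    refine ⟨C (1 / 4) * (X (i, j, true) - X (i, j, false)),
      ((isHomogeneous_X ℝ _).sub (isHomogeneous_X ℝ _)).C_mul _, ?_⟩
    simp only [φ, AlgHom.toLinearMap_apply, map_mul, map_sub, aeval_X, aeval_C, pairForm,
      algebraMap_eq]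
    have h4 : (C (1 / 4) : MvPolynomial (Fin n) ℝ) * 4 = 1 := by
      rw [← map_ofNat (C : ℝ →+* MvPolynomial (Fin n) ℝ) 4, ← map_mul]
      norm_num
    linear_combination (X i * X j) * h4
  have hmem : P ∈ homogeneousSubmodule (Fin n) ℝ (2 * a) := hP
  rw [← homogeneousSubmodule_one_pow, pow_mul] at hmem
  replace hmem := pow_le_pow_left' hmul a hmem
  rw [← Submodule.map_pow] at hmem
  obtain ⟨G, hG, hGP⟩ := hmem
  rw [homogeneousSubmodule_one_pow] at hG
  exact ⟨G, hG, hGP⟩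

/-- The difference of the variables standing for `(xᵢ + xⱼ)²` and `(xᵢ - xⱼ)²`. -/
noncomputable def pairDiff (i j : Fin n) : MvPolynomial (Fin n × Fin n × Bool) ℝ :=
  X (i, j, true) - X (i, j, false)

/-- A form, nonnegative everywhere, whose zeros in the simplex are values of the map
`p ↦ (pairForm k (p) ^ 2)ₖ`. -/
noncomputable def veroneseForm (n : ℕ) : MvPolynomial (Fin n × Fin n × Bool) ℝ :=
  (∑ i, ∑ j, ∑ k, ∑ l,
    (pairDiff i j * pairDiff k l - pairDiff i k * pairDiff j l) ^ 2) +
  (∑ k, X k) ^ 2 * ∑ i, ∑ j,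
    ((C 4 * X (i, j, true) - pairDiff i i - pairDiff j j - C 2 * pairDiff i j) ^ 2 +
      (C 4 * X (i, j, false) - pairDiff i i - pairDiff j j + C 2 * pairDiff i j) ^ 2)

theorem veroneseForm_isHomogeneous : (veroneseForm n).IsHomogeneous 4 := by
  have hX : ∀ k : Fin n × Fin n × Bool,
      (X k : MvPolynomial (Fin n × Fin n × Bool) ℝ).IsHomogeneous 1 := isHomogeneous_X ℝ
  have hE : ∀ i j : Fin n, (pairDiff i j).IsHomogeneous 1 := fun i j => (hX _).sub (hX _)
  refine .add (.sum _ _ _ fun i _ => .sum _ _ _ fun j _ => .sum _ _ _ fun k _ =>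
    .sum _ _ _ fun l _ => ?_) ?_
  · exact (((hE i j).mul (hE k l)).sub ((hE i k).mul (hE j l))).pow 2
  · refine ((IsHomogeneous.sum _ _ 1 fun k _ => hX k).pow 2).mul (n := 2)
      (.sum _ _ _ fun i _ => .sum _ _ _ fun j _ => .add ?_ ?_)
    · exact (((((hX _).C_mul 4).sub (hE i i)).sub (hE j j)).sub ((hE i j).C_mul 2)).pow 2
    · exact (((((hX _).C_mul 4).sub (hE i i)).sub (hE j j)).add ((hE i j).C_mul 2)).pow 2

theorem aeval_veroneseForm :
    aeval (fun k : Fin n × Fin n × Bool => pairForm k ^ 2) (veroneseForm n) = 0 := by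
  have h4 : (C 4 : MvPolynomial (Fin n) ℝ) = 4 := map_ofNat C 4
  have h2 : (C 2 : MvPolynomial (Fin n) ℝ) = 2 := map_ofNat C 2
  simp only [veroneseForm, pairDiff, map_add, map_sum, map_pow, map_mul, map_sub, aeval_X,
    aeval_C, pairForm, algebraMap_eq, h4, h2]
  rw [Finset.sum_eq_zero, Finset.sum_eq_zero (s := Finset.univ (α := Fin n))]
  · simp
  · exact fun i _ => Finset.sum_eq_zero fun j _ => by ring
  · exact fun i _ => Finset.sum_eq_zero fun j _ => Finset.sum_eq_zero fun k _ =>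
      Finset.sum_eq_zero fun l _ => by ring

theorem eval_veroneseForm_nonneg (y : Fin n × Fin n × Bool → ℝ) :
    0 ≤ eval y (veroneseForm n) := by
  simp only [veroneseForm, map_add, map_sum, map_pow, map_mul]
  positivity

theorem exists_eq_pairForm_sq {y : Fin n × Fin n × Bool → ℝ} (hy : y ∈ stdSimplex ℝ _)
    (h0 : eval y (veroneseForm n) = 0) :
    ∃ p : Fin n → ℝ, p ≠ 0 ∧ y = fun k => eval p (pairForm k) ^ 2 := by
  have hsum : eval y (∑ k, X k) = 1 := by simpa using hy.2
  rw [veroneseForm, map_add, map_mul, map_pow, hsum, one_pow, one_mul] at h0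
  simp only [map_sum, map_pow, map_add] at h0
  have hzero : ∀ f : Fin n → ℝ, (∀ i, 0 ≤ f i) → ∑ i, f i = 0 → ∀ i, f i = 0 :=
    fun f hf hsum i => (Finset.sum_eq_zero_iff_of_nonneg fun i _ => hf i).mp hsum i
      (Finset.mem_univ i)
  obtain ⟨hminor, hlin⟩ := (add_eq_zero_iff_of_nonneg
    (Finset.sum_nonneg fun _ _ => Finset.sum_nonneg fun _ _ => Finset.sum_nonneg fun _ _ =>
      Finset.sum_nonneg fun _ _ => sq_nonneg _)
    (Finset.sum_nonneg fun _ _ => Finset.sum_nonneg fun _ _ =>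
      add_nonneg (sq_nonneg _) (sq_nonneg _))).mp h0
  let E : Fin n → Fin n → ℝ := fun i j => y (i, j, true) - y (i, j, false)
  have hE : ∀ i j k l, E i j * E k l = E i k * E j l := by
    intro i j k l
    have h1 := hzero _ (fun _ => Finset.sum_nonneg fun _ _ => Finset.sum_nonneg fun _ _ =>
      Finset.sum_nonneg fun _ _ => sq_nonneg _) hminor i
    have h2 := hzero _ (fun _ => Finset.sum_nonneg fun _ _ => Finset.sum_nonneg fun _ _ =>
      sq_nonneg _) h1 j
    have h3 := hzero _ (fun _ => Finset.sum_nonneg fun _ _ => sq_nonneg _) h2 k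
    have h4 := hzero _ (fun _ => sq_nonneg _) h3 l
    simpa [pairDiff, E, sub_eq_zero] using h4
  have hlin' : ∀ i j, 4 * y (i, j, true) = E i i + E j j + 2 * E i j ∧
      4 * y (i, j, false) = E i i + E j j - 2 * E i j := by
    intro i j
    have h1 := hzero _ (fun _ => Finset.sum_nonneg fun _ _ =>
      add_nonneg (sq_nonneg _) (sq_nonneg _)) hlin i
    have h2 := hzero _ (fun _ => add_nonneg (sq_nonneg _) (sq_nonneg _)) h1 j
    rw [add_eq_zero_iff_of_nonneg (sq_nonneg _) (sq_nonneg _), sq_eq_zero_iff,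
      sq_eq_zero_iff] at h2
    simp only [pairDiff, map_sub, map_mul, eval_C, eval_X] at h2
    constructor <;> simp only [E] <;> linarith
  have hEnonneg : ∀ i, 0 ≤ E i i := fun i => by
    have := hy.1 (i, i, true)
    have := (hlin' i i).1
    linarith
  obtain ⟨k, hk⟩ : ∃ k, E k k ≠ 0 := by
    by_contra! hall
    have hE0 : ∀ i j, E i j = 0 := fun i j => by
      have := hE i j i j
      rw [hall, zero_mul] at this
      exact mul_self_eq_zero.mp this
    have hy0 : ∀ k, y k = 0 := by
      rintro ⟨i, j, _ | _⟩
      · have := (hlin' i j).2; rw [hE0, hE0, hE0] at this; linarith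
      · have := (hlin' i j).1; rw [hE0, hE0, hE0] at this; linarith
    have := hy.2
    simp [hy0] at this
  have hkpos : 0 < E k k := (hEnonneg k).lt_of_ne' hk
  let p : Fin n → ℝ := fun i => E k i / √(E k k) / 2
  have hp : ∀ i j, 4 * (p i * p j) = E i j := by
    intro i j
    have hsq : √(E k k) * √(E k k) = E k k := Real.mul_self_sqrt hkpos.le
    have hne : √(E k k) ≠ 0 := (Real.sqrt_pos.mpr hkpos).ne'
    have : 4 * (p i * p j) = E k i * E k j / (√(E k k) * √(E k k)) := by
      simp only [p]; field_simp; ring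
    rw [this, hsq, hE k i k j, mul_div_assoc, mul_comm, div_mul_cancel₀ _ hk]
  refine ⟨p, fun h => hk ?_, ?_⟩
  · rw [← hp k k, h]; simp
  · funext ⟨i, j, b⟩
    have hij := hlin' i j
    rw [← hp i i, ← hp j j, ← hp i j] at hij
    cases b
    · simp only [pairForm, map_sub, eval_X]; linarith
    · simp only [pairForm, map_add, eval_X]; linarith

end Lift

section Main

variable {n : ℕ}

/-- A positive definite matrix of forms of a common even degree becomes a sum of squares after
multiplication by a power of a fixed sum of squares. -/
theorem exists_isGram_pow_smul_of_isHomogeneous {ι : Type*} [Fintype ι] [DecidableEq ι] {a : ℕ}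
    (M : Matrix ι ι (MvPolynomial (Fin n) ℝ)) (hsymm : M.IsSymm)
    (hM : ∀ i j, (M i j).IsHomogeneous (2 * a))
    (hpos : ∀ p : Fin n → ℝ, p ≠ 0 → ∀ v : ι → ℝ, v ≠ 0 → 0 < v ⬝ᵥ M.map (eval p) *ᵥ v) :
    ∃ N : ℕ, IsGram ((∑ k, pairForm (n := n) k ^ 2) ^ N • M) := by
  choose G hG hGM using fun i j => (hM i j).exists_aeval_pairForm_sq
  have heval : ∀ p i j, eval (fun k => eval p (pairForm k) ^ 2) (G i j) = eval p (M i j) := by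
    intro p i j
    have hid : (eval p).comp (algebraMap ℝ (MvPolynomial (Fin n) ℝ)) = RingHom.id ℝ := by
      ext; simp
    rw [← hGM i j, map_aeval, hid]
    simp only [map_pow]
    rfl
  let B : Matrix ι ι (MvPolynomial (Fin n × Fin n × Bool) ℝ) := Matrix.of G
  have hcont : ∀ i j, Continuous fun q : (Fin n × Fin n × Bool → ℝ) × (ι → ℝ) =>
      eval q.1 (G i j) := fun i j => (MvPolynomial.continuous_eval (G i j)).comp continuous_fst
  have hcontV : Continuous fun q : (Fin n × Fin n × Bool → ℝ) × (ι → ℝ) =>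
      eval q.1 (veroneseForm n) :=
    (MvPolynomial.continuous_eval (veroneseForm n)).comp continuous_fst
  have hself : ∀ v : ι → ℝ, 0 ≤ v ⬝ᵥ v := fun v =>
    Finset.sum_nonneg fun i _ => mul_self_nonneg (v i)
  obtain ⟨c, hc⟩ := ((isCompact_stdSimplex ℝ (Fin n × Fin n × Bool)).prod
    (isCompact_sphere (0 : ι → ℝ) 1)).exists_add_mul_pos
    (f := fun q => q.2 ⬝ᵥ B.map (eval q.1) *ᵥ q.2)
    (g := fun q => eval q.1 (veroneseForm n) * (q.2 ⬝ᵥ q.2))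
    (by simp only [dotProduct, mulVec, B, Matrix.map_apply, Matrix.of_apply]; fun_prop)
    (by simp only [dotProduct]; fun_prop)
    (fun q _ => mul_nonneg (eval_veroneseForm_nonneg _) (hself _))
    (by
      rintro ⟨y, v⟩ ⟨hy, hv⟩ h0
      have hv0 : v ≠ 0 := fun h => by simp [h] at hv
      obtain ⟨p, hp, rfl⟩ := exists_eq_pairForm_sq hy
        ((mul_eq_zero.mp h0).resolve_right (dotProduct_self_eq_zero.not.mpr hv0))
      have hB : B.map (eval fun k => eval p (pairForm k) ^ 2) = M.map (eval p) := by
        ext i j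
        exact heval p i j
      dsimp only
      rw [hB]
      exact hpos p hp v hv0)
  let s : MvPolynomial (Fin n × Fin n × Bool) ℝ := ∑ k, X k
  let F : Matrix ι ι (MvPolynomial (Fin n × Fin n × Bool) ℝ) :=
    s ^ 4 • B + (C c * s ^ a * veroneseForm n) • (1 : Matrix ι ι _)
  have hs : s.IsHomogeneous 1 := .sum _ _ _ fun k _ => isHomogeneous_X ℝ k
  have hF : ∀ i j, (F i j).IsHomogeneous (4 + a) := by
    intro i j
    have h1 : (s ^ 4 * G i j).IsHomogeneous (4 + a) := by simpa using (hs.pow 4).mul (hG i j)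
    have h2 : (C c * s ^ a * veroneseForm n).IsHomogeneous (4 + a) := by
      simpa [add_comm] using ((hs.pow a).C_mul c).mul veroneseForm_isHomogeneous
    simp only [F, Matrix.add_apply, Matrix.smul_apply, smul_eq_mul, Matrix.one_apply, mul_ite,
      mul_one, mul_zero]
    split_ifs
    · exact h1.add h2
    · simpa [B] using h1
  have hFpos : ∀ y ∈ stdSimplex ℝ (Fin n × Fin n × Bool), ∀ v : ι → ℝ, v ≠ 0 →
      0 < v ⬝ᵥ F.map (eval y) *ᵥ v := by
    intro y hy v hv
    obtain ⟨t, ht, x, hx, rfl⟩ := exists_smul_mem_sphere hv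
    rw [smul_dotProduct_mulVec_smul]
    have hs1 : eval y s = 1 := by simpa [s] using hy.2
    have hFy : F.map (eval y) =
        B.map (eval y) + (c * eval y (veroneseForm n)) • (1 : Matrix ι ι ℝ) := by
      ext i j
      rcases eq_or_ne i j with rfl | hij
      · simp [F, hs1]
      · simp [F, hs1, hij]
    rw [hFy, add_mulVec, dotProduct_add, smul_mulVec, one_mulVec, dotProduct_smul, smul_eq_mul,
      mul_assoc]
    exact mul_pos (by positivity) (hc (y, x) ⟨hy, hx⟩)
  obtain ⟨N, hN⟩ := exists_isGram_sum_sq_pow_smul F hF hFpos (pairForm (n := n))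
  refine ⟨N + 4, ?_⟩
  have hFz : (F + Fᵀ).map (aeval fun k => pairForm k ^ 2) =
      (C 2 * (∑ k, pairForm (n := n) k ^ 2) ^ 4) • M := by
    have h2 : (C 2 : MvPolynomial (Fin n) ℝ) = 2 := map_ofNat C 2
    ext1 i j
    simp only [F, B, s, Matrix.map_apply, Matrix.add_apply, Matrix.transpose_apply,
      Matrix.smul_apply, Matrix.of_apply, smul_eq_mul, map_add, map_mul, map_pow, map_sum,
      aeval_X, aeval_veroneseForm, hGM, hsymm.apply i j, h2]
    ring
  have := hN.sq_smul (C √(1 / 2))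
  rw [hFz, smul_smul, smul_smul, ← map_pow, Real.sq_sqrt (by norm_num)] at this
  convert this using 2
  have hC : (C (1 / 2) * C 2 : MvPolynomial (Fin n) ℝ) = 1 := by
    rw [← map_mul]; norm_num
  linear_combination (-(∑ k, pairForm (n := n) k ^ 2) ^ (N + 4)) * hC

theorem IsSumSq.isSOS {q : MvPolynomial (Fin n) ℝ} (h : IsSumSq q) : IsSOS q := by
  induction h with
  | zero => exact ⟨0, 0, by simp⟩
  | sq_add a _ ih =>
    obtain ⟨s, g, rfl⟩ := ih
    exact ⟨s + 1, Fin.cons a g, by simp [Fin.sum_univ_succ, sq]⟩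

theorem Fintype.sum_prod_words_sq {S : Type*} [CommSemiring S] {K : Type*} [Fintype K]
    (f : K → S) (d : ℕ) : ∑ u : Fin d → K, (∏ l, f (u l)) ^ 2 = (∑ k, f k ^ 2) ^ d := by
  rw [Finset.sum_pow', Fintype.piFinset_univ]
  simp only [Finset.prod_pow]

theorem eval_sum_X_sq_pos {p : Fin n → ℝ} (hp : p ≠ 0) :
    0 < eval p (∑ i, (X i : MvPolynomial (Fin n) ℝ) ^ 2) := by
  obtain ⟨i, hi⟩ := Function.ne_iff.mp hp
  simp only [map_sum, map_pow, eval_X]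
  exact Finset.sum_pos' (fun _ _ => sq_nonneg _) ⟨i, Finset.mem_univ i, sq_pos_of_ne_zero hi⟩

theorem eval_sum_pairForm_sq_pos {p : Fin n → ℝ} (hp : p ≠ 0) :
    0 < eval p (∑ k, pairForm (n := n) k ^ 2) := by
  obtain ⟨i, hi⟩ := Function.ne_iff.mp hp
  simp only [map_sum, map_pow]
  refine Finset.sum_pos' (fun _ _ => sq_nonneg _) ⟨(i, i, true), Finset.mem_univ _, ?_⟩
  simp only [pairForm, map_add, eval_X]
  exact sq_pos_of_ne_zero (by simpa using hi)

variable {m : ℕ}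

/-- Pairs of an index `i` and a word of length `e i` in the variables. -/
abbrev WordIndex (n : ℕ) (e : Fin m → ℕ) : Type := Σ i : Fin m, (Fin (e i) → Fin n)

/-- The matrix whose row at `(i, u)` has the monomial of the word `u` in column `i`. -/
noncomputable def monomialMatrix (n : ℕ) (e : Fin m → ℕ) :
    Matrix (WordIndex n e) (Fin m) (MvPolynomial (Fin n) ℝ) :=
  Matrix.of fun x i => if x.1 = i then ∏ l, X (x.2 l) else 0

theorem monomialMatrix_mul_mul_transpose_apply (e : Fin m → ℕ)
    (A : Matrix (Fin m) (Fin m) (MvPolynomial (Fin n) ℝ)) (x y : WordIndex n e) :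
    (monomialMatrix n e * A * (monomialMatrix n e)ᵀ) x y =
      (∏ l, X (x.2 l)) * A x.1 y.1 * ∏ l, X (y.2 l) := by
  simp [monomialMatrix, Matrix.mul_apply]

theorem monomialMatrix_transpose_mul_self (e : Fin m → ℕ) :
    (monomialMatrix n e)ᵀ * monomialMatrix n e =
      diagonal fun i => (∑ k, (X k : MvPolynomial (Fin n) ℝ) ^ 2) ^ e i := by
  ext1 i j
  rw [Matrix.mul_apply, Fintype.sum_sigma, diagonal_apply]
  simp only [monomialMatrix, transpose_apply, Matrix.of_apply, ite_mul, zero_mul, mul_ite,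
    mul_zero]
  rw [Finset.sum_eq_single i (fun k _ hk => by simp [hk]) (by simp)]
  rcases eq_or_ne i j with rfl | hij
  · simp only [if_true, ← sq]
    exact Fintype.sum_prod_words_sq _ _
  · simp [hij]

/-- The Cauchy-Schwarz inequality for the rows of `monomialMatrix`. -/
theorem sum_mul_sq_monomialMatrix_le {α e : Fin m → ℕ} {a : ℕ} (hα : ∀ i, α i + e i = a)
    (p : Fin n → ℝ) (w : WordIndex n e → ℝ) :
    ∑ i, (∑ k, p k ^ 2) ^ α i * (∑ u, (∏ l, p (u l)) * w ⟨i, u⟩) ^ 2 ≤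
      (∑ k, p k ^ 2) ^ a * (w ⬝ᵥ w) := by
  have hr : 0 ≤ ∑ k, p k ^ 2 := Finset.sum_nonneg fun _ _ => sq_nonneg _
  rw [dotProduct, Fintype.sum_sigma, Finset.mul_sum]
  refine Finset.sum_le_sum fun i _ => ?_
  calc (∑ k, p k ^ 2) ^ α i * (∑ u, (∏ l, p (u l)) * w ⟨i, u⟩) ^ 2
      ≤ (∑ k, p k ^ 2) ^ α i *
          ((∑ u : Fin (e i) → Fin n, (∏ l, p (u l)) ^ 2) * ∑ u, w ⟨i, u⟩ ^ 2) := by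
        gcongr
        exact Finset.sum_mul_sq_le_sq_mul_sq _ _ _
    _ = _ := by
        rw [Fintype.sum_prod_words_sq, ← mul_assoc, ← pow_add, hα]
        simp only [sq]

end Main

/-- **Lemma (positive definite homogeneous matrices have SOS multiples).**
Let `Λ` be a symmetric `m×m` matrix over `R = ℝ[x₁,…,xₙ]` whose `(i,j)` entry is
homogeneous of degree `αᵢ + αⱼ` and such that `Λ(p)` is positive definite for all
`0 ≠ p ∈ ℝⁿ`. Then there is a homogeneous sum of squares `q ∈ R` with `q(p) > 0` for all
`0 ≠ p ∈ ℝⁿ` such that `q·Λ = B·Bᵀ` for some matrix `B` over `R`. -/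
theorem statement6 {n m : ℕ} (hm : 1 ≤ m) (α : Fin m → ℕ)
    (Λ : Matrix (Fin m) (Fin m) (MvPolynomial (Fin n) ℝ)) (hsymm : Λ.IsSymm)
    (hhom : ∀ i j, (Λ i j).IsHomogeneous (α i + α j))
    (hpd : ∀ p : Fin n → ℝ, p ≠ 0 → (Λ.map (eval p)).PosDef) :
    ∃ (q : MvPolynomial (Fin n) ℝ) (dq : ℕ), q.IsHomogeneous dq ∧ IsSOS q ∧
      (∀ p : Fin n → ℝ, p ≠ 0 → 0 < eval p q) ∧
      ∃ (s : ℕ) (B : Matrix (Fin m) (Fin s) (MvPolynomial (Fin n) ℝ)),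
        q • Λ = B * B.transpose := by
  classical
  obtain ⟨a, e, he⟩ : ∃ (a : ℕ) (e : Fin m → ℕ), ∀ i, α i + e i = a :=
    ⟨∑ i, α i, fun i => ∑ j, α j - α i, fun i =>
      Nat.add_sub_of_le (Finset.single_le_sum (fun _ _ => Nat.zero_le _) (Finset.mem_univ i))⟩
  let r : MvPolynomial (Fin n) ℝ := ∑ k, X k ^ 2
  have hr : r.IsHomogeneous 2 := .sum _ _ _ fun k _ => isHomogeneous_X_pow k 2
  let D : Matrix (Fin m) (Fin m) (MvPolynomial (Fin n) ℝ) := diagonal fun i => r ^ α i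
  let P := monomialMatrix n e
  let M := P * (Λ - D) * Pᵀ + r ^ a • (1 : Matrix (WordIndex n e) (WordIndex n e) _)
  have hDT : Dᵀ = D := diagonal_transpose _
  have hD : ∀ i j, (D i j).IsHomogeneous (α i + α j) := by
    intro i j
    rcases eq_or_ne i j with rfl | hij
    · simpa [D, two_mul] using hr.pow (α i)
    · simpa [D, hij] using isHomogeneous_zero (Fin n) ℝ (α i + α j)
  have hMsymm : M.IsSymm := by
    simp only [M, IsSymm, transpose_add, transpose_mul, transpose_transpose, transpose_sub,
      hsymm.eq, hDT, transpose_smul, transpose_one, Matrix.mul_assoc]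
  have hMhom : ∀ x y, (M x y).IsHomogeneous (2 * a) := by
    intro x y
    have hword : ∀ x : WordIndex n e,
        (∏ l, X (x.2 l) : MvPolynomial (Fin n) ℝ).IsHomogeneous (e x.1) := fun x => by
      simpa using IsHomogeneous.prod Finset.univ
        (fun l => (X (x.2 l) : MvPolynomial (Fin n) ℝ)) (fun _ => 1) fun l _ => isHomogeneous_X ℝ _
    refine .add ?_ ?_
    · rw [monomialMatrix_mul_mul_transpose_apply]
      have hdeg : 2 * a = e x.1 + (α x.1 + α y.1) + e y.1 := by
        have hx := he x.1
        have hy := he y.1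
        omega
      rw [hdeg]
      exact ((hword x).mul ((hhom x.1 y.1).sub (hD x.1 y.1))).mul (hword y)
    · rcases eq_or_ne x y with rfl | hxy
      · simpa using hr.pow a
      · simpa [hxy] using isHomogeneous_zero (Fin n) ℝ (2 * a)
  have hMpos : ∀ p : Fin n → ℝ, p ≠ 0 → ∀ w : WordIndex n e → ℝ, w ≠ 0 →
      0 < w ⬝ᵥ M.map (eval p) *ᵥ w := by
    intro p hp w hw
    let v : Fin m → ℝ := fun i => ∑ u, (∏ l, p (u l)) * w ⟨i, u⟩
    have hv : w ᵥ* P.map (eval p) = v := by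
      funext i
      simp only [vecMul, dotProduct, v, Fintype.sum_sigma]
      rw [Finset.sum_eq_single i (fun k _ hk => by simp [P, monomialMatrix, hk]) (by simp)]
      simp [P, monomialMatrix, mul_comm]
    have hMp : M.map (eval p) = P.map (eval p) * (Λ.map (eval p) - D.map (eval p)) *
        (P.map (eval p))ᵀ + (∑ k, p k ^ 2) ^ a • (1 : Matrix (WordIndex n e) _ ℝ) := by
      rw [← Matrix.map_sub _ (map_sub _), ← transpose_map, ← Matrix.map_mul, ← Matrix.map_mul]
      ext x y
      rcases eq_or_ne x y with rfl | hxy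
      · simp [M, r, -Matrix.map_mul]
      · simp [M, hxy, -Matrix.map_mul]
    have hDp : v ⬝ᵥ D.map (eval p) *ᵥ v = ∑ i, (∑ k, p k ^ 2) ^ α i * v i ^ 2 := by
      rw [show D.map (eval p) = diagonal fun i => (∑ k, p k ^ 2) ^ α i by
        simp only [D, r]; rw [diagonal_map (map_zero _)]; simp]
      simp only [dotProduct, mulVec_diagonal]
      exact Finset.sum_congr rfl fun i _ => by ring
    have hquad : w ⬝ᵥ M.map (eval p) *ᵥ w = v ⬝ᵥ Λ.map (eval p) *ᵥ v +
        ((∑ k, p k ^ 2) ^ a * (w ⬝ᵥ w) - ∑ i, (∑ k, p k ^ 2) ^ α i * v i ^ 2) := by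
      rw [hMp, add_mulVec, dotProduct_add, ← mulVec_mulVec, ← mulVec_mulVec, mulVec_transpose,
        dotProduct_mulVec, hv, sub_mulVec, dotProduct_sub, hDp, smul_mulVec, one_mulVec,
        dotProduct_smul, smul_eq_mul]
      ring
    rw [hquad]
    have hcs := sum_mul_sq_monomialMatrix_le he p w
    rcases eq_or_ne v 0 with hv0 | hv0
    · have hw0 : 0 < w ⬝ᵥ w := by simpa using dotProduct_star_self_pos_iff.mpr hw
      have hr0 : 0 < ∑ k, p k ^ 2 := by simpa using eval_sum_X_sq_pos hp
      simpa [hv0] using mul_pos (pow_pos hr0 a) hw0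
    · have := (hpd p hp).dotProduct_mulVec_pos hv0
      rw [star_trivial] at this
      linarith
  obtain ⟨N, hN⟩ := exists_isGram_pow_smul_of_isHomogeneous M hMsymm hMhom hMpos
  have hPP : Pᵀ * P = diagonal fun i => r ^ e i := monomialMatrix_transpose_mul_self e
  have hDPP : D * (Pᵀ * P) = r ^ a • (1 : Matrix (Fin m) (Fin m) _) := by
    rw [hPP, diagonal_mul_diagonal, smul_one_eq_diagonal]
    simp only [← pow_add, he]
  have hPPD : Pᵀ * P * D = r ^ a • (1 : Matrix (Fin m) (Fin m) _) := by
    rw [hPP, diagonal_mul_diagonal, smul_one_eq_diagonal]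
    simp only [← pow_add, add_comm (e _), he]
  have hconj : D * Pᵀ * M * (D * Pᵀ)ᵀ = r ^ (2 * a) • Λ := by
    have h1 : D * Pᵀ * M * (D * Pᵀ)ᵀ =
        D * (Pᵀ * P) * (Λ - D) * (Pᵀ * P * D) + r ^ a • (D * (Pᵀ * P) * D) := by
      simp only [M, transpose_mul, transpose_transpose, hDT, Matrix.mul_add, Matrix.add_mul,
        Matrix.mul_assoc, Matrix.mul_smul, Matrix.smul_mul, Matrix.one_mul]
    rw [h1, hDPP, hPPD]
    simp only [Matrix.smul_mul, Matrix.mul_smul, Matrix.one_mul, Matrix.mul_one, smul_smul,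
      ← pow_add, ← two_mul, ← smul_add, sub_add_cancel]
  let Q : MvPolynomial (Fin n) ℝ := ∑ k, pairForm k ^ 2
  have hQ : Q.IsHomogeneous 2 := .sum _ _ _ fun k _ => (pairForm_isHomogeneous k).pow 2
  have hpow : ∀ {f : MvPolynomial (Fin n) ℝ}, IsSumSq f → ∀ l : ℕ, IsSumSq (f ^ l) :=
    fun hf l => by simpa using IsSumSq.prod (I := Finset.range l) fun _ _ => hf
  refine ⟨Q ^ N * r ^ (2 * a), _, (hQ.pow N).mul (hr.pow (2 * a)),
    (IsSumSq.mul (hpow (IsSumSq.sum_sq _ _) N) (hpow (IsSumSq.sum_sq _ _) (2 * a))).isSOS,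
    fun p hp => ?_, ?_⟩
  · rw [map_mul, map_pow, map_pow]
    exact mul_pos (pow_pos (eval_sum_pairForm_sq_pos hp) N)
      (pow_pos (eval_sum_X_sq_pos hp) (2 * a))
  · have hgram := hN.conj (D * Pᵀ)
    rwa [Matrix.mul_smul, Matrix.smul_mul, hconj, smul_smul] at hgram
end

section
/- Let h ∈ ℝ[x₀,…,xₙ] be homogeneous of degree d ≥ 1 with h(1,0,…,0) ≠ 0. Let R = ℝ[x₁,…,xₙ], let M = ℝ[x₀,…,xₙ]/(h) regarded as an R-module (it is free of rank d), let 𝔪 = (x₁,…,xₙ) be the irrelevant maximal ideal of R, and for k ∈ ℕ let M_{≥k} ⊆ M be the R-submodule generated by the residue classes of all homogeneous polynomials of degree ≥ k. Then the R-linear map ⋀²M_{≥k} → ⋀²M between second exterior powers (over R) induced by the inclusion M_{≥k} ↪ M is injective on the submodule 𝔪·(⋀²M_{≥k}). -/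
set_option synthInstance.maxHeartbeats 1000000
set_option maxHeartbeats 1000000

open MvPolynomial

/-- `M = ℝ[x₀,…,xₙ]/(h)` is an algebra (in particular a module) over `R = ℝ[x₁,…,xₙ]`
via `xⱼ ↦ xⱼ` (indices shifted by one). -/
noncomputable instance quotAlgebra (n : ℕ) (h : MvPolynomial (Fin (n + 1)) ℝ) :
    Algebra (MvPolynomial (Fin n) ℝ) (MvPolynomial (Fin (n + 1)) ℝ ⧸ Ideal.span {h}) :=
  ((Ideal.Quotient.mk (Ideal.span {h})).comp
    (rename Fin.succ :
      MvPolynomial (Fin n) ℝ →ₐ[ℝ] MvPolynomial (Fin (n + 1)) ℝ).toRingHom).toAlgebra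

/-- `M_{≥k}`: the `R`-submodule of `M = ℝ[x₀,…,xₙ]/(h)` generated by the residue classes
of all homogeneous polynomials of degree `≥ k`. -/
noncomputable def Mgeq (n : ℕ) (h : MvPolynomial (Fin (n + 1)) ℝ) (k : ℕ) :
    Submodule (MvPolynomial (Fin n) ℝ) (MvPolynomial (Fin (n + 1)) ℝ ⧸ Ideal.span {h}) :=
  Submodule.span _ {x | ∃ (f : MvPolynomial (Fin (n + 1)) ℝ) (df : ℕ),
    k ≤ df ∧ f.IsHomogeneous df ∧ Ideal.Quotient.mk (Ideal.span {h}) f = x}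

/-- A function of two exponents that is invariant under shifting monomials from one argument to
the other, as long as the degrees stay at least `a` and `b`, depends only on the sum of its
arguments in total degree greater than `a + b`. -/
theorem eq_of_add_eq_of_shift {σ A : Type*} {a b : ℕ}
    {F : (σ →₀ ℕ) → (σ →₀ ℕ) → A}
    (hF : ∀ α β δ, a ≤ Finsupp.degree α → b ≤ Finsupp.degree β → F (α + δ) β = F α (β + δ))
    {α β α' β' : σ →₀ ℕ} (hα : a ≤ α.degree) (hβ : b ≤ β.degree)
    (hα' : a ≤ α'.degree) (hβ' : b ≤ β'.degree)
    (hlt : a + b < α.degree + β.degree) (hsum : α + β = α' + β') : F α β = F α' β' := by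
  have key : ∀ (m : ℕ) (δ δ' μ ν : σ →₀ ℕ), δ.degree = m →
      a ≤ (μ + δ).degree → b ≤ (ν + δ').degree → a ≤ (μ + δ').degree → b ≤ (ν + δ).degree →
      a + b < (μ + δ).degree + (ν + δ').degree →
      F (μ + δ) (ν + δ') = F (μ + δ') (ν + δ) := by
    intro m
    induction m with
    | zero =>
      intro δ δ' μ ν hm h1 h2 h3 h4 h5
      obtain rfl := (Finsupp.degree_eq_zero_iff δ).1 hm
      simp only [add_zero] at *
      exact (hF μ ν δ' h1 h4).symm
    | succ m ih =>
      intro δ δ' μ ν hm h1 h2 h3 h4 h5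
      by_cases hδ' : δ' = 0
      · subst hδ'
        simp only [add_zero] at *
        exact hF μ ν δ h3 h2
      have hδ : δ ≠ 0 := by
        rintro rfl
        simp at hm
      obtain ⟨l, hl⟩ := Finsupp.ne_iff.1 hδ
      obtain ⟨l', hl'⟩ := Finsupp.ne_iff.1 hδ'
      obtain ⟨η, rfl⟩ : ∃ η, δ = η + Finsupp.single l 1 :=
        ⟨δ - Finsupp.single l 1, (tsub_add_cancel_of_le (by
          simpa [Finsupp.single_le_iff] using Nat.one_le_iff_ne_zero.2 hl)).symm⟩
      obtain ⟨η', rfl⟩ : ∃ η', δ' = η' + Finsupp.single l' 1 :=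
        ⟨δ' - Finsupp.single l' 1, (tsub_add_cancel_of_le (by
          simpa [Finsupp.single_le_iff] using Nat.one_le_iff_ne_zero.2 hl')).symm⟩
      have step : F (μ + (η + Finsupp.single l 1)) (ν + (η' + Finsupp.single l' 1)) =
          F (μ + Finsupp.single l' 1 + η) (ν + Finsupp.single l 1 + η') := by
        simp only [map_add, Finsupp.degree_single] at *
        by_cases hgt : a ≤ μ.degree + η.degree
        · have e1 := hF (μ + η) (ν + η' + Finsupp.single l' 1) (Finsupp.single l 1)
            (by simpa using hgt) (by simp; omega)
          have e2 := hF (μ + η) (ν + η' + Finsupp.single l 1) (Finsupp.single l' 1)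
            (by simpa using hgt) (by simp; omega)
          convert e1.trans ((congrArg _ (add_right_comm _ _ _)).trans e2.symm) using 1 <;>
            congr 1 <;> abel
        · have e1 := hF (μ + η + Finsupp.single l 1) (ν + η') (Finsupp.single l' 1)
            (by simp; omega) (by simp; omega)
          have e2 := hF (μ + η + Finsupp.single l' 1) (ν + η') (Finsupp.single l 1)
            (by simp; omega) (by simp; omega)
          convert e1.symm.trans ((congrArg (F · _) (add_right_comm _ _ _)).trans e2) using 1 <;>
            congr 1 <;> abel
      rw [step, ih η η' (μ + Finsupp.single l' 1) (ν + Finsupp.single l 1)]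
      · congr 1 <;> abel
      all_goals simp only [map_add, Finsupp.degree_single] at *; omega
  have h1 : α ⊓ α' + (α - α') = α := by
    ext x
    simp only [Finsupp.coe_add, Pi.add_apply, Finsupp.inf_apply, Finsupp.coe_tsub, Pi.sub_apply]
    omega
  have h2 : α ⊓ α' + (α' - α) = α' := by
    ext x
    simp only [Finsupp.coe_add, Pi.add_apply, Finsupp.inf_apply, Finsupp.coe_tsub, Pi.sub_apply]
    omega
  have h3 : β ⊓ β' + (α' - α) = β := by
    ext x
    have := DFunLike.congr_fun hsum x
    simp only [Finsupp.coe_add, Pi.add_apply, Finsupp.inf_apply, Finsupp.coe_tsub,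
      Pi.sub_apply] at *
    omega
  have h4 : β ⊓ β' + (α - α') = β' := by
    ext x
    have := DFunLike.congr_fun hsum x
    simp only [Finsupp.coe_add, Pi.add_apply, Finsupp.inf_apply, Finsupp.coe_tsub,
      Pi.sub_apply] at *
    omega
  have := key _ (α - α') (α' - α) (α ⊓ α') (β ⊓ β') rfl
  rw [h1, h2, h3, h4] at this
  exact this hα hβ hα' hβ' hlt

/-- The `R`-linear functional `x ∧ y ↦ f x * g y - f y * g x`, zero outside degree two. -/
noncomputable def wedgeFunctional {R M : Type*} [CommRing R] [AddCommGroup M] [Module R M]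
    (f g : M →ₗ[R] R) : ExteriorAlgebra R M →ₗ[R] R :=
  ExteriorAlgebra.liftAlternating
    (Pi.single 2 ((Matrix.detRowAlternating (R := R) (n := Fin 2)).compLinearMap
      (LinearMap.pi ![f, g])))

theorem wedgeFunctional_ι_mul_ι {R M : Type*} [CommRing R] [AddCommGroup M] [Module R M]
    (f g : M →ₗ[R] R) (x y : M) :
    wedgeFunctional f g (ExteriorAlgebra.ι R x * ExteriorAlgebra.ι R y) = f x * g y - f y * g x := by
  have : ExteriorAlgebra.ι R x * ExteriorAlgebra.ι R y = ExteriorAlgebra.ιMulti R 2 ![x, y] := by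
    simp [ExteriorAlgebra.ιMulti_apply]
  rw [this, wedgeFunctional, ExteriorAlgebra.liftAlternating_apply_ιMulti]
  refine (Matrix.det_fin_two _).trans ?_
  simp [mul_comm]

/-- Additive maps out of a polynomial ring prescribed on monomials. -/
noncomputable def monomialLift {σ K A : Type*} [CommRing K] [AddCommGroup A]
    [Module (MvPolynomial σ K) A] (E : (σ →₀ ℕ) → A) : MvPolynomial σ K →+ A where
  toFun p := p.support.sum fun γ => (C (p.coeff γ) : MvPolynomial σ K) • E γ
  map_zero' := by simp
  map_add' p q := by
    classical
    have key : ∀ (r : MvPolynomial σ K), r.support ⊆ p.support ∪ q.support →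
      r.support.sum (fun γ => (C (r.coeff γ) : MvPolynomial σ K) • E γ) =
        (p.support ∪ q.support).sum fun γ => (C (r.coeff γ) : MvPolynomial σ K) • E γ := by
      intro r hr
      refine Finset.sum_subset hr fun γ _ h => ?_
      simp [notMem_support_iff.1 h]
    rw [key _ support_add, key p Finset.subset_union_left, key q Finset.subset_union_right,
      ← Finset.sum_add_distrib]
    simp [add_smul]

theorem monomialLift_monomial {σ K A : Type*} [CommRing K] [AddCommGroup A]
    [Module (MvPolynomial σ K) A] (E : (σ →₀ ℕ) → A) (γ : σ →₀ ℕ) (c : K) :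
    monomialLift E (monomial γ c) = (C c : MvPolynomial σ K) • E γ := by
  classical
  change (monomial γ c).support.sum
    (fun δ => (C ((monomial γ c).coeff δ) : MvPolynomial σ K) • E δ) = _
  rw [Finset.sum_subset support_monomial_subset, Finset.sum_singleton, coeff_monomial, if_pos rfl]
  intro δ _ h
  simp [notMem_support_iff.1 h]

open scoped Pointwise in
/-- If `M` has a family `e` with a dual family `π` and `N` is spanned by the `x ^ α • e i` with
`|α| ≥ a i`, then `⋀²N → ⋀²M` is injective on `𝔪 • ⋀²N`. -/
theorem injOn_exteriorAlgebra_map_smul {σ K ι M : Type*} [CommRing K] [Invertible (2 : K)]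
    [Fintype ι] [LinearOrder ι] [AddCommGroup M] [Module (MvPolynomial σ K) M]
    (e : ι → M) (π : ι → M →ₗ[MvPolynomial σ K] MvPolynomial σ K)
    (hπ : ∀ i j, π i (e j) = if i = j then 1 else 0) (a : ι → ℕ)
    (N : Submodule (MvPolynomial σ K) M)
    (hN : N = Submodule.span (MvPolynomial σ K)
      {x | ∃ i α, a i ≤ Finsupp.degree α ∧ (monomial α 1 : MvPolynomial σ K) • e i = x}) :
    Set.InjOn (ExteriorAlgebra.map N.subtype)
      ((Ideal.span (Set.range (X : σ → MvPolynomial σ K)) • (⋀[MvPolynomial σ K]^2 N) :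
        Submodule (MvPolynomial σ K) (ExteriorAlgebra (MvPolynomial σ K) N)) : Set _) := by
  classical
  have hmem : ∀ i α, a i ≤ Finsupp.degree α → (monomial α 1 : MvPolynomial σ K) • e i ∈ N := by
    intro i α h
    rw [hN]
    exact Submodule.subset_span ⟨i, α, h, rfl⟩
  let v : ι → (σ →₀ ℕ) → N := fun i α =>
    if h : a i ≤ Finsupp.degree α then ⟨_, hmem i α h⟩ else 0
  have hv : ∀ i α, a i ≤ Finsupp.degree α →
      (v i α : M) = (monomial α 1 : MvPolynomial σ K) • e i := by
    intro i α h
    simp only [v, dif_pos h]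
  have hvadd : ∀ i α δ, a i ≤ Finsupp.degree α →
      v i (α + δ) = (monomial δ 1 : MvPolynomial σ K) • v i α := by
    intro i α δ h
    apply Subtype.ext
    rw [Submodule.coe_smul, hv i α h, hv i (α + δ) (by rw [map_add]; omega), smul_smul,
      monomial_mul, one_mul, add_comm]
  let I := ExteriorAlgebra.ι (MvPolynomial σ K) (M := N)
  let S : Set N := {x | ∃ i α, a i ≤ Finsupp.degree α ∧ v i α = x}
  have hS : Submodule.span (MvPolynomial σ K) S = ⊤ := by
    apply Submodule.map_injective_of_injective N.injective_subtype
    rw [Submodule.map_span, Submodule.map_top, Submodule.range_subtype]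
    conv_rhs => rw [hN]
    congr 1
    ext x
    constructor
    · rintro ⟨_, ⟨i, α, h, rfl⟩, rfl⟩
      exact ⟨i, α, h, (hv i α h).symm⟩
    · rintro ⟨i, α, h, rfl⟩
      exact ⟨_, ⟨i, α, h, rfl⟩, hv i α h⟩
  have hspan : (⋀[MvPolynomial σ K]^2 N) =
      Submodule.span (MvPolynomial σ K) ((I '' S) * (I '' S)) := by
    change LinearMap.range I ^ 2 = _
    rw [pow_two, ← Submodule.map_top, ← hS, Submodule.map_span,
      Submodule.span_mul_span]
  let P : ι → ι → (σ →₀ ℕ) → (σ →₀ ℕ) → Prop := fun i j α β =>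
    a i ≤ Finsupp.degree α ∧ a j ≤ Finsupp.degree β ∧
      a i + a j < Finsupp.degree α + Finsupp.degree β
  have hsplit : ∀ i j α β α' β', P i j α β → P i j α' β' → α + β = α' + β' →
      I (v i α) * I (v j β) = I (v i α') * I (v j β') := by
    intro i j α β α' β' h h' hs
    refine eq_of_add_eq_of_shift (F := fun α β => I (v i α) * I (v j β)) ?_
      h.1 h.2.1 h'.1 h'.2.1 h.2.2 hs
    intro α β δ hα hβ
    simp only [hvadd i α δ hα, hvadd j β δ hβ, map_smul, smul_mul_assoc, mul_smul_comm]
  have hswap : ∀ x y : N, I x * I y = -(I y * I x) := fun x y =>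
    eq_neg_of_add_eq_zero_left (ExteriorAlgebra.ι_add_mul_swap x y)
  have hdiag : ∀ i α β, P i i α β → I (v i α) * I (v i β) = 0 := by
    intro i α β h
    have h1 := hsplit i i α β β α h ⟨h.2.1, h.1, by have := h.2.2; omega⟩ (add_comm _ _)
    have h2 := h1.trans (hswap _ _)
    have h3 : (2 : MvPolynomial σ K) • (I (v i α) * I (v i β)) = 0 := by
      rw [two_smul]
      nth_rewrite 1 [h2]
      simp
    have h4 : (C (⅟ 2 : K) : MvPolynomial σ K) * 2 = 1 := by
      rw [← map_ofNat C 2, ← C_mul, invOf_mul_self, C_1]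
    rw [← one_smul (MvPolynomial σ K) (I (v i α) * I (v i β)), ← h4, mul_smul, h3, smul_zero]
  let E : ι × ι → (σ →₀ ℕ) → ExteriorAlgebra (MvPolynomial σ K) N := fun p γ =>
    if h : ∃ q : (σ →₀ ℕ) × (σ →₀ ℕ), P p.1 p.2 q.1 q.2 ∧ q.1 + q.2 = γ then
      I (v p.1 h.choose.1) * I (v p.2 h.choose.2) else 0
  have hE : ∀ i j α β, P i j α β → E (i, j) (α + β) = I (v i α) * I (v j β) := by
    intro i j α β h
    have hex : ∃ q : (σ →₀ ℕ) × (σ →₀ ℕ), P i j q.1 q.2 ∧ q.1 + q.2 = α + β :=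
      ⟨(α, β), h, rfl⟩
    simp only [E, dif_pos hex]
    exact hsplit _ _ _ _ _ _ hex.choose_spec.1 h hex.choose_spec.2
  let ψ : ExteriorAlgebra (MvPolynomial σ K) M →+ ExteriorAlgebra (MvPolynomial σ K) N :=
    ∑ p ∈ Finset.univ.filter (fun p : ι × ι => p.1 < p.2),
      (monomialLift (E p)).comp (wedgeFunctional (π p.1) (π p.2)).toAddMonoidHom
  have hψlt : ∀ i j α β (c : K), i < j → P i j α β →
      ψ (ExteriorAlgebra.map N.subtype ((C c : MvPolynomial σ K) • (I (v i α) * I (v j β)))) =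
        (C c : MvPolynomial σ K) • (I (v i α) * I (v j β)) := by
    intro i j α β c hij h
    simp only [I, ψ, map_smul, map_mul, ExteriorAlgebra.map_apply_ι, Submodule.subtype_apply,
      hv i α h.1, hv j β h.2.1, AddMonoidHom.finsetSum_apply, AddMonoidHom.comp_apply,
      LinearMap.toAddMonoidHom_coe, smul_mul_smul_comm, wedgeFunctional_ι_mul_ι, hπ]
    rw [Finset.sum_eq_single (i, j)]
    · simp only [if_pos, if_neg hij.ne, if_neg hij.ne', smul_eq_mul, mul_one, mul_zero, sub_zero,
        monomial_mul, C_mul_monomial, monomialLift_monomial, hE i j α β h, I]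
    · rintro ⟨i', j'⟩ hlt hne
      have hlt' : i' < j' := by simpa using hlt
      have h1 : ¬ (i' = i ∧ j' = j) := fun h => hne (by rw [h.1, h.2])
      have h2 : ¬ (i' = j ∧ j' = i) := by
        rintro ⟨rfl, rfl⟩
        exact lt_asymm hij hlt'
      convert map_zero (monomialLift (E (i', j')))
      split_ifs <;>
        first
        | exact absurd ⟨‹_›, ‹_›⟩ h1
        | exact absurd ⟨‹_›, ‹_›⟩ h2
        | simp
    · simp [hij]
  have hψ : ∀ i j α β (c : K), P i j α β →
      ψ (ExteriorAlgebra.map N.subtype ((C c : MvPolynomial σ K) • (I (v i α) * I (v j β)))) =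
        (C c : MvPolynomial σ K) • (I (v i α) * I (v j β)) := by
    intro i j α β c h
    rcases lt_trichotomy i j with hij | rfl | hij
    · exact hψlt i j α β c hij h
    · rw [hdiag i α β h]
      simp
    · rw [hswap, smul_neg, map_neg, map_neg,
        hψlt j i β α c hij ⟨h.2.1, h.1, by have := h.2.2; omega⟩]
  have hleft : ∀ w ∈ Ideal.span (Set.range (X : σ → MvPolynomial σ K)) •
      (⋀[MvPolynomial σ K]^2 N), ψ (ExteriorAlgebra.map N.subtype w) = w := by
    rw [hspan, Submodule.span_smul_span]
    intro w hw
    suffices ∀ r : MvPolynomial σ K, ψ (ExteriorAlgebra.map N.subtype (r • w)) = r • w by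
      simpa using this 1
    induction hw using Submodule.span_induction with
    | zero => simp
    | add x y _ _ hx hy =>
      intro r
      rw [smul_add, map_add, map_add, hx, hy]
    | smul s x _ hx =>
      intro r
      rw [smul_smul, hx]
    | mem x hx =>
      obtain ⟨_, ⟨l, rfl⟩, _, ⟨_, ⟨_, ⟨i, α, hα, rfl⟩, rfl⟩, _, ⟨_, ⟨j, β, hβ, rfl⟩, rfl⟩, rfl⟩,
        rfl⟩ := hx
      intro r
      induction r using MvPolynomial.induction_on' with
      | monomial δ c =>
        have h1 : (monomial δ c : MvPolynomial σ K) • (X l : MvPolynomial σ K) •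
            (I (v i α) * I (v j β)) = (C c : MvPolynomial σ K) •
              (I (v i (α + (δ + Finsupp.single l 1))) * I (v j β)) := by
          rw [hvadd i α _ hα, map_smul, smul_mul_assoc, smul_smul, smul_smul, X, monomial_mul,
            C_mul_monomial]
        dsimp only
        rw [h1]
        refine hψ _ _ _ _ _ ⟨?_, hβ, ?_⟩ <;> simp only [map_add, Finsupp.degree_single] <;> omega
      | add p q hp hq => rw [add_smul, map_add, map_add, hp, hq]
  intro x hx y hy hxy
  rw [← hleft x hx, ← hleft y hy, hxy]

theorem finSuccEquiv_rename_succ {K : Type*} [CommSemiring K] {n : ℕ} (r : MvPolynomial (Fin n) K) :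
    finSuccEquiv K n (rename Fin.succ r) = Polynomial.C r := by
  induction r using MvPolynomial.induction_on with
  | C a => simp [finSuccEquiv_apply]
  | add p q hp hq => simp only [map_add, hp, hq]
  | mul_X p i hp => simp only [map_mul, hp, rename_X, finSuccEquiv_X_succ]

theorem degree_finsuppCons {n : ℕ} (i : ℕ) (α : Fin n →₀ ℕ) :
    (Finsupp.cons i α).degree = i + α.degree := by
  simp [Finsupp.degree_eq_sum, Fin.sum_univ_succ]

theorem monomial_cons_eq {K : Type*} [CommSemiring K] {n : ℕ} (i : ℕ) (α : Fin n →₀ ℕ) (c : K) :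
    monomial (Finsupp.cons i α) c = rename Fin.succ (monomial α c) * X 0 ^ i := by
  have hcons : Finsupp.cons i α = Finsupp.mapDomain Fin.succ α + Finsupp.single 0 i := by
    ext j
    refine Fin.cases ?_ (fun j => ?_) j
    · rw [Finsupp.add_apply, Finsupp.mapDomain_of_notMem_range _ _ (by simp)]
      simp
    · simp [Finsupp.mapDomain_apply (Fin.succ_injective n)]
  rw [rename_monomial, X_pow_eq_monomial, monomial_mul, mul_one, hcons]

theorem eq_single_of_degree_le {n d : ℕ} {m : Fin (n + 1) →₀ ℕ} (hm : m.degree = d) (h : d ≤ m 0) :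
    m = Finsupp.single 0 d := by
  rw [← Finsupp.cons_tail m, degree_finsuppCons] at hm
  have h0 : m.tail = 0 := (Finsupp.degree_eq_zero_iff _).1 (by omega)
  have h1 : m 0 = d := by omega
  rw [← Finsupp.cons_tail m, h0, h1]
  ext j
  refine Fin.cases ?_ (fun j => ?_) j <;> simp

theorem eval_cons_one_zero {K : Type*} [CommSemiring K] {n d : ℕ} {h : MvPolynomial (Fin (n + 1)) K}
    (hhom : h.IsHomogeneous d) :
    eval (Fin.cons 1 0 : Fin (n + 1) → K) h = h.coeff (Finsupp.single 0 d) := by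
  classical
  rw [eval_eq', Finset.sum_eq_single (Finsupp.single 0 d)]
  · simp [Fin.prod_univ_succ]
  · intro m hm hne
    obtain ⟨j, hj⟩ : ∃ j : Fin n, m j.succ ≠ 0 := by
      by_contra! hall
      refine hne (eq_single_of_degree_le (d := d) ?_ ?_) <;>
      · have : m.degree = d := by
          by_contra hd
          exact mem_support_iff.1 hm (hhom.coeff_eq_zero hd)
        first
        | exact this
        | rw [← this, Finsupp.degree_eq_sum, Fin.sum_univ_succ]
          simp [hall]
    rw [Finset.prod_eq_zero (Finset.mem_univ j.succ), mul_zero]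
    simp [hj]
  · intro hm
    rw [notMem_support_iff.1 hm, zero_mul]

theorem algebraMap_quot {n : ℕ} (h : MvPolynomial (Fin (n + 1)) ℝ) (r : MvPolynomial (Fin n) ℝ) :
    algebraMap (MvPolynomial (Fin n) ℝ) (MvPolynomial (Fin (n + 1)) ℝ ⧸ Ideal.span {h}) r =
      Ideal.Quotient.mk (Ideal.span {h}) (rename Fin.succ r) := rfl

theorem monomial_smul_pow {n : ℕ} (h : MvPolynomial (Fin (n + 1)) ℝ) (i : ℕ) (α : Fin n →₀ ℕ)
    (c : ℝ) :
    (monomial α c : MvPolynomial (Fin n) ℝ) • Ideal.Quotient.mk (Ideal.span {h}) (X 0) ^ i =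
      Ideal.Quotient.mk (Ideal.span {h}) (monomial (Finsupp.cons i α) c) := by
  rw [Algebra.smul_def, algebraMap_quot, monomial_cons_eq, map_mul, map_pow]

theorem mk_monomial_eq_smul {n : ℕ} (h : MvPolynomial (Fin (n + 1)) ℝ) (m : Fin (n + 1) →₀ ℕ)
    (c : ℝ) :
    Ideal.Quotient.mk (Ideal.span {h}) (monomial m c) =
      (C c : MvPolynomial (Fin n) ℝ) • Ideal.Quotient.mk (Ideal.span {h}) (monomial m 1) := by
  rw [Algebra.smul_def, algebraMap_quot, ← map_mul, rename_C, C_mul_monomial, mul_one]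

theorem exists_monic_finSuccEquiv_s7 {K : Type*} [Field K] {n d : ℕ} {h : MvPolynomial (Fin (n + 1)) K}
    (hhom : h.IsHomogeneous d) (hc : h.coeff (Finsupp.single 0 d) ≠ 0) :
    ∃ g : Polynomial (MvPolynomial (Fin n) K), g.Monic ∧ g.natDegree = d ∧
      g ∣ finSuccEquiv K n h := by
  set c := h.coeff (Finsupp.single 0 d) with hcdef
  have hcoeff : (finSuccEquiv K n h).coeff d = C c := by
    ext m
    rw [finSuccEquiv_coeff_coeff, coeff_C]
    split_ifs with hm
    · subst hm
      rw [hcdef]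
      congr 1
      ext j
      refine Fin.cases ?_ (fun j => ?_) j <;> simp
    · refine hhom.coeff_eq_zero ?_
      rw [degree_finsuppCons]
      intro h0
      exact hm ((Finsupp.degree_eq_zero_iff m).1 (by omega)).symm
  have hdeg : (finSuccEquiv K n h).natDegree ≤ d := by
    rw [Polynomial.natDegree_le_iff_coeff_eq_zero]
    intro i hi
    ext m
    rw [finSuccEquiv_coeff_coeff, coeff_zero]
    refine hhom.coeff_eq_zero ?_
    rw [degree_finsuppCons]
    omega
  have hdeg' : (Polynomial.C (C c⁻¹) * finSuccEquiv K n h).natDegree ≤ d :=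
    (Polynomial.natDegree_C_mul_le _ _).trans hdeg
  have hone : (Polynomial.C (C c⁻¹) * finSuccEquiv K n h).coeff d = 1 := by
    rw [Polynomial.coeff_C_mul, hcoeff, ← C_mul, inv_mul_cancel₀ hc, C_1]
  refine ⟨Polynomial.C (C c⁻¹) * finSuccEquiv K n h,
    Polynomial.monic_of_natDegree_le_of_coeff_eq_one d hdeg' hone,
    le_antisymm hdeg' (Polynomial.le_natDegree_of_ne_zero (by rw [hone]; exact one_ne_zero)),
    Polynomial.C (C c), ?_⟩
  rw [mul_comm, ← mul_assoc, ← Polynomial.C_mul, ← C_mul, mul_inv_cancel₀ hc, C_1, Polynomial.C_1,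
    one_mul]

theorem exists_dual_pow {n d : ℕ} {h : MvPolynomial (Fin (n + 1)) ℝ}
    (hhom : h.IsHomogeneous d) (hc : h.coeff (Finsupp.single 0 d) ≠ 0) :
    ∃ π : Fin d → (MvPolynomial (Fin (n + 1)) ℝ ⧸ Ideal.span {h}) →ₗ[MvPolynomial (Fin n) ℝ]
      MvPolynomial (Fin n) ℝ,
      ∀ i j : Fin d, π i (Ideal.Quotient.mk (Ideal.span {h}) (X 0) ^ (j : ℕ)) =
        if i = j then 1 else 0 := by
  obtain ⟨g, hg, hdeg, hdvd⟩ := exists_monic_finSuccEquiv_s7 hhom hc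
  let θ : (MvPolynomial (Fin (n + 1)) ℝ ⧸ Ideal.span {h}) →+* AdjoinRoot g :=
    Ideal.Quotient.lift (Ideal.span {h})
      ((AdjoinRoot.mk g).comp (finSuccEquiv ℝ n : _ →+* Polynomial (MvPolynomial (Fin n) ℝ))) (by
        intro a ha
        obtain ⟨b, rfl⟩ := Ideal.mem_span_singleton.1 ha
        simp [AdjoinRoot.mk_eq_zero.2 hdvd])
  have hθ : ∀ f, θ (Ideal.Quotient.mk (Ideal.span {h}) f) = AdjoinRoot.mk g (finSuccEquiv ℝ n f) :=
    fun f => rfl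
  let Θ : (MvPolynomial (Fin (n + 1)) ℝ ⧸ Ideal.span {h}) →ₗ[MvPolynomial (Fin n) ℝ]
      AdjoinRoot g :=
    { toFun := θ
      map_add' := map_add θ
      map_smul' := by
        intro r x
        rw [Algebra.smul_def, map_mul, algebraMap_quot, hθ, finSuccEquiv_rename_succ,
          AdjoinRoot.mk_C, RingHom.id_apply, Algebra.smul_def, AdjoinRoot.algebraMap_eq] }
  refine ⟨fun i => Polynomial.lcoeff _ i ∘ₗ AdjoinRoot.modByMonicHom hg ∘ₗ Θ, fun i j => ?_⟩
  have h1 : Θ (Ideal.Quotient.mk (Ideal.span {h}) (X 0) ^ (j : ℕ)) =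
      AdjoinRoot.mk g (Polynomial.X ^ (j : ℕ)) := by
    change θ (Ideal.Quotient.mk (Ideal.span {h}) (X 0) ^ (j : ℕ)) = _
    rw [map_pow, hθ, finSuccEquiv_X_zero, map_pow]
  rw [LinearMap.comp_apply, LinearMap.comp_apply, h1, AdjoinRoot.modByMonicHom_mk,
    (Polynomial.modByMonic_eq_self_iff hg).2, Polynomial.lcoeff_apply, Polynomial.coeff_X_pow]
  · simp only [Fin.ext_iff]
  · rw [Polynomial.degree_X_pow, Polynomial.degree_eq_natDegree hg.ne_zero, hdeg]
    exact_mod_cast j.2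

theorem mk_monomial_mem_span {n d : ℕ} {h : MvPolynomial (Fin (n + 1)) ℝ}
    (hhom : h.IsHomogeneous d) (hc : h.coeff (Finsupp.single 0 d) ≠ 0) (k i : ℕ)
    (α : Fin n →₀ ℕ) (hk : k ≤ i + α.degree) :
    Ideal.Quotient.mk (Ideal.span {h}) (monomial (Finsupp.cons i α) 1) ∈
      Submodule.span (MvPolynomial (Fin n) ℝ) {x | ∃ (i : Fin d) (α : Fin n →₀ ℕ),
        k - (i : ℕ) ≤ α.degree ∧ (monomial α 1 : MvPolynomial (Fin n) ℝ) •
          Ideal.Quotient.mk (Ideal.span {h}) (X 0) ^ (i : ℕ) = x} := by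
  classical
  induction i using Nat.strong_induction_on generalizing α with
  | _ i ih =>
    by_cases hi : i < d
    · exact Submodule.subset_span ⟨⟨i, hi⟩, α, by simp only; omega, monomial_smul_pow h i α 1⟩
    have hshift : ∀ m : Fin (n + 1) →₀ ℕ, Finsupp.cons (i - d) α + m =
        Finsupp.cons (i - d + m 0) (α + m.tail) := by
      intro m
      ext j
      refine Fin.cases ?_ (fun j => ?_) j <;> simp [Finsupp.tail_apply]
    have hzero : ∑ m ∈ h.support, Ideal.Quotient.mk (Ideal.span {h})
        (monomial (Finsupp.cons (i - d) α) 1 * monomial m (h.coeff m)) = 0 := by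
      rw [← map_sum, ← Finset.mul_sum, support_sum_monomial_coeff]
      exact Ideal.Quotient.eq_zero_iff_mem.2
        (Ideal.mul_mem_left _ _ (Ideal.subset_span (Set.mem_singleton h)))
    rw [← Finset.add_sum_erase _ _ (mem_support_iff.2 hc)] at hzero
    have hrest := eq_neg_of_add_eq_zero_left hzero
    have hlead : Finsupp.cons (i - d) α + Finsupp.single 0 d = Finsupp.cons i α := by
      ext j
      refine Fin.cases ?_ (fun j => ?_) j
      · simp; omega
      · simp
    rw [monomial_mul, one_mul, hlead, mk_monomial_eq_smul] at hrest
    have hinv : (C (h.coeff (Finsupp.single 0 d))⁻¹ : MvPolynomial (Fin n) ℝ) *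
        C (h.coeff (Finsupp.single 0 d)) = 1 := by
      rw [← C_mul, inv_mul_cancel₀ hc, C_1]
    rw [← one_smul (MvPolynomial (Fin n) ℝ)
      (Ideal.Quotient.mk (Ideal.span {h}) (monomial (Finsupp.cons i α) 1)), ← hinv, mul_smul, hrest]
    refine Submodule.smul_mem _ _ (Submodule.neg_mem _ (Submodule.sum_mem _ fun m hm => ?_))
    obtain ⟨hne, hm⟩ := Finset.mem_erase.1 hm
    have hdeg : m.degree = d := by
      by_contra hd
      exact mem_support_iff.1 hm (hhom.coeff_eq_zero hd)
    have hlt : m 0 < d := by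
      by_contra hle
      exact hne (eq_single_of_degree_le hdeg (by omega))
    rw [← Finsupp.cons_tail m, degree_finsuppCons] at hdeg
    rw [monomial_mul, one_mul, hshift, mk_monomial_eq_smul]
    exact Submodule.smul_mem _ _ (ih _ (by omega) _ (by rw [map_add]; omega))

theorem Mgeq_eq_span {n d : ℕ} {h : MvPolynomial (Fin (n + 1)) ℝ}
    (hhom : h.IsHomogeneous d) (hc : h.coeff (Finsupp.single 0 d) ≠ 0) (k : ℕ) :
    Mgeq n h k =
      Submodule.span (MvPolynomial (Fin n) ℝ) {x | ∃ (i : Fin d) (α : Fin n →₀ ℕ),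
        k - (i : ℕ) ≤ α.degree ∧ (monomial α 1 : MvPolynomial (Fin n) ℝ) •
          Ideal.Quotient.mk (Ideal.span {h}) (X 0) ^ (i : ℕ) = x} := by
  refine le_antisymm (Submodule.span_le.2 ?_) (Submodule.span_mono ?_)
  · rintro _ ⟨f, df, hk, hf, rfl⟩
    rw [f.as_sum, map_sum]
    refine Submodule.sum_mem _ fun m hm => ?_
    have hdeg : m.degree = df := by
      by_contra hd
      exact mem_support_iff.1 hm (hf.coeff_eq_zero hd)
    rw [mk_monomial_eq_smul]
    refine Submodule.smul_mem _ _ ?_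
    rw [← Finsupp.cons_tail m, degree_finsuppCons] at hdeg
    rw [← Finsupp.cons_tail m]
    exact mk_monomial_mem_span hhom hc k _ _ (by omega)
  · rintro _ ⟨i, α, hk, rfl⟩
    refine ⟨monomial (Finsupp.cons i α) 1, i + α.degree, by omega,
      isHomogeneous_monomial _ (degree_finsuppCons _ _), ?_⟩
    rw [monomial_smul_pow]

/-- **Lemma.** Let `h` be homogeneous of degree `d ≥ 1` with `h(1,0,…,0) ≠ 0`, let
`M = ℝ[x₀,…,xₙ]/(h)` as a module over `R = ℝ[x₁,…,xₙ]` and `𝔪 = (x₁,…,xₙ) ⊆ R`. Then the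
map `⋀²M_{≥k} → ⋀²M` induced by the inclusion `M_{≥k} ↪ M` is injective on
`𝔪·(⋀²M_{≥k})`. -/
theorem statement7 {n d : ℕ} (hd : 1 ≤ d) (h : MvPolynomial (Fin (n + 1)) ℝ)
    (hhom : h.IsHomogeneous d)
    (hne : eval (Fin.cons 1 0 : Fin (n + 1) → ℝ) h ≠ 0) (k : ℕ) :
    Set.InjOn (ExteriorAlgebra.map (Mgeq n h k).subtype)
      ((Ideal.span (Set.range (X : Fin n → MvPolynomial (Fin n) ℝ)) •
          (⋀[MvPolynomial (Fin n) ℝ]^2 ↥(Mgeq n h k)) :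
        Submodule (MvPolynomial (Fin n) ℝ)
          (ExteriorAlgebra (MvPolynomial (Fin n) ℝ) ↥(Mgeq n h k))) : Set _) := by
  rw [eval_cons_one_zero hhom] at hne
  obtain ⟨π, hπ⟩ := exists_dual_pow hhom hne
  exact injOn_exteriorAlgebra_map_smul _ π hπ (fun i => k - (i : ℕ)) _ (Mgeq_eq_span hhom hne k)
end

section
/- Let R = ℝ[x₁,…,xₙ] with n ≥ 1, let p = x₁² + … + xₙ² ∈ R, and let r ∈ ℕ. Then Σ(p^r) = R_{≥r}. -/
open MvPolynomial

/-- `Σ(f)`: the ideal of `R = ℝ[x₁,…,xₙ]` generated by all homogeneous `v` such that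
`q·f = v² + w₁² + … + w_s²` for some homogeneous sum of squares `q` and some `wᵢ ∈ R`. -/
noncomputable def SigmaIdeal {n : ℕ} (f : MvPolynomial (Fin n) ℝ) : Ideal (MvPolynomial (Fin n) ℝ) :=
  Ideal.span {v | (∃ dv, v.IsHomogeneous dv) ∧
    ∃ (q : MvPolynomial (Fin n) ℝ) (dq : ℕ), IsSOS q ∧ q.IsHomogeneous dq ∧
      ∃ (s : ℕ) (w : Fin s → MvPolynomial (Fin n) ℝ), q * f = v ^ 2 + ∑ i, (w i) ^ 2}

/-- A homogeneous polynomial of degree `d` scales by `t ^ d` along lines through the origin. -/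
theorem eval_smul_of_isHomogeneous {σ R : Type*} [CommSemiring R] {φ : MvPolynomial σ R} {d : ℕ}
    (hφ : φ.IsHomogeneous d) (t : R) (x : σ → R) :
    eval (t • x) φ = t ^ d * eval x φ := by
  rw [eval_eq, eval_eq, Finset.mul_sum]
  refine Finset.sum_congr rfl fun m hm => ?_
  have hdeg : ∑ i ∈ m.support, m i = d := by
    rw [← Finsupp.degree_apply, Finsupp.degree_eq_weight_one]
    exact hφ (mem_support_iff.mp hm)
  simp only [Pi.smul_apply, smul_eq_mul, mul_pow, Finset.prod_mul_distrib, Finset.prod_pow_eq_pow_sum,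
    hdeg]
  ring

theorem exists_eq_sum_sq_of_isSumSq {R : Type*} [CommSemiring R] {a : R} (ha : IsSumSq a) :
    ∃ (s : ℕ) (w : Fin s → R), a = ∑ i, w i ^ 2 := by
  induction ha with
  | zero => exact ⟨0, 0, by simp⟩
  | sq_add b _ ih =>
    obtain ⟨s, w, rfl⟩ := ih
    exact ⟨s + 1, Fin.cons b w, by simp [Fin.sum_univ_succ, sq]⟩

/-- If `a * t ^ k ≤ b * t ^ m` for all `t ∈ (0, 1]` and `0 < a`, then `m ≤ k`. -/
theorem le_of_forall_mul_pow_le_mul_pow {a b : ℝ} {k m : ℕ} (ha : 0 < a)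
    (h : ∀ t : ℝ, 0 < t → t ≤ 1 → a * t ^ k ≤ b * t ^ m) : m ≤ k := by
  by_contra! hlt
  obtain ⟨c, rfl⟩ := Nat.exists_eq_add_of_lt hlt
  have hab : a ≤ b := by simpa using h 1 one_pos le_rfl
  have hb : 0 < b := ha.trans_le hab
  set t := a / (2 * b) with ht
  have ht0 : 0 < t := by positivity
  have ht1 : t ≤ 1 := by
    rw [ht, div_le_one (by positivity)]
    linarith
  have hbt : b * t = a / 2 := by
    rw [ht]
    field_simp
  have key : a * t ^ k ≤ a / 2 * t ^ k :=
    calc a * t ^ k ≤ b * t ^ (k + c + 1) := h t ht0 ht1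
      _ ≤ b * t ^ (k + 1) :=
        mul_le_mul_of_nonneg_left (pow_le_pow_of_le_one ht0.le ht1 (by omega)) hb.le
      _ = a / 2 * t ^ k := by rw [← hbt]; ring
  have := le_of_mul_le_mul_right key (pow_pos ht0 k)
  linarith

/-- If the square of a nonzero form `v` is bounded by a form of degree `m`, then
`m ≤ 2 * deg v`. -/
theorem le_two_mul_of_eval_sq_le {σ : Type*} {v f : MvPolynomial σ ℝ} {d m : ℕ}
    (hv : v.IsHomogeneous d) (hf : f.IsHomogeneous m) (hv0 : v ≠ 0)
    (hle : ∀ x, eval x v ^ 2 ≤ eval x f) : m ≤ 2 * d := by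
  obtain ⟨x, hx⟩ : ∃ x, eval x v ≠ 0 := by
    by_contra! h
    exact hv0 (MvPolynomial.funext fun x => by simpa using h x)
  refine le_of_forall_mul_pow_le_mul_pow (a := eval x v ^ 2) (b := eval x f) (by positivity)
    fun t _ _ => ?_
  have := hle (t • x)
  rw [eval_smul_of_isHomogeneous hv, eval_smul_of_isHomogeneous hf] at this
  calc eval x v ^ 2 * t ^ (2 * d) = (t ^ d * eval x v) ^ 2 := by ring
    _ ≤ t ^ m * eval x f := this
    _ = eval x f * t ^ m := mul_comm _ _

theorem isHomogeneous_sum_X_sq_pow {σ R : Type*} [Fintype σ] [CommSemiring R] (r : ℕ) :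
    ((∑ i : σ, X i ^ 2 : MvPolynomial σ R) ^ r).IsHomogeneous (2 * r) :=
  (IsHomogeneous.sum _ _ _ fun i _ => isHomogeneous_X_pow i 2).pow r

theorem sigmaIdeal_le_pow_idealOfVars {n : ℕ} (r : ℕ) :
    SigmaIdeal ((∑ i : Fin n, X i ^ 2) ^ r) ≤ idealOfVars (Fin n) ℝ ^ r := by
  refine Ideal.span_le.mpr ?_
  rintro v ⟨⟨d, hv⟩, q, dq, -, hq, s, w, hw⟩
  refine (mem_pow_idealOfVars_iff r v).mpr fun m hm => ?_
  have hv0 : v ≠ 0 := by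
    rintro rfl
    simp at hm
  have hle := le_two_mul_of_eval_sq_le hv (hq.mul (isHomogeneous_sum_X_sq_pow r)) hv0 fun x => by
    rw [hw, map_add, map_pow, map_sum]
    exact le_add_of_nonneg_right (Finset.sum_nonneg fun i _ => by rw [map_pow]; positivity)
  have hdeg : Finsupp.degree m = d := by
    rw [Finsupp.degree_eq_weight_one]
    exact hv (mem_support_iff.mp hm)
  omega

open scoped Pointwise in
/-- For a product `v` of `r` variables, `(∑ Xᵢ²) ^ r - v²` is a sum of squares. -/
theorem exists_isSumSq_of_mem_range_X_pow {σ R : Type*} [Fintype σ] [CommSemiring R] (r : ℕ)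
    {v : MvPolynomial σ R} (hv : v ∈ (Set.range X : Set (MvPolynomial σ R)) ^ r) :
    v.IsHomogeneous r ∧ ∃ a, IsSumSq a ∧ (∑ i : σ, X i ^ 2) ^ r = v ^ 2 + a := by
  classical
  induction r generalizing v with
  | zero =>
    obtain rfl : v = 1 := by simpa using hv
    exact ⟨isHomogeneous_one _ _, 0, .zero, by simp⟩
  | succ r ih =>
    rw [pow_succ] at hv
    obtain ⟨u, hu, _, ⟨i, rfl⟩, rfl⟩ := Set.mem_mul.mp hv
    obtain ⟨hhom, a, ha, h⟩ := ih hu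
    refine ⟨hhom.mul (isHomogeneous_X _ i),
      u ^ 2 * ∑ j ∈ Finset.univ.erase i, X j ^ 2 + a * ∑ j, X j ^ 2, ?_, ?_⟩
    · exact (((IsSquare.sq u).isSumSq).mul (IsSumSq.sum_sq _ _)).add
        (ha.mul (IsSumSq.sum_sq _ _))
    · rw [pow_succ, h, add_mul, ← Finset.add_sum_erase Finset.univ _ (Finset.mem_univ i)]
      ring

theorem pow_idealOfVars_le_sigmaIdeal {n : ℕ} (r : ℕ) :
    idealOfVars (Fin n) ℝ ^ r ≤ SigmaIdeal ((∑ i : Fin n, X i ^ 2) ^ r) := by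
  rw [idealOfVars, Ideal.span, Submodule.span_pow]
  refine Submodule.span_le.mpr fun v hv => Ideal.subset_span ?_
  obtain ⟨hhom, a, ha, h⟩ := exists_isSumSq_of_mem_range_X_pow r hv
  obtain ⟨s, w, rfl⟩ := exists_eq_sum_sq_of_isSumSq ha
  exact ⟨⟨r, hhom⟩, 1, 0, ⟨1, 1, by simp⟩, isHomogeneous_one _ _, s, w, by rw [one_mul, h]⟩

theorem mem_pow_idealOfVars_iff_homogeneousComponent {σ R : Type*} [CommSemiring R] (r : ℕ)
    (g : MvPolynomial σ R) :
    g ∈ idealOfVars σ R ^ r ↔ ∀ i < r, homogeneousComponent i g = 0 := by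
  rw [mem_pow_idealOfVars_iff']
  constructor
  · intro h i hi
    ext m
    rw [coeff_homogeneousComponent, coeff_zero]
    split_ifs with hm
    · exact h m (hm ▸ hi)
    · rfl
  · intro h m hm
    simpa [coeff_homogeneousComponent] using congrArg (coeff m) (h _ hm)

/-- **Example.** For `p = x₁² + … + xₙ²` (with `n ≥ 1`) and any `r ∈ ℕ` one has
`Σ(p^r) = R_{≥r}`, the ideal of polynomials all of whose nonzero homogeneous components
have degree `≥ r`. -/
theorem statement8 {n : ℕ} (hn : 1 ≤ n) (r : ℕ) :
    (SigmaIdeal ((∑ i : Fin n, X i ^ 2) ^ r) : Set (MvPolynomial (Fin n) ℝ)) =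
      {g | ∀ i < r, homogeneousComponent i g = 0} := by
  ext g
  rw [SetLike.mem_coe, Set.mem_ofPred_eq, ← mem_pow_idealOfVars_iff_homogeneousComponent,
    (sigmaIdeal_le_pow_idealOfVars r).antisymm (pow_idealOfVars_le_sigmaIdeal r)]
end

section
/- Let R = ℝ[x₁,…,xₙ], fix m ≥ 1 and natural numbers α₁,…,α_m, and let Λ be a symmetric m×m matrix with entries in R that is homogeneous of some degree D. If v₁,…,v_r ∈ Σ(Λ) are all homogeneous of the same degree k, then there exist a homogeneous polynomial q ∈ R that is a sum of squares in R and vectors w₁,…,w_s ∈ R^m such that q·Λ = v₁·v₁ᵀ + … + v_r·v_rᵀ + w₁·w₁ᵀ + … + w_s·w_sᵀ (as matrices over R). -/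
open MvPolynomial

/-- A vector `v ∈ R^m` is homogeneous of degree `k` (for the twists `α₁,…,α_m`) if its
`i`-th coordinate is homogeneous of degree `k − αᵢ`, and zero whenever `k < αᵢ`. -/
def IsVHomog {n m : ℕ} (α : Fin m → ℕ) (k : ℕ)
    (v : Fin m → MvPolynomial (Fin n) ℝ) : Prop :=
  ∀ i, ((v i).IsHomogeneous (k - α i) ∧ (k < α i → v i = 0))

/-- A symmetric `m×m` matrix `Λ` over `R` is homogeneous of degree `D` (for the twists
`α₁,…,α_m`) if its `(i,j)` entry is homogeneous of degree `D − αᵢ − αⱼ`, and zero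
whenever `D < αᵢ + αⱼ`. -/
def IsMatHomog {n m : ℕ} (α : Fin m → ℕ) (D : ℕ)
    (Λ : Matrix (Fin m) (Fin m) (MvPolynomial (Fin n) ℝ)) : Prop :=
  ∀ i j, ((Λ i j).IsHomogeneous (D - α i - α j) ∧ (D < α i + α j → Λ i j = 0))

/-- `Σ(Λ)`: the `R`-submodule of `R^m` generated by all homogeneous vectors `v` such that
`q·Λ = v·vᵀ + w₁·w₁ᵀ + … + w_s·w_sᵀ` for some homogeneous sum of squares `q ∈ R` and
vectors `w₁,…,w_s ∈ R^m`. -/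
noncomputable def SigmaMod {n m : ℕ} (α : Fin m → ℕ)
    (Λ : Matrix (Fin m) (Fin m) (MvPolynomial (Fin n) ℝ)) :
    Submodule (MvPolynomial (Fin n) ℝ) (Fin m → MvPolynomial (Fin n) ℝ) :=
  Submodule.span _ {v | (∃ k, IsVHomog α k v) ∧
    ∃ (q : MvPolynomial (Fin n) ℝ) (dq : ℕ), IsSOS q ∧ q.IsHomogeneous dq ∧
      ∃ (s : ℕ) (w : Fin s → (Fin m → MvPolynomial (Fin n) ℝ)),
        q • Λ = Matrix.vecMulVec v v + ∑ l, Matrix.vecMulVec (w l) (w l)}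

theorem AddSubmonoid.mem_closure_range_iff_exists_fin_sum {ι M : Type*} [AddCommMonoid M]
    (f : ι → M) (x : M) :
    x ∈ AddSubmonoid.closure (Set.range f) ↔ ∃ (s : ℕ) (w : Fin s → ι), x = ∑ i, f (w i) := by
  constructor
  · intro hx
    induction hx using AddSubmonoid.closure_induction with
    | mem x hx =>
      obtain ⟨w, rfl⟩ := hx
      exact ⟨1, fun _ ↦ w, by simp⟩
    | zero => exact ⟨0, Fin.elim0, by simp⟩
    | add x y _ _ hx hy =>
      obtain ⟨s, w, rfl⟩ := hx
      obtain ⟨s', w', rfl⟩ := hy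
      exact ⟨s + s', Fin.append w w', by simp [Fin.sum_univ_add]⟩
  · rintro ⟨s, w, rfl⟩
    exact _root_.sum_mem fun i _ ↦ AddSubmonoid.subset_closure (Set.mem_range_self _)

/-- The cone of sums of matrices `w·wᵀ`. -/
def gramCone (m : ℕ) (A : Type*) [CommRing A] : AddSubmonoid (Matrix (Fin m) (Fin m) A) :=
  AddSubmonoid.closure (Set.range fun w : Fin m → A ↦ Matrix.vecMulVec w w)

theorem mem_gramCone {m : ℕ} {A : Type*} [CommRing A] {M : Matrix (Fin m) (Fin m) A} :
    M ∈ gramCone m A ↔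
      ∃ (s : ℕ) (w : Fin s → (Fin m → A)), M = ∑ l, Matrix.vecMulVec (w l) (w l) :=
  AddSubmonoid.mem_closure_range_iff_exists_fin_sum _ _

theorem vecMulVec_self_mem_gramCone {m : ℕ} {A : Type*} [CommRing A] (w : Fin m → A) :
    Matrix.vecMulVec w w ∈ gramCone m A :=
  AddSubmonoid.subset_closure ⟨w, rfl⟩

theorem vecMulVec_smul_self {m : ℕ} {A : Type*} [CommRing A] (p : A) (w : Fin m → A) :
    Matrix.vecMulVec (p • w) (p • w) = p ^ 2 • Matrix.vecMulVec w w := by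
  ext i j
  simp only [Matrix.vecMulVec_apply, Matrix.smul_apply, Pi.smul_apply, smul_eq_mul]
  ring

theorem sq_smul_mem_gramCone {m : ℕ} {A : Type*} [CommRing A] (p : A)
    {M : Matrix (Fin m) (Fin m) A} (hM : M ∈ gramCone m A) : p ^ 2 • M ∈ gramCone m A := by
  obtain ⟨s, w, rfl⟩ := mem_gramCone.1 hM
  rw [Finset.smul_sum]
  exact sum_mem fun l _ ↦ vecMulVec_smul_self p (w l) ▸ vecMulVec_self_mem_gramCone _

theorem IsSOS.zero {n : ℕ} : IsSOS (0 : MvPolynomial (Fin n) ℝ) := ⟨0, Fin.elim0, by simp⟩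

theorem IsSOS.add {n : ℕ} {p q : MvPolynomial (Fin n) ℝ} (hp : IsSOS p) (hq : IsSOS q) :
    IsSOS (p + q) := by
  obtain ⟨s, g, rfl⟩ := hp
  obtain ⟨t, h, rfl⟩ := hq
  exact ⟨s + t, Fin.append g h, by simp [Fin.sum_univ_add]⟩

theorem IsSOS.sq_mul {n : ℕ} {q : MvPolynomial (Fin n) ℝ} (hq : IsSOS q)
    (p : MvPolynomial (Fin n) ℝ) : IsSOS (p ^ 2 * q) := by
  obtain ⟨s, g, rfl⟩ := hq
  exact ⟨s, fun i ↦ p * g i, by simp [Finset.mul_sum, mul_pow]⟩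

theorem MvPolynomial.IsHomogeneous.eval_smul {σ A : Type*} [CommSemiring A]
    {p : MvPolynomial σ A} {d : ℕ} (hp : p.IsHomogeneous d) (t : A) (x : σ → A) :
    eval (t • x) p = t ^ d * eval x p := by
  rw [eval_eq, eval_eq, Finset.mul_sum]
  refine Finset.sum_congr rfl fun e he ↦ ?_
  simp only [Pi.smul_apply, smul_eq_mul, mul_pow, Finset.prod_mul_distrib,
    Finset.prod_pow_eq_pow_sum]
  rw [hp.degree_eq_sum_deg_support he]
  ring

theorem eq_of_forall_pos_mul_pow_le {a b : ℝ} {d e : ℕ} (hb : 0 < b)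
    (h : ∀ t : ℝ, 0 < t → b * t ^ e ≤ a * t ^ d) : d = e := by
  have ha : 0 < a := by have := h 1 one_pos; simp at this; linarith
  by_contra hne
  rcases Nat.lt_or_gt_of_ne hne with hlt | hlt
  · obtain ⟨c, rfl⟩ := Nat.exists_eq_add_of_lt hlt
    have ht : 0 < a / b + 1 := by positivity
    have h1 := h _ ht
    have h2 : b * (a / b + 1) ^ (c + 1) ≤ a := by
      have : 0 < (a / b + 1) ^ d := by positivity
      refine le_of_mul_le_mul_right ?_ this
      calc _ = b * (a / b + 1) ^ (d + c + 1) := by ring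
        _ ≤ _ := h1
    have h3 : a / b + 1 ≤ (a / b + 1) ^ (c + 1) :=
      le_self_pow₀ (by linarith [div_pos ha hb]) (by omega)
    have h4 : b * (a / b + 1) = a + b := by field_simp
    nlinarith
  · obtain ⟨c, rfl⟩ := Nat.exists_eq_add_of_lt hlt
    have ht : 0 < b / (a + b) := by positivity
    have h1 := h _ ht
    have h2 : b ≤ a * (b / (a + b)) ^ (c + 1) := by
      have : 0 < (b / (a + b)) ^ e := by positivity
      refine le_of_mul_le_mul_right (h1.trans_eq ?_) this
      ring
    have h3 : (b / (a + b)) ^ (c + 1) ≤ b / (a + b) :=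
      pow_le_of_le_one ht.le ((div_le_one (by positivity)).2 (by linarith)) (by omega)
    have h4 : a * (b / (a + b)) < b := by
      rw [← mul_div_assoc, div_lt_iff₀ (by positivity)]
      nlinarith
    nlinarith

theorem MvPolynomial.IsHomogeneous.degree_eq_two_mul_of_sq_le {σ : Type*}
    {f h : MvPolynomial σ ℝ} {d e : ℕ} (hf : f.IsHomogeneous d) (hh : h.IsHomogeneous e)
    (hne : h ≠ 0) (hle : ∀ x, eval x h ^ 2 ≤ eval x f) : d = 2 * e := by
  obtain ⟨x, hx⟩ : ∃ x, eval x h ≠ 0 := by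
    by_contra! H
    exact hne (MvPolynomial.funext fun x ↦ by simpa using H x)
  refine eq_of_forall_pos_mul_pow_le (a := eval x f) (b := eval x h ^ 2) (by positivity)
    fun t _ ↦ ?_
  have := hle (t • x)
  rw [hf.eval_smul, hh.eval_smul] at this
  calc _ = (t ^ e * eval x h) ^ 2 := by ring
    _ ≤ _ := this
    _ = _ := mul_comm _ _

theorem eval_diag_nonneg_of_mem_gramCone {n m : ℕ}
    {M : Matrix (Fin m) (Fin m) (MvPolynomial (Fin n) ℝ)} (hM : M ∈ gramCone m _)
    (i : Fin m) (x : Fin n → ℝ) : 0 ≤ eval x (M i i) := by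
  obtain ⟨s, w, rfl⟩ := mem_gramCone.1 hM
  simp only [Matrix.sum_apply, Matrix.vecMulVec_apply, map_sum, map_mul]
  exact Finset.sum_nonneg fun l _ ↦ mul_self_nonneg _

/-- In an identity `q·Λ = v·vᵀ + Σ wⱼ·wⱼᵀ` with `v ≠ 0`, the degrees satisfy
`deg q + deg Λ = 2 deg v`. -/
theorem degree_add_eq_two_mul {n m : ℕ} {α : Fin m → ℕ} {D k d : ℕ}
    {Λ M : Matrix (Fin m) (Fin m) (MvPolynomial (Fin n) ℝ)} (hΛ : IsMatHomog α D Λ)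
    {v : Fin m → MvPolynomial (Fin n) ℝ} (hv : IsVHomog α k v) (hne : v ≠ 0)
    {q : MvPolynomial (Fin n) ℝ} (hq : q.IsHomogeneous d) (hM : M ∈ gramCone m _)
    (h : q • Λ = Matrix.vecMulVec v v + M) : d + D = 2 * k := by
  obtain ⟨i, hi⟩ := Function.ne_iff.1 hne
  have hii : q * Λ i i = v i * v i + M i i := congrFun (congrFun h i) i
  have hle : ∀ x, eval x (v i) ^ 2 ≤ eval x (q * Λ i i) := fun x ↦ by
    rw [hii, map_add, map_mul, ← sq]
    exact le_add_of_nonneg_right (eval_diag_nonneg_of_mem_gramCone hM i x)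
  have hk : α i ≤ k := not_lt.1 fun hlt ↦ hi ((hv i).2 hlt)
  have hD : α i + α i ≤ D := by
    refine not_lt.1 fun hlt ↦ hi (MvPolynomial.funext fun x ↦ ?_)
    have := hle x
    rw [(hΛ i i).2 hlt, mul_zero, map_zero] at this
    simpa using pow_eq_zero_iff two_ne_zero |>.1 (le_antisymm this (sq_nonneg _))
  have := (hq.mul (hΛ i i).1).degree_eq_two_mul_of_sq_le (hv i).1 hi hle
  omega

/-- `M` is dominated by a multiple `q·Λ`, where `q` is a sum of squares that is homogeneous of
degree `2 * k - D`, and vanishes if `2 * k < D`. -/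
def IsDominated {n m : ℕ} (D k : ℕ) (Λ M : Matrix (Fin m) (Fin m) (MvPolynomial (Fin n) ℝ)) :
    Prop :=
  ∃ q : MvPolynomial (Fin n) ℝ, IsSOS q ∧ q.IsHomogeneous (2 * k - D) ∧ (2 * k < D → q = 0) ∧
    ∃ N ∈ gramCone m _, q • Λ = M + N

namespace IsDominated

variable {n m D k : ℕ} {Λ M M' : Matrix (Fin m) (Fin m) (MvPolynomial (Fin n) ℝ)}
  {v w : Fin m → MvPolynomial (Fin n) ℝ}

theorem zero : IsDominated D k Λ 0 :=
  ⟨0, .zero, isHomogeneous_zero _ _ _, fun _ ↦ rfl, 0, zero_mem _, by simp⟩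

theorem add (h : IsDominated D k Λ M) (h' : IsDominated D k Λ M') :
    IsDominated D k Λ (M + M') := by
  obtain ⟨q, hs, hq, h0, N, hN, e⟩ := h
  obtain ⟨q', hs', hq', h0', N', hN', e'⟩ := h'
  refine ⟨q + q', hs.add hs', hq.add hq', fun hlt ↦ by rw [h0 hlt, h0' hlt, add_zero],
    N + N', add_mem hN hN', ?_⟩
  rw [add_smul, e, e', add_add_add_comm]

theorem sum {ι : Type*} (s : Finset ι)
    (f : ι → Matrix (Fin m) (Fin m) (MvPolynomial (Fin n) ℝ))
    (h : ∀ i ∈ s, IsDominated D k Λ (f i)) : IsDominated D k Λ (∑ i ∈ s, f i) :=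
  Finset.sum_induction f _ (fun _ _ ↦ add) zero h

theorem of_add_right (h : IsDominated D k Λ (M + M')) (hM' : M' ∈ gramCone m _) :
    IsDominated D k Λ M := by
  obtain ⟨q, hs, hq, h0, N, hN, e⟩ := h
  exact ⟨q, hs, hq, h0, M' + N, add_mem hM' hN, by rw [e, add_assoc]⟩

theorem vecMulVec_add (hv : IsDominated D k Λ (Matrix.vecMulVec v v))
    (hw : IsDominated D k Λ (Matrix.vecMulVec w w)) :
    IsDominated D k Λ (Matrix.vecMulVec (v + w) (v + w)) := by
  refine of_add_right (M' := Matrix.vecMulVec (v - w) (v - w)) ?_ (vecMulVec_self_mem_gramCone _)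
  convert (hv.add hw).add (hv.add hw) using 1
  ext1 i j
  simp only [Matrix.add_apply, Matrix.vecMulVec_apply, Pi.add_apply, Pi.sub_apply]
  ring

theorem vecMulVec_smul {p : MvPolynomial (Fin n) ℝ} {e : ℕ} (hp : p.IsHomogeneous e)
    (h : IsDominated D k Λ (Matrix.vecMulVec v v)) :
    IsDominated D (e + k) Λ (Matrix.vecMulVec (p • v) (p • v)) := by
  obtain ⟨q, hs, hq, h0, N, hN, eq⟩ := h
  have key : p ^ 2 • q • Λ = Matrix.vecMulVec (p • v) (p • v) + p ^ 2 • N := by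
    rw [eq, smul_add, vecMulVec_smul_self]
  rw [← mul_smul] at key
  by_cases hlt : 2 * k < D
  · refine ⟨0, .zero, isHomogeneous_zero _ _ _, fun _ ↦ rfl, _, sq_smul_mem_gramCone p hN, ?_⟩
    rw [← key, h0 hlt, mul_zero]
  · refine ⟨p ^ 2 * q, hs.sq_mul p, ?_, fun _ ↦ by omega, _, sq_smul_mem_gramCone p hN, key⟩
    convert (hp.pow 2).mul hq using 1
    omega

end IsDominated

theorem homogeneousComponent_mul_of_isHomogeneous {σ A : Type*} [CommSemiring A]
    (p : MvPolynomial σ A) {h : MvPolynomial σ A} {e : ℕ} (hh : h.IsHomogeneous e) (d : ℕ) :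
    homogeneousComponent d (p * h) =
      if e ≤ d then homogeneousComponent (d - e) p * h else 0 := by
  let := gradedAlgebra (σ := σ) (R := A)
  have := DirectSum.coe_decompose_mul_of_right_mem (homogeneousSubmodule σ A) (a := p) d
    ((mem_homogeneousSubmodule e h).2 hh)
  have key (i : ℕ) (q : MvPolynomial σ A) :
      (DirectSum.decompose (homogeneousSubmodule σ A) q i : MvPolynomial σ A) =
        homogeneousComponent i q := decomposition.decompose'_apply q i
  rwa [key, key] at this

/-- The homogeneous component of degree `k` of a vector, for the twists `α`. -/
noncomputable def vecComponent {n m : ℕ} (α : Fin m → ℕ) (k : ℕ)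
    (v : Fin m → MvPolynomial (Fin n) ℝ) : Fin m → MvPolynomial (Fin n) ℝ :=
  fun i ↦ if α i ≤ k then homogeneousComponent (k - α i) (v i) else 0

section

variable {n m : ℕ} {α : Fin m → ℕ} {k l : ℕ} {v w : Fin m → MvPolynomial (Fin n) ℝ}

theorem vecComponent_zero : vecComponent α k (0 : Fin m → MvPolynomial (Fin n) ℝ) = 0 := by
  ext1 i
  simp [vecComponent]

theorem vecComponent_add : vecComponent α k (v + w) = vecComponent α k v + vecComponent α k w := by
  ext1 i
  by_cases h : α i ≤ k <;> simp [vecComponent, h]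

theorem IsVHomog.vecComponent_eq (hv : IsVHomog α k v) : vecComponent α k v = v := by
  ext1 i
  by_cases h : α i ≤ k
  · simp [vecComponent, h, homogeneousComponent_eq_self (hv i).1]
  · simp [vecComponent, h, (hv i).2 (not_le.1 h)]

theorem IsVHomog.vecComponent_smul (hv : IsVHomog α l v) (p : MvPolynomial (Fin n) ℝ) :
    vecComponent α k (p • v) = if l ≤ k then homogeneousComponent (k - l) p • v else 0 := by
  ext1 i
  by_cases hl : l < α i
  · simp [vecComponent, (hv i).2 hl, apply_ite (fun u : Fin m → MvPolynomial (Fin n) ℝ ↦ u i)]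
  · simp only [vecComponent, Pi.smul_apply, smul_eq_mul,
      homogeneousComponent_mul_of_isHomogeneous p (hv i).1]
    by_cases hk : l ≤ k
    · rw [if_pos (by omega), if_pos (by omega), if_pos hk, Pi.smul_apply, smul_eq_mul,
        show k - α i - (l - α i) = k - l by omega]
    · rw [if_neg hk, Pi.zero_apply]
      split_ifs <;> first | rfl | omega

theorem isDominated_vecComponent {D : ℕ} {Λ : Matrix (Fin m) (Fin m) (MvPolynomial (Fin n) ℝ)}
    (hΛ : IsMatHomog α D Λ) (hv : v ∈ SigmaMod α Λ) (k : ℕ) :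
    IsDominated D k Λ (Matrix.vecMulVec (vecComponent α k v) (vecComponent α k v)) := by
  induction hv using Submodule.closure_induction with
  | zero => simpa [vecComponent_zero] using IsDominated.zero
  | add x y _ _ hx hy =>
    rw [vecComponent_add]
    exact hx.vecMulVec_add hy
  | smul_mem p g hg =>
    obtain ⟨⟨l, hl⟩, q, d, hs, hq, s, w, h⟩ := hg
    rw [hl.vecComponent_smul]
    split_ifs with hlk
    · by_cases hne : g = 0
      · simpa [hne] using IsDominated.zero
      have hN := mem_gramCone.2 ⟨s, w, rfl⟩
      have hd := degree_add_eq_two_mul hΛ hl hne hq hN h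
      have hg : IsDominated D l Λ (Matrix.vecMulVec g g) :=
        ⟨q, hs, by rwa [← hd, Nat.add_sub_cancel], fun _ ↦ by omega, _, hN, h⟩
      simpa [Nat.sub_add_cancel hlk] using
        hg.vecMulVec_smul (homogeneousComponent_isHomogeneous (k - l) p)
    · simpa using IsDominated.zero

end

/-- **Lemma.** If `Λ` is a symmetric homogeneous `m×m` matrix over `R = ℝ[x₁,…,xₙ]` and
`v₁,…,v_r ∈ Σ(Λ)` are homogeneous of the same degree `k`, then there are a homogeneous
sum of squares `q ∈ R` and vectors `w₁,…,w_s ∈ R^m` with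
`q·Λ = Σᵢ vᵢ·vᵢᵀ + Σⱼ wⱼ·wⱼᵀ`. -/
theorem statement9 {n m : ℕ} (hm : 1 ≤ m) (α : Fin m → ℕ) (D : ℕ)
    (Λ : Matrix (Fin m) (Fin m) (MvPolynomial (Fin n) ℝ)) (hsymm : Λ.IsSymm)
    (hΛ : IsMatHomog α D Λ) (r k : ℕ) (v : Fin r → (Fin m → MvPolynomial (Fin n) ℝ))
    (hmem : ∀ i, v i ∈ SigmaMod α Λ) (hv : ∀ i, IsVHomog α k (v i)) :
    ∃ (q : MvPolynomial (Fin n) ℝ) (dq : ℕ), IsSOS q ∧ q.IsHomogeneous dq ∧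
      ∃ (s : ℕ) (w : Fin s → (Fin m → MvPolynomial (Fin n) ℝ)),
        q • Λ = ∑ i, Matrix.vecMulVec (v i) (v i) + ∑ l, Matrix.vecMulVec (w l) (w l) := by
  obtain ⟨q, hs, hq, -, N, hN, h⟩ : IsDominated D k Λ (∑ i, Matrix.vecMulVec (v i) (v i)) :=
    IsDominated.sum _ _ fun i _ ↦ by
      simpa only [(hv i).vecComponent_eq] using isDominated_vecComponent hΛ (hmem i) k
  obtain ⟨s, w, rfl⟩ := mem_gramCone.1 hN
  exact ⟨q, _, hs, hq, s, w, h⟩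
end
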